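/- Let N ≥ 2 and 0 < s < 1. There exists a constant σ₂ > 0, depending only on N and s, such that for every open set Ω ⊆ ℝ^N with finite positive Lebesgue measure and every open ball B ⊆ ℝ^N one has T_s(B)/|B|^{(N+2s)/N} − T_s(Ω)/|Ω|^{(N+2s)/N} ≥ σ₂ (1−s) · A(Ω)^{3/s}. -/

import Mathlib

open MeasureTheory Filter
open scoped ENNReal NNReal Topology FourierTransform RealInnerProductSpace

noncomputable section

/-- Euclidean space ℝ^N -/
abbrev Eu (N : ℕ) := EuclideanSpace ℝ (Fin N)

/-- Squared Gagliardo seminorm `[u]_{W^{s,2}}²`, as an extended nonnegative real. -/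
def gagliardoSq (N : ℕ) (s : ℝ) (u : Eu N → ℝ) : ℝ≥0∞ :=
  ∫⁻ x, ∫⁻ y, ENNReal.ofReal (|u x - u y| ^ 2 / ‖x - y‖ ^ ((N : ℝ) + 2 * s))

/-- Squared Gagliardo seminorm, as a real number. -/
def gagliardoSqR (N : ℕ) (s : ℝ) (u : Eu N → ℝ) : ℝ :=
  (gagliardoSq N s u).toReal

/-- The sharp fractional Poincaré–Sobolev constant
`λ_{s,q}(Ω) = inf { [u]_{W^{s,2}}² : u ∈ C_c^∞(Ω), ‖u‖_{L^q(Ω)} = 1 }`. -/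
def sobolevConst (N : ℕ) (s q : ℝ) (Ω : Set (Eu N)) : ℝ :=
  sInf { c : ℝ | ∃ u : Eu N → ℝ, ContDiff ℝ (⊤ : ℕ∞) u ∧ HasCompactSupport u ∧
    tsupport u ⊆ Ω ∧ (∫ x in Ω, |u x| ^ q) = 1 ∧ c = gagliardoSqR N s u }

/-- The Fraenkel asymmetry `A(Ω)`. -/
def asym (N : ℕ) (Ω : Set (Eu N)) : ℝ :=
  sInf { c : ℝ | ∃ (x₀ : Eu N) (r : ℝ), 0 < r ∧
    volume (Metric.ball x₀ r) = volume Ω ∧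
    c = (volume (symmDiff Ω (Metric.ball x₀ r))).toReal / (volume Ω).toReal }

/-- The normalizing constant `β_{N,s}`. -/
def betaC (N : ℕ) (s : ℝ) : ℝ :=
  (∫ x : Eu N, ((1 : ℝ) + ‖x‖ ^ 2) ^ (-((N : ℝ) + 2 * s) / 2))⁻¹

/-- The Poisson kernel `P_z(x) = β_{N,s} z^{2s} (z² + |x|²)^{-(N+2s)/2}`. -/
def poisson (N : ℕ) (s z : ℝ) (x : Eu N) : ℝ :=
  betaC N s * z ^ (2 * s) * ((z ^ 2 + ‖x‖ ^ 2) ^ (-((N : ℝ) + 2 * s) / 2))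

/-- The Caffarelli–Silvestre extension `U(x,z) = (P_z ∗ u)(x)`. -/
def csExt (N : ℕ) (s : ℝ) (u : Eu N → ℝ) (x : Eu N) (z : ℝ) : ℝ :=
  ∫ y, poisson N s z (x - y) * u y

/-- A first minimizer for `λ_{s,q}(Ω)`: a nonnegative measurable function, vanishing a.e.
outside `Ω`, with unit `L^q` norm, realizing the infimum, and positive inside `Ω`. -/
def IsFirstMinimizer (N : ℕ) (s q : ℝ) (Ω : Set (Eu N)) (u : Eu N → ℝ) : Prop :=
  Measurable u ∧ (∀ x, 0 ≤ u x) ∧ (∀ᵐ x, x ∉ Ω → u x = 0) ∧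
  (∫ x in Ω, u x ^ q) = 1 ∧ gagliardoSqR N s u = sobolevConst N s q Ω ∧
  ∀ x ∈ Ω, 0 < u x

/-- The level `T` from (4.1): `T = sup { t > 0 : |{u > t}| ≥ |Ω| (1 - A(Ω)/9) }`. -/
def levelT (N : ℕ) (Ω : Set (Eu N)) (u : Eu N → ℝ) : ℝ :=
  sSup { t : ℝ | 0 < t ∧
    volume Ω * ENNReal.ofReal (1 - asym N Ω / 9) ≤ volume {x | t < u x} }


/-- The fractional torsional rigidity of order `s`:
`T_s(Ω) = sup { (∫_Ω |u|)² : u ∈ C_c^∞(Ω), [u]_{W^{s,2}}² = 1 }`. -/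
def torsion (N : ℕ) (s : ℝ) (Ω : Set (Eu N)) : ℝ :=
  sSup { c : ℝ | ∃ u : Eu N → ℝ, ContDiff ℝ (⊤ : ℕ∞) u ∧ HasCompactSupport u ∧
    tsupport u ⊆ Ω ∧ gagliardoSqR N s u = 1 ∧ c = (∫ x in Ω, |u x|) ^ 2 }

/-- The volume of the unit ball of `ℝ^N`. -/
def unitBallVol (N : ℕ) : ℝ := volume.real (Metric.ball (0 : Eu N) 1)

/-- The energy `2 ∫ u - [u]²` whose supremum is the torsional rigidity. -/
def torsionEnergy (N : ℕ) (s : ℝ) (u : Eu N → ℝ) : ℝ :=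
  2 * (∫ x, u x) - gagliardoSqR N s u

/-- The Gagliardo integrand. -/
def gagInt (N : ℕ) (s : ℝ) (u : Eu N → ℝ) (x y : Eu N) : ℝ :=
  |u x - u y| ^ 2 / ‖x - y‖ ^ ((N : ℝ) + 2 * s)

/-- Admissible competitors: bounded nonnegative measurable functions with support of finite
measure and finite Gagliardo seminorm. -/
structure Adm (N : ℕ) (s : ℝ) (u : Eu N → ℝ) : Prop where
  meas : Measurable u
  nonneg : ∀ x, 0 ≤ u x
  bdd : ∃ k, ∀ x, u x ≤ k
  supp : volume {x | u x ≠ 0} ≠ ⊤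
  gag : gagliardoSq N s u ≠ ⊤

lemma unitBallVol_pos (N : ℕ) : 0 < unitBallVol N :=
  ENNReal.toReal_pos (Metric.measure_ball_pos _ _ one_pos).ne' measure_ball_lt_top.ne

lemma volume_ball_eq {N : ℕ} (x : Eu N) {r : ℝ} (hr : 0 < r) :
    volume (Metric.ball x r) = ENNReal.ofReal (r ^ N * unitBallVol N) := by
  rw [Measure.addHaar_ball_of_pos _ _ hr, finrank_euclideanSpace_fin,
    ENNReal.ofReal_mul (by positivity), unitBallVol, ofReal_measureReal measure_ball_lt_top.ne]

lemma gagliardoSq_eq (N : ℕ) (s : ℝ) (u : Eu N → ℝ) :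
    gagliardoSq N s u = ∫⁻ x, ∫⁻ y, ENNReal.ofReal (gagInt N s u x y) := rfl

lemma gagInt_nonneg (N : ℕ) (s : ℝ) (u : Eu N → ℝ) (x y : Eu N) : 0 ≤ gagInt N s u x y := by
  unfold gagInt; positivity

lemma measurable_gagInt {N : ℕ} {s : ℝ} {u : Eu N → ℝ} (hu : Measurable u) :
    Measurable (fun p : Eu N × Eu N => gagInt N s u p.1 p.2) := by
  unfold gagInt
  have h1 : Measurable fun p : Eu N × Eu N => u p.1 := hu.comp measurable_fst
  have h2 : Measurable fun p : Eu N × Eu N => u p.2 := hu.comp measurable_snd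
  have h3 : Measurable fun p : Eu N × Eu N => ‖p.1 - p.2‖ :=
    (measurable_fst.sub measurable_snd).norm
  have h4 : Measurable fun p : Eu N × Eu N => |u p.1 - u p.2| := by
    simpa [Real.norm_eq_abs] using (h1.sub h2).norm
  exact (h4.pow_const 2).div (h3.pow_const _)

lemma measurable_gagInt_right {N : ℕ} {s : ℝ} {u : Eu N → ℝ} (hu : Measurable u) (x : Eu N) :
    Measurable (fun y => gagInt N s u x y) := by
  unfold gagInt
  have h3 : Measurable fun y : Eu N => ‖x - y‖ := (measurable_const.sub measurable_id).norm
  have h4 : Measurable fun y : Eu N => |u x - u y| := by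
    simpa [Real.norm_eq_abs] using (measurable_const.sub hu).norm (f := fun y => u x - u y)
  exact (h4.pow_const 2).div (h3.pow_const _)

/-- A pointwise comparison of Gagliardo integrands with a remainder term. -/
lemma gagliardoSq_add_le {N : ℕ} {s : ℝ} {u v : Eu N → ℝ} (hv : Measurable v)
    (G : Eu N → Eu N → ℝ) (hG : ∀ x y, 0 ≤ G x y)
    (h : ∀ x y, gagInt N s v x y + G x y ≤ gagInt N s u x y) :
    gagliardoSq N s v + ∫⁻ x, ∫⁻ y, ENNReal.ofReal (G x y) ≤ gagliardoSq N s u := by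
  have hm : Measurable fun p : Eu N × Eu N => ENNReal.ofReal (gagInt N s v p.1 p.2) :=
    (measurable_gagInt (s := s) hv).ennreal_ofReal
  have h1 : Measurable fun x => ∫⁻ y, ENNReal.ofReal (gagInt N s v x y) :=
    hm.lintegral_prod_right'
  have h2 : ∀ x, Measurable fun y => ENNReal.ofReal (gagInt N s v x y) :=
    fun x => (measurable_gagInt_right hv x).ennreal_ofReal
  calc gagliardoSq N s v + ∫⁻ x, ∫⁻ y, ENNReal.ofReal (G x y)
      = ∫⁻ x, ∫⁻ y, (ENNReal.ofReal (gagInt N s v x y) + ENNReal.ofReal (G x y)) := by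
        rw [gagliardoSq_eq, ← lintegral_add_left h1]
        exact lintegral_congr fun x => (lintegral_add_left (h2 x) _).symm
    _ ≤ ∫⁻ x, ∫⁻ y, ENNReal.ofReal (gagInt N s u x y) := by
        refine lintegral_mono fun x => lintegral_mono fun y => ?_
        rw [← ENNReal.ofReal_add (gagInt_nonneg ..) (hG x y)]
        exact ENNReal.ofReal_le_ofReal (h x y)

lemma gagliardoSq_mono {N : ℕ} {s : ℝ} {u v : Eu N → ℝ}
    (h : ∀ x y, |v x - v y| ≤ |u x - u y|) :
    gagliardoSq N s v ≤ gagliardoSq N s u := by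
  rw [gagliardoSq_eq, gagliardoSq_eq]
  refine lintegral_mono fun x => lintegral_mono fun y => ENNReal.ofReal_le_ofReal ?_
  unfold gagInt
  have := h x y
  gcongr

lemma gagliardoSq_const_mul {N : ℕ} {s : ℝ} (t : ℝ) (u : Eu N → ℝ) :
    gagliardoSq N s (fun x => t * u x) = ENNReal.ofReal (t ^ 2) * gagliardoSq N s u := by
  rw [gagliardoSq_eq, gagliardoSq_eq, ← lintegral_const_mul' _ _ ENNReal.ofReal_ne_top]
  refine lintegral_congr fun x => ?_
  rw [← lintegral_const_mul' _ _ ENNReal.ofReal_ne_top]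
  refine lintegral_congr fun y => ?_
  rw [← ENNReal.ofReal_mul (by positivity)]
  congr 1
  unfold gagInt
  rw [← mul_sub, abs_mul, mul_pow, sq_abs, mul_div_assoc]

namespace Adm

variable {N : ℕ} {s : ℝ} {u : Eu N → ℝ}

lemma integrable (h : Adm N s u) : Integrable u := by
  obtain ⟨k, hk⟩ := h.bdd
  have hms : MeasurableSet {x | u x ≠ 0} := (h.meas (measurableSet_singleton 0)).compl
  have : IntegrableOn u {x | u x ≠ 0} := by
    refine Measure.integrableOn_of_bounded (M := k) h.supp h.meas.aestronglyMeasurable ?_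
    exact Eventually.of_forall fun x => by
      rw [Real.norm_eq_abs, abs_of_nonneg (h.nonneg x)]; exact hk x
  rwa [integrableOn_iff_integrable_of_support_subset] at this
  intro x hx; exact hx

lemma supp_measurable (h : Adm N s u) : MeasurableSet {x | u x ≠ 0} :=
  (h.meas (measurableSet_singleton 0)).compl

/-- Contractions of an admissible function that fix zero are admissible. -/
lemma of_contraction (h : Adm N s u) {v : Eu N → ℝ} (hv : Measurable v) (h0 : ∀ x, 0 ≤ v x)
    (hle : ∀ x, v x ≤ u x) (hc : ∀ x y, |v x - v y| ≤ |u x - u y|) : Adm N s v := by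
  obtain ⟨k, hk⟩ := h.bdd
  refine ⟨hv, h0, ⟨k, fun x => (hle x).trans (hk x)⟩, ?_, ?_⟩
  · refine ne_top_of_le_ne_top h.supp (measure_mono fun x hx => ?_)
    simp only [Set.mem_ofPred_eq] at hx ⊢
    intro hu; exact hx (le_antisymm (hu ▸ hle x) (h0 x))
  · exact ne_top_of_le_ne_top h.gag (gagliardoSq_mono hc)

lemma const_mul (h : Adm N s u) {t : ℝ} (ht : 0 ≤ t) : Adm N s (fun x => t * u x) := by
  obtain ⟨k, hk⟩ := h.bdd
  refine ⟨h.meas.const_mul t, fun x => mul_nonneg ht (h.nonneg x),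
    ⟨t * k, fun x => mul_le_mul_of_nonneg_left (hk x) ht⟩, ?_, ?_⟩
  · exact ne_top_of_le_ne_top h.supp (measure_mono fun x hx hu => hx (by simp [hu]))
  · rw [gagliardoSq_const_mul]
    exact ENNReal.mul_ne_top ENNReal.ofReal_ne_top h.gag

end Adm

lemma gagliardoSqR_const_mul {N : ℕ} {s : ℝ} (t : ℝ) (u : Eu N → ℝ) :
    gagliardoSqR N s (fun x => t * u x) = t ^ 2 * gagliardoSqR N s u := by
  rw [gagliardoSqR, gagliardoSq_const_mul, ENNReal.toReal_mul, ENNReal.toReal_ofReal (by positivity),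
    gagliardoSqR]

/-- The Gagliardo integrand of a function splits under truncation at height `k`. -/
lemma gagInt_truncate (N : ℕ) (s : ℝ) (u : Eu N → ℝ) (hu : ∀ x, 0 ≤ u x) {k : ℝ} (hk : 0 < k)
    (x y : Eu N) :
    gagInt N s (fun z => min (u z) k) x y +
      (if u y = 0 then 2 * k * (u x - min (u x) k) / ‖x - y‖ ^ ((N : ℝ) + 2 * s) else 0)
      ≤ gagInt N s u x y := by
  unfold gagInt
  have h : |min (u x) k - min (u y) k| ^ 2 + (if u y = 0 then 2 * k * (u x - min (u x) k) else 0)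
      ≤ |u x - u y| ^ 2 := by
    simp only [sq_abs]
    have hx := hu x
    have hy := hu y
    split_ifs with h0
    · rw [h0, min_eq_left hk.le]
      rcases min_cases (u x) k with ⟨h1, h2⟩ | ⟨h1, h2⟩ <;> rw [h1] <;> nlinarith
    · rcases min_cases (u x) k with ⟨h1, h2⟩ | ⟨h1, h2⟩ <;> rw [h1] <;>
      rcases min_cases (u y) k with ⟨h3, h4⟩ | ⟨h3, h4⟩ <;> rw [h3] <;> nlinarith
  have hn : 0 ≤ ‖x - y‖ ^ ((N : ℝ) + 2 * s) := by positivity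
  have := div_le_div_of_nonneg_right h hn
  rw [add_div] at this
  refine le_trans (le_of_eq ?_) this
  congr 1
  split_ifs <;> simp

/-- The fractional kernel. -/
def fracKernel (N : ℕ) (s : ℝ) (z : Eu N) : ℝ := 1 / ‖z‖ ^ ((N : ℝ) + 2 * s)

lemma fracKernel_nonneg (N : ℕ) (s : ℝ) (z : Eu N) : 0 ≤ fracKernel N s z := by
  unfold fracKernel; positivity

lemma measurable_fracKernel (N : ℕ) (s : ℝ) : Measurable (fracKernel N s) :=
  measurable_const.div (measurable_norm.pow_const _)

lemma gagInt_eq (N : ℕ) (s : ℝ) (u : Eu N → ℝ) (x y : Eu N) :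
    gagInt N s u x y = |u x - u y| ^ 2 * fracKernel N s (x - y) := by
  rw [gagInt, fracKernel, mul_one_div]

lemma nontrivial_eu {N : ℕ} (hN : 2 ≤ N) : Nontrivial (Eu N) := by
  have : Nonempty (Fin N) := ⟨⟨0, by omega⟩⟩
  infer_instance

/-- Lower bound for the kernel mass of the complement of a set of bounded measure. -/
lemma le_lintegral_kernel_compl {N : ℕ} (hN : 2 ≤ N) {s : ℝ} (hs : 0 < s) {S : Set (Eu N)}
    (hS : MeasurableSet S) {x : Eu N} {ρ : ℝ} (hρ : 0 < ρ) {b : ℝ}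
    (hvol : ENNReal.ofReal b ≤ volume (Metric.ball x ρ \ S)) :
    ENNReal.ofReal (b / ρ ^ ((N : ℝ) + 2 * s)) ≤
      ∫⁻ y in Sᶜ, ENNReal.ofReal (fracKernel N s (x - y)) := by
  have := nontrivial_eu hN
  have hp : 0 < (N : ℝ) + 2 * s := by positivity
  have hme : volume ((Metric.ball x ρ \ S) \ {x}) = volume (Metric.ball x ρ \ S) :=
    measure_sdiff_null (measure_singleton x)
  calc ENNReal.ofReal (b / ρ ^ ((N : ℝ) + 2 * s))
      = ENNReal.ofReal (1 / ρ ^ ((N : ℝ) + 2 * s)) * ENNReal.ofReal b := by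
        rw [← ENNReal.ofReal_mul (by positivity)]; congr 1; ring
    _ ≤ ENNReal.ofReal (1 / ρ ^ ((N : ℝ) + 2 * s)) * volume ((Metric.ball x ρ \ S) \ {x}) := by
        rw [hme]; gcongr
    _ = ∫⁻ y in (Metric.ball x ρ \ S) \ {x}, ENNReal.ofReal (1 / ρ ^ ((N : ℝ) + 2 * s)) := by
        rw [setLIntegral_const]
    _ ≤ ∫⁻ y in (Metric.ball x ρ \ S) \ {x}, ENNReal.ofReal (fracKernel N s (x - y)) := by
        refine setLIntegral_mono_ae' ((measurableSet_ball.diff hS).diff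
          (measurableSet_singleton x)) (Eventually.of_forall fun y hy => ?_)
        refine ENNReal.ofReal_le_ofReal ?_
        unfold fracKernel
        have h1 : 0 < ‖x - y‖ := norm_pos_iff.2 (sub_ne_zero.2 fun h => hy.2 h.symm)
        have h2 : ‖x - y‖ ≤ ρ := by
          have := hy.1.1
          rw [Metric.mem_ball, dist_comm, dist_eq_norm] at this
          exact this.le
        gcongr
    _ ≤ _ := lintegral_mono_set fun y hy => hy.1.2

/-- The volume of the support. -/
def supportVol {N : ℕ} (u : Eu N → ℝ) : ℝ := volume.real (Function.support u)

lemma supportVol_nonneg {N : ℕ} (u : Eu N → ℝ) : 0 ≤ supportVol u := measureReal_nonneg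

/-- The kernel mass constant `c₀`. -/
def kerMass (N : ℕ) (s : ℝ) : ℝ := unitBallVol N / 2 ^ ((N : ℝ) + 2 * s)

lemma kerMass_pos (N : ℕ) (s : ℝ) : 0 < kerMass N s := by
  have := unitBallVol_pos N
  unfold kerMass; positivity

lemma kerMass_le {N : ℕ} (hN : 2 ≤ N) {s : ℝ} (hs : 0 < s) {S : Set (Eu N)}
    (hS : MeasurableSet S) (hvol : volume S ≤ ENNReal.ofReal (unitBallVol N)) (x : Eu N) :
    ENNReal.ofReal (kerMass N s) ≤ ∫⁻ y in Sᶜ, ENNReal.ofReal (fracKernel N s (x - y)) := by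
  have hω := unitBallVol_pos N
  refine le_lintegral_kernel_compl hN hs hS two_pos ?_
  refine le_trans ?_ le_measure_sdiff
  rw [volume_ball_eq x two_pos]
  refine ENNReal.le_sub_of_add_le_right (ne_top_of_le_ne_top ENNReal.ofReal_ne_top hvol) ?_
  refine (add_le_add_right hvol _).trans ?_
  rw [← ENNReal.ofReal_add hω.le hω.le]
  refine ENNReal.ofReal_le_ofReal ?_
  have : (2 : ℝ) ^ 1 ≤ 2 ^ N := pow_le_pow_right₀ one_le_two (by omega)
  nlinarith

namespace Adm

variable {N : ℕ} {s : ℝ} {u : Eu N → ℝ}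

lemma min_const (h : Adm N s u) {k : ℝ} (hk : 0 ≤ k) : Adm N s (fun x => min (u x) k) :=
  h.of_contraction (h.meas.min measurable_const) (fun x => le_min (h.nonneg x) hk)
    (fun x => min_le_left _ _) fun x y => by
      simpa using abs_min_sub_min_le_max (u x) k (u y) k

/-- Truncating at height `1 / kerMass` does not decrease the energy. -/
lemma torsionEnergy_le_min (h : Adm N s u) (hN : 2 ≤ N) (hs : 0 < s)
    (hS : volume (Function.support u) ≤ ENNReal.ofReal (unitBallVol N)) :
    torsionEnergy N s u ≤ torsionEnergy N s (fun x => min (u x) (1 / kerMass N s)) := by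
  set k := 1 / kerMass N s with hkdef
  have hc := kerMass_pos N s
  have hk : 0 < k := by positivity
  have hv := h.min_const hk.le
  have h1 := gagliardoSq_add_le hv.meas _ (fun x y => by
    have : 0 ≤ u x - min (u x) k := sub_nonneg.2 (min_le_left _ _)
    split_ifs <;> positivity) (gagInt_truncate N s u h.nonneg hk)
  have h2 : ENNReal.ofReal (2 * ∫ x, (u x - min (u x) k)) ≤
      ∫⁻ x, ∫⁻ y, ENNReal.ofReal
        (if u y = 0 then 2 * k * (u x - min (u x) k) / ‖x - y‖ ^ ((N : ℝ) + 2 * s) else 0) := by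
    rw [← integral_const_mul, ofReal_integral_eq_lintegral_ofReal
      (f := fun x => 2 * (u x - min (u x) k)) ((h.integrable.sub hv.integrable).const_mul 2)
      (Eventually.of_forall fun x => mul_nonneg two_pos.le (sub_nonneg.2 (min_le_left _ _)))]
    refine lintegral_mono fun x => ?_
    have h0 : 0 ≤ u x - min (u x) k := sub_nonneg.2 (min_le_left _ _)
    calc ENNReal.ofReal (2 * (u x - min (u x) k))
        = ENNReal.ofReal (2 * k * (u x - min (u x) k)) * ENNReal.ofReal (kerMass N s) := by
          rw [← ENNReal.ofReal_mul (by positivity)]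
          congr 1; rw [hkdef]; field_simp
      _ ≤ ENNReal.ofReal (2 * k * (u x - min (u x) k)) *
          ∫⁻ y in (Function.support u)ᶜ, ENNReal.ofReal (fracKernel N s (x - y)) := by
          gcongr; exact kerMass_le hN hs h.supp_measurable hS x
      _ = ∫⁻ y, ENNReal.ofReal
        (if u y = 0 then 2 * k * (u x - min (u x) k) / ‖x - y‖ ^ ((N : ℝ) + 2 * s) else 0) := by
          rw [← lintegral_const_mul' _ _ ENNReal.ofReal_ne_top,
            ← lintegral_indicator (s := (Function.support u)ᶜ) h.supp_measurable.compl]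
          refine lintegral_congr fun y => ?_
          by_cases hy : u y = 0
          · rw [Set.indicator_of_mem (by simpa using hy), if_pos hy,
              ← ENNReal.ofReal_mul (by positivity), fracKernel, mul_one_div]
          · rw [Set.indicator_of_notMem (by simpa using hy), if_neg hy, ENNReal.ofReal_zero]
  have h3 := (add_le_add_right h2 _).trans h1
  have hI : 0 ≤ ∫ x, (u x - min (u x) k) :=
    integral_nonneg fun x => sub_nonneg.2 (min_le_left _ _)
  have h4 := ENNReal.toReal_mono h.gag h3
  rw [ENNReal.toReal_add hv.gag ENNReal.ofReal_ne_top, ENNReal.toReal_ofReal (by positivity),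
    integral_sub h.integrable hv.integrable] at h4
  unfold torsionEnergy gagliardoSqR
  linarith

end Adm

section Kernel

variable {N : ℕ} {s : ℝ}

/-- The fractional kernel multiplied by `min 1 (‖z‖² / ℓ²)`. -/
def truncKernel (N : ℕ) (s ℓ : ℝ) (z : Eu N) : ℝ := min 1 (‖z‖ ^ 2 / ℓ ^ 2) * fracKernel N s z

lemma truncKernel_nonneg (N : ℕ) (s ℓ : ℝ) (z : Eu N) : 0 ≤ truncKernel N s ℓ z :=
  mul_nonneg (le_min zero_le_one (by positivity)) (fracKernel_nonneg ..)

lemma measurable_truncKernel (N : ℕ) (s ℓ : ℝ) : Measurable (truncKernel N s ℓ) :=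
  (measurable_const.min ((measurable_norm.pow_const 2).div_const _)).mul (measurable_fracKernel N s)

lemma fracKernel_neg (z : Eu N) : fracKernel N s (-z) = fracKernel N s z := by
  simp [fracKernel]

lemma truncKernel_neg (ℓ : ℝ) (z : Eu N) : truncKernel N s ℓ (-z) = truncKernel N s ℓ z := by
  simp [truncKernel, fracKernel_neg]

lemma integrable_truncKernel_one (hN : 2 ≤ N) (hs0 : 0 < s) (hs1 : s < 1) :
    Integrable (truncKernel N s 1) := by
  have := nontrivial_eu hN
  have h : truncKernel N s 1 = fun z : Eu N =>
      (fun r : ℝ => min 1 (r ^ 2) * (1 / r ^ ((N : ℝ) + 2 * s))) ‖z‖ := by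
    ext z; simp [truncKernel, fracKernel]
  rw [h]
  refine (integrable_fun_norm_addHaar volume
    (f := fun r : ℝ => min 1 (r ^ 2) * (1 / r ^ ((N : ℝ) + 2 * s)))).2 ?_
  rw [finrank_euclideanSpace_fin,
    ← Set.Ioc_union_Ioi_eq_Ioi zero_le_one, integrableOn_union]
  have key : ∀ y : ℝ, 0 < y → y ^ (N - 1) * (1 / y ^ ((N : ℝ) + 2 * s)) = y ^ (-1 - 2 * s) := by
    intro y hy
    rw [← Real.rpow_natCast, one_div, ← Real.rpow_neg hy.le, ← Real.rpow_add hy]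
    congr 1
    rw [Nat.cast_sub (by omega)]; push_cast; ring
  constructor
  · have h1 : IntegrableOn (fun y : ℝ => y ^ (1 - 2 * s)) (Set.Ioc 0 1) := by
      have := (intervalIntegral.intervalIntegrable_rpow' (a := 0) (b := 1)
        (show -1 < 1 - 2 * s by linarith))
      rwa [intervalIntegrable_iff_integrableOn_Ioc_of_le zero_le_one] at this
    refine h1.congr_fun (fun y hy => ?_) measurableSet_Ioc
    have hy0 := hy.1
    simp only [smul_eq_mul]
    rw [min_eq_right (pow_le_one₀ hy0.le hy.2), mul_left_comm, key y hy0, ← Real.rpow_natCast,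
      ← Real.rpow_add hy0]
    congr 1; push_cast; ring
  · have h1 : IntegrableOn (fun y : ℝ => y ^ (-1 - 2 * s)) (Set.Ioi 1) :=
      integrableOn_Ioi_rpow_of_lt (by linarith) one_pos
    refine h1.congr_fun (fun y hy => ?_) measurableSet_Ioi
    have hy1 : (1 : ℝ) < y := hy
    simp only [smul_eq_mul]
    rw [min_eq_left (one_le_pow₀ hy1.le), one_mul, key y (by linarith)]

lemma truncKernel_le_one {ℓ : ℝ} (hℓ : 1 ≤ ℓ) (z : Eu N) :
    truncKernel N s ℓ z ≤ truncKernel N s 1 z := by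
  unfold truncKernel
  have := fracKernel_nonneg N s z
  have : ‖z‖ ^ 2 / ℓ ^ 2 ≤ ‖z‖ ^ 2 / 1 ^ 2 := by gcongr
  gcongr

lemma integrable_truncKernel (hN : 2 ≤ N) (hs0 : 0 < s) (hs1 : s < 1) {ℓ : ℝ} (hℓ : 0 < ℓ) :
    Integrable (truncKernel N s ℓ) := by
  refine ((integrable_truncKernel_one hN hs0 hs1).const_mul (1 + 1 / ℓ ^ 2)).mono'
    (measurable_truncKernel ..).aestronglyMeasurable (Eventually.of_forall fun z => ?_)
  rw [Real.norm_eq_abs, abs_of_nonneg (truncKernel_nonneg ..)]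
  unfold truncKernel
  rw [← mul_assoc]
  refine mul_le_mul_of_nonneg_right ?_ (fracKernel_nonneg ..)
  have h1 : 0 ≤ 1 / ℓ ^ 2 := by positivity
  have h2 : ‖z‖ ^ 2 / ℓ ^ 2 = 1 / ℓ ^ 2 * (‖z‖ ^ 2 / 1 ^ 2) := by ring
  have h3 : 0 ≤ ‖z‖ ^ 2 / 1 ^ 2 := by positivity
  rw [h2]
  generalize ‖z‖ ^ 2 / 1 ^ 2 = b at *
  generalize 1 / ℓ ^ 2 = a at *
  rcases min_cases 1 b with ⟨e, h4⟩ | ⟨e, h4⟩ <;> rw [e]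
  · exact (min_le_left _ _).trans (by linarith)
  · exact (min_le_right _ _).trans (by nlinarith)

/-- The total mass of the truncated kernel. -/
def truncMass (N : ℕ) (s ℓ : ℝ) : ℝ := ∫ z, truncKernel N s ℓ z

lemma truncMass_nonneg (N : ℕ) (s ℓ : ℝ) : 0 ≤ truncMass N s ℓ :=
  integral_nonneg (truncKernel_nonneg N s ℓ)

lemma lintegral_truncKernel (hN : 2 ≤ N) (hs0 : 0 < s) (hs1 : s < 1) {ℓ : ℝ} (hℓ : 0 < ℓ)
    (x : Eu N) :
    ∫⁻ y, ENNReal.ofReal (truncKernel N s ℓ (x - y)) = ENNReal.ofReal (truncMass N s ℓ) := by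
  rw [truncMass, ofReal_integral_eq_lintegral_ofReal (integrable_truncKernel hN hs0 hs1 hℓ)
    (Eventually.of_forall (truncKernel_nonneg N s ℓ))]
  exact lintegral_sub_left_eq_self (fun z => ENNReal.ofReal (truncKernel N s ℓ z)) x

lemma tendsto_truncMass (hN : 2 ≤ N) (hs0 : 0 < s) (hs1 : s < 1) :
    Tendsto (truncMass N s) atTop (𝓝 0) := by
  have h0 : (∫ _ : Eu N, (0 : ℝ)) = 0 := by simp
  rw [← h0]
  refine tendsto_integral_filter_of_dominated_convergence (truncKernel N s 1)
    (Eventually.of_forall fun ℓ => (measurable_truncKernel ..).aestronglyMeasurable) ?_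
    (integrable_truncKernel_one hN hs0 hs1) ?_
  · filter_upwards [eventually_ge_atTop 1] with ℓ hℓ
    refine Eventually.of_forall fun z => ?_
    rw [Real.norm_eq_abs, abs_of_nonneg (truncKernel_nonneg ..)]
    exact truncKernel_le_one hℓ z
  · refine Eventually.of_forall fun z => ?_
    have h1 : Tendsto (fun ℓ : ℝ => ‖z‖ ^ 2 / ℓ ^ 2) atTop (𝓝 0) :=
      tendsto_const_nhds.div_atTop (tendsto_pow_atTop two_ne_zero)
    have h2 : Tendsto (fun ℓ : ℝ => min 1 (‖z‖ ^ 2 / ℓ ^ 2)) atTop (𝓝 (min 1 0)) :=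
      tendsto_const_nhds.min h1
    rw [min_eq_right zero_le_one] at h2
    simpa [truncKernel] using h2.mul_const (fracKernel N s z)

end Kernel

section Scaling

variable {N : ℕ} {s : ℝ}

lemma lintegral_comp_smul_add (f : Eu N → ℝ≥0∞) {r : ℝ} (hr : 0 < r) (b : Eu N) :
    ∫⁻ x, f (r • x + b) = ENNReal.ofReal ((r ^ N)⁻¹) * ∫⁻ x, f x := by
  have h1 := (Homeomorph.smulOfNeZero (α := Eu N) r hr.ne').measurableEmbedding.lintegral_map
    (μ := volume) (fun x => f (x + b))
  have h2 : (fun x : Eu N => (Homeomorph.smulOfNeZero (α := Eu N) r hr.ne') x) =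
    fun x => r • x := rfl
  have h3 := Measure.map_addHaar_smul (volume : Measure (Eu N)) hr.ne'
  rw [finrank_euclideanSpace_fin, abs_of_pos (by positivity)] at h3
  change ∫⁻ x, f (x + b) ∂(Measure.map (fun x : Eu N => r • x) volume) = _ at h1
  rw [show (fun x : Eu N => r • x) = (r • ·) from rfl, h3, lintegral_smul_measure,
    lintegral_add_right_eq_self] at h1
  exact h1.symm

/-- Rescaled and translated copy of a function, normalised so that energies scale. -/
def rescale (s r : ℝ) (b : Eu N) (u : Eu N → ℝ) (x : Eu N) : ℝ := r ^ (-2 * s) * u (r • x + b)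

lemma gagliardoSq_comp_smul_add (u : Eu N → ℝ) {r : ℝ} (hr : 0 < r) (b : Eu N) :
    gagliardoSq N s (fun x => u (r • x + b)) =
      ENNReal.ofReal (r ^ (2 * s - N)) * gagliardoSq N s u := by
  have h1 : ∀ x y, ENNReal.ofReal (gagInt N s (fun x => u (r • x + b)) x y) =
      ENNReal.ofReal (r ^ ((N : ℝ) + 2 * s)) *
        ENNReal.ofReal (gagInt N s u (r • x + b) (r • y + b)) := by
    intro x y
    rw [← ENNReal.ofReal_mul (by positivity)]
    congr 1
    unfold gagInt
    rw [add_sub_add_right_eq_sub, ← smul_sub, norm_smul, Real.norm_of_nonneg hr.le,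
      Real.mul_rpow hr.le (norm_nonneg _)]
    have : r ^ ((N : ℝ) + 2 * s) ≠ 0 := by positivity
    rw [← div_div, mul_div_assoc', mul_div_assoc', mul_div_cancel_left₀ _ this]
  simp_rw [gagliardoSq_eq, h1]
  simp_rw [lintegral_const_mul' _ _ ENNReal.ofReal_ne_top]
  have h2 : ∀ x, ∫⁻ y, ENNReal.ofReal (gagInt N s u (r • x + b) (r • y + b)) =
      ENNReal.ofReal ((r ^ N)⁻¹) * ∫⁻ y, ENNReal.ofReal (gagInt N s u (r • x + b) y) :=
    fun x => lintegral_comp_smul_add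
      (fun y => ENNReal.ofReal (gagInt N s u (r • x + b) y)) hr b
  simp_rw [h2]
  rw [lintegral_const_mul' _ _ ENNReal.ofReal_ne_top,
    lintegral_comp_smul_add (fun x => ∫⁻ y, ENNReal.ofReal (gagInt N s u x y)) hr b,
    ← mul_assoc, ← mul_assoc, ← ENNReal.ofReal_mul (by positivity),
    ← ENNReal.ofReal_mul (by positivity)]
  congr 2
  rw [← Real.rpow_natCast, ← Real.rpow_neg hr.le, ← Real.rpow_add hr, ← Real.rpow_add hr]
  congr 1; ring

lemma volume_support_rescale (u : Eu N → ℝ) {r : ℝ} (hr : 0 < r) (b : Eu N)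
    (hu : Measurable u) :
    volume (Function.support (rescale s r b u)) =
      ENNReal.ofReal ((r ^ N)⁻¹) * volume (Function.support u) := by
  have h1 : Function.support (rescale s r b u) =
      (fun x : Eu N => r • x + b) ⁻¹' Function.support u := by
    ext x
    have : r ^ (-2 * s) ≠ 0 := by positivity
    simp only [Function.mem_support, rescale, ne_eq, mul_eq_zero, this, false_or,
      Set.mem_preimage]
  have hm : MeasurableSet (Function.support u) := (hu (measurableSet_singleton 0)).compl
  have hm2 : Measurable fun x : Eu N => r • x + b := (measurable_id.const_smul r).add_const b
  rw [h1, ← lintegral_indicator_one (hm2 hm), ← lintegral_indicator_one hm,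
    ← lintegral_comp_smul_add _ hr b]
  rfl

lemma integral_rescale (u : Eu N → ℝ) {r : ℝ} (hr : 0 < r) (b : Eu N) :
    ∫ x, rescale s r b u x = r ^ (-(N : ℝ) - 2 * s) * ∫ x, u x := by
  unfold rescale
  rw [integral_const_mul, Measure.integral_comp_smul volume (fun x => u (x + b)) r,
    integral_add_right_eq_self, finrank_euclideanSpace_fin, abs_of_pos (by positivity),
    smul_eq_mul, ← mul_assoc, ← Real.rpow_natCast, ← Real.rpow_neg hr.le, ← Real.rpow_add hr]
  congr 2; ring

lemma gagliardoSqR_rescale (u : Eu N → ℝ) {r : ℝ} (hr : 0 < r) (b : Eu N) :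
    gagliardoSqR N s (rescale s r b u) = r ^ (-(N : ℝ) - 2 * s) * gagliardoSqR N s u := by
  unfold rescale
  rw [gagliardoSqR_const_mul, gagliardoSqR, gagliardoSq_comp_smul_add u hr b, ENNReal.toReal_mul,
    ENNReal.toReal_ofReal (by positivity), gagliardoSqR, ← mul_assoc, ← Real.rpow_natCast,
    ← Real.rpow_mul hr.le, ← Real.rpow_add hr]
  congr 2; push_cast; ring

lemma torsionEnergy_rescale (u : Eu N → ℝ) {r : ℝ} (hr : 0 < r) (b : Eu N) :
    torsionEnergy N s (rescale s r b u) = r ^ (-(N : ℝ) - 2 * s) * torsionEnergy N s u := by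
  rw [torsionEnergy, torsionEnergy, integral_rescale u hr, gagliardoSqR_rescale u hr]; ring

lemma Adm.rescale {u : Eu N → ℝ} (h : Adm N s u) {r : ℝ} (hr : 0 < r) (b : Eu N) :
    Adm N s (rescale s r b u) := by
  obtain ⟨k, hk⟩ := h.bdd
  have hp : 0 ≤ r ^ (-2 * s) := by positivity
  refine ⟨?_, fun x => mul_nonneg hp (h.nonneg _),
    ⟨r ^ (-2 * s) * k, fun x => mul_le_mul_of_nonneg_left (hk _) hp⟩, ?_, ?_⟩
  · exact (h.meas.comp ((measurable_id.const_smul r).add_const b)).const_mul _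
  · change volume (Function.support _) ≠ ⊤
    rw [volume_support_rescale u hr b h.meas]
    exact ENNReal.mul_ne_top ENNReal.ofReal_ne_top h.supp
  · unfold _root_.rescale
    rw [gagliardoSq_const_mul, gagliardoSq_comp_smul_add u hr b]
    exact ENNReal.mul_ne_top ENNReal.ofReal_ne_top
      (ENNReal.mul_ne_top ENNReal.ofReal_ne_top h.gag)

end Scaling

section MaxEnergy

variable {N : ℕ} {s : ℝ} {u : Eu N → ℝ}

/-- The maximal energy among admissible functions whose support has at most the volume of the
unit ball. -/
def maxEnergy (N : ℕ) (s : ℝ) : ℝ :=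
  sSup {d : ℝ | ∃ u : Eu N → ℝ, Adm N s u ∧
    volume (Function.support u) ≤ ENNReal.ofReal (unitBallVol N) ∧ d = torsionEnergy N s u}

lemma gagliardoSqR_nonneg (N : ℕ) (s : ℝ) (u : Eu N → ℝ) : 0 ≤ gagliardoSqR N s u :=
  ENNReal.toReal_nonneg

lemma Adm.volume_support (h : Adm N s u) :
    volume (Function.support u) = ENNReal.ofReal (supportVol u) :=
  (ofReal_measureReal h.supp).symm

lemma Adm.volume_support_le (h : Adm N s u) {b : ℝ} (hb : supportVol u ≤ b) :
    volume (Function.support u) ≤ ENNReal.ofReal b := by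
  rw [h.volume_support]; exact ENNReal.ofReal_le_ofReal hb

/-- The integral of a function bounded by `k` on its support. -/
lemma Adm.integral_le (h : Adm N s u) {k : ℝ} (hk : ∀ x, u x ≤ k) :
    ∫ x, u x ≤ k * supportVol u := by
  have h1 : ∫ x in Function.support u, u x = ∫ x, u x :=
    setIntegral_eq_integral_of_forall_compl_eq_zero fun x hx => by simpa using hx
  rw [← h1]
  have h2 := setIntegral_mono_on (μ := volume) (s := Function.support u) (f := u)
    (g := fun _ => k) h.integrable.integrableOn
    (integrableOn_const h.supp) h.supp_measurable (fun x _ => hk x)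
  rwa [setIntegral_const, smul_eq_mul, mul_comm] at h2

lemma Adm.torsionEnergy_le (h : Adm N s u) {k : ℝ} (hk : ∀ x, u x ≤ k) :
    torsionEnergy N s u ≤ 2 * k * supportVol u := by
  have := h.integral_le hk
  have := gagliardoSqR_nonneg N s u
  unfold torsionEnergy; linarith

lemma support_min_const {k : ℝ} (hk : 0 < k) :
    Function.support (fun x => min (u x) k) = Function.support u := by
  ext x
  simp only [Function.mem_support, ne_eq, not_iff_not]
  rcases min_cases (u x) k with ⟨e, h⟩ | ⟨e, h⟩ <;> rw [e]
  constructor <;> intro <;> linarith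

lemma maxEnergy_bddAbove (hN : 2 ≤ N) (hs : 0 < s) :
    BddAbove {d : ℝ | ∃ u : Eu N → ℝ, Adm N s u ∧
    volume (Function.support u) ≤ ENNReal.ofReal (unitBallVol N) ∧ d = torsionEnergy N s u} := by
  have hc := kerMass_pos N s
  refine ⟨2 * (1 / kerMass N s) * unitBallVol N, ?_⟩
  rintro d ⟨u, hu, hS, rfl⟩
  refine (hu.torsionEnergy_le_min hN hs hS).trans ?_
  have h1 := (hu.min_const (k := 1 / kerMass N s) (by positivity)).torsionEnergy_le
    (fun x => min_le_right _ _)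
  refine h1.trans ?_
  have : supportVol (fun x => min (u x) (1 / kerMass N s)) ≤ unitBallVol N := by
    rw [supportVol, support_min_const (by positivity), measureReal_def]
    exact ENNReal.toReal_le_of_le_ofReal (unitBallVol_pos N).le hS
  gcongr

lemma Adm.torsionEnergy_le_maxEnergy (h : Adm N s u) (hN : 2 ≤ N) (hs : 0 < s)
    (hS : supportVol u ≤ unitBallVol N) : torsionEnergy N s u ≤ maxEnergy N s :=
  le_csSup (maxEnergy_bddAbove hN hs) ⟨u, h, h.volume_support_le hS, rfl⟩

lemma supportVol_rescale (h : Adm N s u) {r : ℝ} (hr : 0 < r) (b : Eu N) :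
    supportVol (rescale s r b u) = (r ^ N)⁻¹ * supportVol u := by
  rw [supportVol, measureReal_def, volume_support_rescale u hr b h.meas, ENNReal.toReal_mul,
    ENNReal.toReal_ofReal (by positivity), supportVol, measureReal_def]

/-- The homogeneity exponent of the energy with respect to volume. -/
def volExp (N : ℕ) (s : ℝ) : ℝ := ((N : ℝ) + 2 * s) / N

lemma Adm.torsionEnergy_le_rpow (h : Adm N s u) (hN : 2 ≤ N) (hs : 0 < s) :
    torsionEnergy N s u ≤ (supportVol u / unitBallVol N) ^ volExp N s * maxEnergy N s := by
  have hω := unitBallVol_pos N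
  have hN0 : (0 : ℝ) < N := by exact_mod_cast (by omega : 0 < N)
  have he : 0 < volExp N s := by unfold volExp; positivity
  rcases (supportVol_nonneg u).eq_or_lt with h0 | h0
  · have := h.bdd
    obtain ⟨k, hk⟩ := this
    have := h.torsionEnergy_le hk
    rw [← h0, zero_div, Real.zero_rpow he.ne', zero_mul]
    rwa [← h0, mul_zero] at this
  · set f := supportVol u / unitBallVol N with hf
    have hf0 : 0 < f := by positivity
    set r := f ^ (1 / (N : ℝ)) with hr
    have hr0 : 0 < r := by positivity
    have hrN : r ^ N = f := by
      rw [hr, ← Real.rpow_natCast, ← Real.rpow_mul hf0.le, one_div_mul_cancel hN0.ne',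
        Real.rpow_one]
    have h1 := (h.rescale hr0 0).torsionEnergy_le_maxEnergy hN hs (by
      rw [supportVol_rescale h hr0, hrN, hf]
      apply le_of_eq; field_simp)
    rw [torsionEnergy_rescale u hr0] at h1
    have h2 : f ^ volExp N s * r ^ (-(N : ℝ) - 2 * s) = 1 := by
      rw [hr, ← Real.rpow_mul hf0.le, ← Real.rpow_add hf0, volExp]
      convert Real.rpow_zero f using 2
      field_simp; ring
    calc torsionEnergy N s u
        = f ^ volExp N s * (r ^ (-(N : ℝ) - 2 * s) * torsionEnergy N s u) := by
          rw [← mul_assoc, h2, one_mul]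
      _ ≤ _ := by gcongr

lemma one_lt_volExp (hN : 2 ≤ N) (hs : 0 < s) : 1 < volExp N s := by
  have hN0 : (0 : ℝ) < N := by exact_mod_cast (by omega : 0 < N)
  rw [volExp, lt_div_iff₀ hN0]; linarith

/-- The double integral of the truncated kernel over the pairs that touch a set. -/
lemma lintegral_indicator_truncKernel (hN : 2 ≤ N) (hs0 : 0 < s) (hs1 : s < 1) {ℓ : ℝ}
    (hℓ : 0 < ℓ) {S : Set (Eu N)} (hS : MeasurableSet S) :
    ∫⁻ x, ∫⁻ y, (S.indicator (fun _ => ENNReal.ofReal (truncKernel N s ℓ (x - y))) x +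
        S.indicator (fun y => ENNReal.ofReal (truncKernel N s ℓ (x - y))) y) =
      2 * (ENNReal.ofReal (truncMass N s ℓ) * volume S) := by
  have hm2 : Measurable fun p : Eu N × Eu N => ENNReal.ofReal (truncKernel N s ℓ (p.1 - p.2)) :=
    ((measurable_truncKernel N s ℓ).comp (measurable_fst.sub measurable_snd)).ennreal_ofReal
  have e1 : ∀ x, ∫⁻ y, S.indicator
      (fun _ => ENNReal.ofReal (truncKernel N s ℓ (x - y))) x =
      S.indicator (fun _ => ENNReal.ofReal (truncMass N s ℓ)) x := by
    intro x
    by_cases hx : x ∈ S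
    · simp only [Set.indicator_of_mem hx]
      exact lintegral_truncKernel hN hs0 hs1 hℓ x
    · simp [Set.indicator_of_notMem hx]
  have e2 : ∀ y, ∫⁻ x, S.indicator
      (fun y => ENNReal.ofReal (truncKernel N s ℓ (x - y))) y =
      S.indicator (fun _ => ENNReal.ofReal (truncMass N s ℓ)) y := by
    intro y
    by_cases hy : y ∈ S
    · simp only [Set.indicator_of_mem hy]
      rw [← lintegral_truncKernel hN hs0 hs1 hℓ y]
      refine lintegral_congr fun x => ?_
      rw [← truncKernel_neg, neg_sub]
    · simp [Set.indicator_of_notMem hy]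
  have hm4 : Measurable fun p : Eu N × Eu N => S.indicator
      (fun y => ENNReal.ofReal (truncKernel N s ℓ (p.1 - y))) p.2 := by
    have : (fun p : Eu N × Eu N => S.indicator
      (fun y => ENNReal.ofReal (truncKernel N s ℓ (p.1 - y))) p.2) =
      (Prod.snd ⁻¹' S).indicator fun p => ENNReal.ofReal (truncKernel N s ℓ (p.1 - p.2)) := by
      ext p; rfl
    rw [this]; exact hm2.indicator (measurable_snd hS)
  calc ∫⁻ x, ∫⁻ y, (S.indicator (fun _ => ENNReal.ofReal (truncKernel N s ℓ (x - y))) x +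
          S.indicator (fun y => ENNReal.ofReal (truncKernel N s ℓ (x - y))) y)
      _ = ∫⁻ x, (S.indicator (fun _ => ENNReal.ofReal (truncMass N s ℓ)) x +
          ∫⁻ y, S.indicator (fun y => ENNReal.ofReal (truncKernel N s ℓ (x - y))) y) := by
          refine lintegral_congr fun x => ?_
          rw [← e1, ← lintegral_add_left]
          by_cases hx : x ∈ S
          · simp only [Set.indicator_of_mem hx]
            exact ((measurable_truncKernel N s ℓ).comp
              (measurable_const.sub measurable_id)).ennreal_ofReal
          · simp only [Set.indicator_of_notMem hx]; exact measurable_const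
      _ = ENNReal.ofReal (truncMass N s ℓ) * volume S +
          ∫⁻ y, ∫⁻ x, S.indicator (fun y => ENNReal.ofReal (truncKernel N s ℓ (x - y))) y := by
          rw [lintegral_add_left (measurable_const.indicator hS), lintegral_indicator hS,
            setLIntegral_const, lintegral_lintegral_swap hm4.aemeasurable]
      _ = _ := by
          simp_rw [e2]
          rw [lintegral_indicator hS, setLIntegral_const, two_mul]

lemma adm_zero (N : ℕ) (s : ℝ) : Adm N s (fun _ => 0) := by
  refine ⟨measurable_const, fun _ => le_rfl, ⟨0, fun _ => le_rfl⟩, by simp, ?_⟩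
  simp [gagliardoSq]

/-- The tent function on the unit ball. -/
def tent (N : ℕ) (x : Eu N) : ℝ := max 0 (1 - ‖x‖)

lemma adm_tent (hN : 2 ≤ N) (hs0 : 0 < s) (hs1 : s < 1) : Adm N s (tent N) := by
  have hsupp : {x : Eu N | tent N x ≠ 0} ⊆ Metric.ball 0 1 := by
    intro x hx
    by_contra h
    rw [mem_ball_zero_iff, not_lt] at h
    exact hx (max_eq_left (by linarith))
  have hmeas : Measurable (tent N) := by unfold tent; fun_prop
  refine ⟨hmeas, fun x => le_max_left _ _, ⟨1, fun x => ?_⟩, ?_, ?_⟩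
  · exact max_le zero_le_one (by linarith [norm_nonneg x])
  · exact ne_top_of_le_ne_top measure_ball_lt_top.ne (measure_mono hsupp)
  · let S : Set (Eu N) := Metric.ball 0 1
    have hpt : ∀ x y, ENNReal.ofReal (gagInt N s (tent N) x y) ≤
        S.indicator (fun _ => ENNReal.ofReal (truncKernel N s 1 (x - y))) x +
        S.indicator (fun y => ENNReal.ofReal (truncKernel N s 1 (x - y))) y := by
      intro x y
      by_cases hxy : x ∈ S ∨ y ∈ S
      · have : ENNReal.ofReal (gagInt N s (tent N) x y) ≤
            ENNReal.ofReal (truncKernel N s 1 (x - y)) := by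
          refine ENNReal.ofReal_le_ofReal ?_
          rw [gagInt_eq, truncKernel]
          refine mul_le_mul_of_nonneg_right ?_ (fracKernel_nonneg ..)
          have h0 : ∀ z : Eu N, 0 ≤ tent N z ∧ tent N z ≤ 1 := fun z =>
            ⟨le_max_left _ _, max_le zero_le_one (by linarith [norm_nonneg z])⟩
          refine le_min ?_ ?_
          · refine pow_le_one₀ (abs_nonneg _) ?_
            rw [abs_le]; constructor <;> linarith [h0 x, h0 y]
          · rw [one_pow, div_one]
            refine pow_le_pow_left₀ (abs_nonneg _) ?_ 2
            unfold tent
            refine (abs_max_sub_max_le_max 0 (1 - ‖x‖) 0 (1 - ‖y‖)).trans ?_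
            rw [sub_zero, abs_zero, max_eq_right (abs_nonneg _)]
            rw [show 1 - ‖x‖ - (1 - ‖y‖) = -(‖x‖ - ‖y‖) by ring, abs_neg]
            exact abs_norm_sub_norm_le x y
        refine this.trans ?_
        rcases hxy with h | h
        · rw [Set.indicator_of_mem h]; exact le_self_add
        · rw [Set.indicator_of_mem h (fun y => ENNReal.ofReal (truncKernel N s 1 (x - y)))]
          exact le_add_self
      · push Not at hxy
        have hx : tent N x = 0 := by_contra fun h => hxy.1 (hsupp h)
        have hy : tent N y = 0 := by_contra fun h => hxy.2 (hsupp h)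
        simp [gagInt, hx, hy, Set.indicator_of_notMem hxy.1]
    have hS : MeasurableSet S := measurableSet_ball
    have hb : gagliardoSq N s (tent N) ≤
        2 * (ENNReal.ofReal (truncMass N s 1) * volume S) := by
      rw [← lintegral_indicator_truncKernel hN hs0 hs1 one_pos hS, gagliardoSq_eq]
      exact lintegral_mono fun x => lintegral_mono fun y => hpt x y
    exact ne_top_of_le_ne_top (ENNReal.mul_ne_top (by simp)
      (ENNReal.mul_ne_top ENNReal.ofReal_ne_top measure_ball_lt_top.ne)) hb

lemma torsionEnergy_const_mul (t : ℝ) (u : Eu N → ℝ) :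
    torsionEnergy N s (fun x => t * u x) = 2 * t * (∫ x, u x) - t ^ 2 * gagliardoSqR N s u := by
  rw [torsionEnergy, gagliardoSqR_const_mul, integral_const_mul]; ring

lemma maxEnergy_pos (hN : 2 ≤ N) (hs0 : 0 < s) (hs1 : s < 1) : 0 < maxEnergy N s := by
  have h := adm_tent hN hs0 hs1
  have hI : 0 < ∫ x, tent N x := by
    rw [integral_pos_iff_support_of_nonneg h.nonneg h.integrable]
    refine (Metric.measure_ball_pos volume (0 : Eu N) one_pos).trans_le (measure_mono ?_)
    intro x hx
    rw [mem_ball_zero_iff] at hx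
    rw [Function.mem_support, tent, max_eq_right (by linarith)]
    linarith
  have hG := gagliardoSqR_nonneg N s (tent N)
  set I := ∫ x, tent N x
  set G := gagliardoSqR N s (tent N)
  set t := I / (G + 1) with ht
  have ht0 : 0 < t := by positivity
  have h2 := h.const_mul ht0.le
  refine lt_of_lt_of_le ?_ (h2.torsionEnergy_le_maxEnergy hN hs0 ?_)
  · rw [torsionEnergy_const_mul]
    have h3 : I = t * (G + 1) := by rw [ht]; field_simp
    change 0 < 2 * t * I - t ^ 2 * G
    rw [h3]; nlinarith [mul_pos ht0 ht0]
  · refine measureReal_mono ?_ measure_ball_lt_top.ne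
    intro x hx
    by_contra hb
    rw [mem_ball_zero_iff, not_lt] at hb
    exact hx (by simp [tent, max_eq_left (show 1 - ‖x‖ ≤ 0 by linarith)])

lemma Adm.torsionEnergy_le_linear (h : Adm N s u) (hN : 2 ≤ N) (hs0 : 0 < s) (hs1 : s < 1)
    (hS : supportVol u ≤ unitBallVol N) :
    torsionEnergy N s u ≤ maxEnergy N s * (supportVol u / unitBallVol N) := by
  have hω := unitBallVol_pos N
  refine (h.torsionEnergy_le_rpow hN hs0).trans ?_
  rw [mul_comm]
  refine mul_le_mul_of_nonneg_left ?_ (maxEnergy_pos hN hs0 hs1).le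
  have h1 : supportVol u / unitBallVol N ≤ 1 := by rwa [div_le_one hω]
  have h0 : 0 ≤ supportVol u / unitBallVol N := div_nonneg (supportVol_nonneg u) hω.le
  exact Real.rpow_le_self_of_le_one h0 h1 (one_lt_volExp hN hs0).le

/-- Low values of an almost maximising function fill only a small part of its domain. -/
lemma Adm.volume_sublevel_le (h : Adm N s u) (hN : 2 ≤ N) (hs0 : 0 < s) (hs1 : s < 1)
    {Ω : Set (Eu N)} (hΩ : MeasurableSet Ω) (hvol : volume.real Ω = unitBallVol N)
    (hu : ∀ x ∉ Ω, u x = 0) {t : ℝ} (ht : 0 ≤ t) :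
    maxEnergy N s * volume.real (Ω \ {x | t < u x}) ≤
      unitBallVol N * (maxEnergy N s - torsionEnergy N s u + 2 * t * unitBallVol N) := by
  have hω := unitBallVol_pos N
  have hΩfin : volume Ω ≠ ⊤ := by
    intro h; rw [measureReal_def, h] at hvol; simp at hvol; linarith
  have hv : Adm N s (fun x => max (u x - t) 0) := by
    refine h.of_contraction ((h.meas.sub_const t).max measurable_const)
      (fun x => le_max_right _ _) (fun x => max_le (by linarith) (h.nonneg x)) fun x y => ?_
    simpa using abs_max_sub_max_le_max (u x - t) 0 (u y - t) 0
  have hsub : {x | t < u x} ⊆ Ω := by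
    intro x hx
    by_contra h0
    have : t < u x := hx
    rw [hu x h0] at this; linarith
  have hsupp : Function.support (fun x => max (u x - t) 0) = {x | t < u x} := by
    ext x
    simp only [Function.mem_support, Set.mem_ofPred_eq, ne_eq, max_eq_right_iff, not_le, sub_pos]
  have hsv : supportVol (fun x => max (u x - t) 0) = volume.real {x | t < u x} := by
    rw [supportVol, hsupp]
  have hmE : MeasurableSet {x | t < u x} := measurableSet_lt measurable_const h.meas
  have hdiff : volume.real (Ω \ {x | t < u x}) = unitBallVol N - volume.real {x | t < u x} := by
    rw [measureReal_sdiff hsub hmE, hvol]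
  have hE : volume.real {x | t < u x} ≤ unitBallVol N := by
    rw [← hvol]; exact measureReal_mono hsub hΩfin
  have h1 := hv.torsionEnergy_le_linear hN hs0 hs1 (by rw [hsv]; exact hE)
  have h2 : ∫ x, (u x - max (u x - t) 0) ≤ t * unitBallVol N := by
    have e : ∫ x in Ω, (u x - max (u x - t) 0) = ∫ x, (u x - max (u x - t) 0) :=
      setIntegral_eq_integral_of_forall_compl_eq_zero fun x hx => by
        rw [hu x hx]; simp [ht]
    rw [← e]
    have h2 := setIntegral_mono_on (μ := volume) (s := Ω)
      (f := fun x => u x - max (u x - t) 0) (g := fun _ => t)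
      (h.integrable.sub hv.integrable).integrableOn (integrableOn_const hΩfin) hΩ
      (fun x _ => by linarith [le_max_left (u x - t) 0])
    rwa [setIntegral_const, smul_eq_mul, mul_comm, hvol] at h2
  rw [integral_sub h.integrable hv.integrable] at h2
  have h3 : gagliardoSqR N s (fun x => max (u x - t) 0) ≤ gagliardoSqR N s u :=
    ENNReal.toReal_mono h.gag (gagliardoSq_mono fun x y => by
      simpa using abs_max_sub_max_le_max (u x - t) 0 (u y - t) 0)
  rw [hsv] at h1
  rw [hdiff]
  have h4 : torsionEnergy N s u - 2 * (t * unitBallVol N) ≤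
      maxEnergy N s * (volume.real {x | t < u x} / unitBallVol N) := by
    refine le_trans ?_ h1
    unfold torsionEnergy
    linarith
  have h5 := mul_le_mul_of_nonneg_left h4 hω.le
  have h6 : unitBallVol N * (maxEnergy N s * (volume.real {x | t < u x} / unitBallVol N)) =
      maxEnergy N s * volume.real {x | t < u x} := by field_simp
  rw [h6] at h5
  linarith

end MaxEnergy

section Cut

variable {N : ℕ} {s : ℝ} {u : Eu N → ℝ}

/-- The angle of the trigonometric cut-off between `ball p r` and `ball p (r + ℓ)`. -/
def cutAngle (p : Eu N) (r ℓ : ℝ) (x : Eu N) : ℝ :=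
  Real.pi / 2 * max 0 (min 1 ((‖x - p‖ - r) / ℓ))

lemma cutAngle_mem (p : Eu N) (r ℓ : ℝ) (x : Eu N) :
    0 ≤ cutAngle p r ℓ x ∧ cutAngle p r ℓ x ≤ Real.pi / 2 := by
  have hpi := Real.pi_pos
  unfold cutAngle
  have h1 : 0 ≤ max 0 (min 1 ((‖x - p‖ - r) / ℓ)) := le_max_left _ _
  have h2 : max 0 (min 1 ((‖x - p‖ - r) / ℓ)) ≤ 1 := max_le zero_le_one (min_le_left _ _)
  constructor <;> nlinarith

lemma cutAngle_eq_zero {p : Eu N} {r ℓ : ℝ} (hℓ : 0 < ℓ) {x : Eu N}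
    (hx : x ∈ Metric.closedBall p r) : cutAngle p r ℓ x = 0 := by
  rw [Metric.mem_closedBall, dist_eq_norm] at hx
  have : (‖x - p‖ - r) / ℓ ≤ 0 := div_nonpos_of_nonpos_of_nonneg (by linarith) hℓ.le
  rw [cutAngle, max_eq_left ((min_le_right _ _).trans this), mul_zero]

lemma cutAngle_eq_pi_div_two {p : Eu N} {r ℓ : ℝ} (hℓ : 0 < ℓ) {x : Eu N}
    (hx : x ∉ Metric.ball p (r + ℓ)) : cutAngle p r ℓ x = Real.pi / 2 := by
  rw [Metric.mem_ball, dist_eq_norm, not_lt] at hx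
  have : 1 ≤ (‖x - p‖ - r) / ℓ := by rw [le_div_iff₀ hℓ]; linarith
  rw [cutAngle, min_eq_left this, max_eq_right zero_le_one, mul_one]

lemma abs_cutAngle_sub_le (p : Eu N) (r : ℝ) {ℓ : ℝ} (hℓ : 0 < ℓ) (x y : Eu N) :
    (cutAngle p r ℓ x - cutAngle p r ℓ y) ^ 2 ≤
      Real.pi ^ 2 / 4 * min 1 (‖x - y‖ ^ 2 / ℓ ^ 2) := by
  set a := max 0 (min 1 ((‖x - p‖ - r) / ℓ)) with ha
  set b := max 0 (min 1 ((‖y - p‖ - r) / ℓ)) with hb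
  have e : (cutAngle p r ℓ x - cutAngle p r ℓ y) ^ 2 = Real.pi ^ 2 / 4 * (a - b) ^ 2 := by
    rw [cutAngle, cutAngle, ← ha, ← hb]; ring
  rw [e]
  have ha0 : 0 ≤ a ∧ a ≤ 1 := ⟨le_max_left _ _, max_le zero_le_one (min_le_left _ _)⟩
  have hb0 : 0 ≤ b ∧ b ≤ 1 := ⟨le_max_left _ _, max_le zero_le_one (min_le_left _ _)⟩
  refine mul_le_mul_of_nonneg_left (le_min ?_ ?_) (by positivity)
  · rw [← sq_abs]
    refine pow_le_one₀ (abs_nonneg _) ?_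
    rw [abs_le]; constructor <;> linarith
  · rw [← div_pow, ← sq_abs (a - b)]
    refine pow_le_pow_left₀ (abs_nonneg _) ?_ 2
    have h1 : |a - b| ≤ |(‖x - p‖ - r) / ℓ - (‖y - p‖ - r) / ℓ| := by
      refine (abs_max_sub_max_le_max 0 _ 0 _).trans ?_
      rw [sub_zero, abs_zero, max_eq_right (abs_nonneg _)]
      refine (abs_min_sub_min_le_max 1 _ 1 _).trans ?_
      rw [sub_self, abs_zero, max_eq_right (abs_nonneg _)]
    refine h1.trans ?_
    rw [← sub_div, abs_div, abs_of_pos hℓ]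
    refine div_le_div_of_nonneg_right ?_ hℓ.le
    rw [sub_sub_sub_cancel_right]
    refine (abs_norm_sub_norm_le _ _).trans (le_of_eq ?_)
    rw [sub_sub_sub_cancel_right]

lemma measurable_cutAngle (p : Eu N) (r ℓ : ℝ) : Measurable (cutAngle p r ℓ) := by
  unfold cutAngle; fun_prop

/-- Pointwise effect of the trigonometric cut-off. -/
lemma cut_pointwise (a b α β : ℝ) :
    (Real.cos α * a - Real.cos β * b) ^ 2 + (Real.sin α * a - Real.sin β * b) ^ 2 =
      (a - b) ^ 2 + 2 * a * b * (1 - Real.cos (α - β)) := by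
  rw [Real.cos_sub]
  linear_combination a ^ 2 * Real.sin_sq_add_cos_sq α + b ^ 2 * Real.sin_sq_add_cos_sq β

/-- Splitting an admissible function along a spherical shell. -/
lemma Adm.exists_cut (h : Adm N s u) (hN : 2 ≤ N) (hs0 : 0 < s) (hs1 : s < 1) {k : ℝ}
    (hk : ∀ x, u x ≤ k) (p : Eu N) (r : ℝ) {ℓ : ℝ} (hℓ : 0 < ℓ) :
    ∃ v w : Eu N → ℝ, Adm N s v ∧ Adm N s w ∧ (∀ x, v x ≤ u x) ∧
      Function.support v ⊆ Function.support u ∩ Metric.ball p (r + ℓ) ∧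
      Function.support w ⊆ Function.support u \ Metric.closedBall p r ∧
      torsionEnergy N s u ≤ torsionEnergy N s v + torsionEnergy N s w +
        Real.pi ^ 2 / 2 * k ^ 2 * truncMass N s ℓ *
          volume.real (Function.support u \ Metric.closedBall p r) := by
  set θ := cutAngle p r ℓ with hθ
  have hk0 : 0 ≤ k := (h.nonneg 0).trans (hk 0)
  have hθm : Measurable θ := measurable_cutAngle p r ℓ
  have hcos : ∀ x, 0 ≤ Real.cos (θ x) := fun x => Real.cos_nonneg_of_mem_Icc
    ⟨by linarith [(cutAngle_mem p r ℓ x).1, Real.pi_pos], (cutAngle_mem p r ℓ x).2⟩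
  have hsin : ∀ x, 0 ≤ Real.sin (θ x) := fun x => Real.sin_nonneg_of_mem_Icc
    ⟨(cutAngle_mem p r ℓ x).1, by linarith [(cutAngle_mem p r ℓ x).2, Real.pi_pos]⟩
  set v : Eu N → ℝ := fun x => Real.cos (θ x) * u x with hv
  set w : Eu N → ℝ := fun x => Real.sin (θ x) * u x with hw
  have hvm : Measurable v := (Real.measurable_cos.comp hθm).mul h.meas
  have hwm : Measurable w := (Real.measurable_sin.comp hθm).mul h.meas
  have hvle : ∀ x, v x ≤ u x := fun x =>
    mul_le_of_le_one_left (h.nonneg x) (Real.cos_le_one _)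
  have hwle : ∀ x, w x ≤ u x := fun x =>
    mul_le_of_le_one_left (h.nonneg x) (Real.sin_le_one _)
  have hvs : Function.support v ⊆ Function.support u ∩ Metric.ball p (r + ℓ) := by
    intro x hx
    refine ⟨fun h0 => hx (by simp [hv, h0]), by_contra fun hb => hx ?_⟩
    simp [hv, hθ, cutAngle_eq_pi_div_two hℓ hb]
  have hws : Function.support w ⊆ Function.support u \ Metric.closedBall p r := by
    intro x hx
    refine ⟨fun h0 => hx (by simp [hw, h0]), fun hb => hx ?_⟩
    simp [hw, hθ, cutAngle_eq_zero hℓ hb]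
  set Z := Function.support u \ Metric.closedBall p r with hZ
  have hZm : MeasurableSet Z := h.supp_measurable.diff measurableSet_closedBall
  have hZfin : volume Z ≠ ⊤ := ne_top_of_le_ne_top h.supp (measure_mono Set.sdiff_subset)
  set c := Real.pi ^ 2 / 4 * k ^ 2 with hc
  have hc0 : 0 ≤ c := by positivity
  have hpt : ∀ x y, ENNReal.ofReal (gagInt N s v x y) + ENNReal.ofReal (gagInt N s w x y) ≤
      ENNReal.ofReal (gagInt N s u x y) + ENNReal.ofReal c *
        (Z.indicator (fun _ => ENNReal.ofReal (truncKernel N s ℓ (x - y))) x +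
        Z.indicator (fun y => ENNReal.ofReal (truncKernel N s ℓ (x - y))) y) := by
    intro x y
    rw [← ENNReal.ofReal_add (gagInt_nonneg ..) (gagInt_nonneg ..)]
    have e : gagInt N s v x y + gagInt N s w x y = gagInt N s u x y +
        2 * u x * u y * (1 - Real.cos (θ x - θ y)) * fracKernel N s (x - y) := by
      simp only [gagInt_eq, sq_abs]
      rw [← add_mul, ← add_mul, ← cut_pointwise]
    have hux := h.nonneg x
    have huy := h.nonneg y
    have h1c : 0 ≤ 1 - Real.cos (θ x - θ y) := by linarith [Real.cos_le_one (θ x - θ y)]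
    rw [e, ENNReal.ofReal_add (gagInt_nonneg ..)
      (mul_nonneg (mul_nonneg (by positivity) h1c) (fracKernel_nonneg ..))]
    refine add_le_add_right ?_ _
    by_cases hxy : x ∈ Z ∨ y ∈ Z
    · have h1 : ENNReal.ofReal
          (2 * u x * u y * (1 - Real.cos (θ x - θ y)) * fracKernel N s (x - y)) ≤
          ENNReal.ofReal c * ENNReal.ofReal (truncKernel N s ℓ (x - y)) := by
        rw [← ENNReal.ofReal_mul hc0]
        refine ENNReal.ofReal_le_ofReal ?_
        rw [truncKernel, ← mul_assoc]
        refine mul_le_mul_of_nonneg_right ?_ (fracKernel_nonneg ..)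
        have h2 : u x * u y ≤ k ^ 2 := by
          rw [sq]; exact mul_le_mul (hk x) (hk y) huy hk0
        have h3 : 1 - Real.cos (θ x - θ y) ≤ (θ x - θ y) ^ 2 / 2 := by
          linarith [Real.one_sub_sq_div_two_le_cos (x := θ x - θ y)]
        have h4 := abs_cutAngle_sub_le p r hℓ x y
        calc 2 * u x * u y * (1 - Real.cos (θ x - θ y))
            = (u x * u y) * (2 * (1 - Real.cos (θ x - θ y))) := by ring
          _ ≤ k ^ 2 * (Real.pi ^ 2 / 4 * min 1 (‖x - y‖ ^ 2 / ℓ ^ 2)) := by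
              refine mul_le_mul h2 (by linarith) (by linarith) (by positivity)
          _ = _ := by rw [hc]; ring
      refine h1.trans ?_
      gcongr
      rcases hxy with hx | hy
      · rw [Set.indicator_of_mem hx]; exact le_self_add
      · rw [Set.indicator_of_mem hy (fun y => ENNReal.ofReal (truncKernel N s ℓ (x - y)))]
        exact le_add_self
    · push Not at hxy
      have h0 : ∀ z, z ∉ Z → u z = 0 ∨ θ z = 0 := by
        intro z hz
        by_cases hu : u z = 0
        · exact Or.inl hu
        · right
          refine cutAngle_eq_zero hℓ (by_contra fun hb => hz ⟨hu, hb⟩)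
      have : 2 * u x * u y * (1 - Real.cos (θ x - θ y)) * fracKernel N s (x - y) = 0 := by
        rcases h0 x hxy.1 with h1 | h1
        · simp [h1]
        · rcases h0 y hxy.2 with h2 | h2
          · simp [h2]
          · simp [h1, h2]
      rw [this, ENNReal.ofReal_zero]; exact zero_le
  have hm1 : Measurable fun x => ∫⁻ y, ENNReal.ofReal (gagInt N s v x y) :=
    (measurable_gagInt (s := s) hvm).ennreal_ofReal.lintegral_prod_right'
  have hm2 : Measurable fun x => ∫⁻ y, ENNReal.ofReal (gagInt N s u x y) :=
    (measurable_gagInt (s := s) h.meas).ennreal_ofReal.lintegral_prod_right'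
  have hgag : gagliardoSq N s v + gagliardoSq N s w ≤ gagliardoSq N s u +
      ENNReal.ofReal (2 * c * truncMass N s ℓ * volume.real Z) := by
    calc gagliardoSq N s v + gagliardoSq N s w
        = ∫⁻ x, ∫⁻ y, (ENNReal.ofReal (gagInt N s v x y) +
          ENNReal.ofReal (gagInt N s w x y)) := by
          rw [gagliardoSq_eq, gagliardoSq_eq, ← lintegral_add_left hm1]
          exact lintegral_congr fun x =>
            (lintegral_add_left (measurable_gagInt_right hvm x).ennreal_ofReal _).symm
      _ ≤ ∫⁻ x, ∫⁻ y, (ENNReal.ofReal (gagInt N s u x y) + ENNReal.ofReal c *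
        (Z.indicator (fun _ => ENNReal.ofReal (truncKernel N s ℓ (x - y))) x +
        Z.indicator (fun y => ENNReal.ofReal (truncKernel N s ℓ (x - y))) y)) :=
          lintegral_mono fun x => lintegral_mono fun y => hpt x y
      _ = gagliardoSq N s u + ENNReal.ofReal c *
          (2 * (ENNReal.ofReal (truncMass N s ℓ) * volume Z)) := by
          rw [← lintegral_indicator_truncKernel hN hs0 hs1 hℓ hZm, gagliardoSq_eq,
            ← lintegral_const_mul' _ _ ENNReal.ofReal_ne_top, ← lintegral_add_left hm2]
          refine lintegral_congr fun x => ?_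
          rw [← lintegral_const_mul' _ _ ENNReal.ofReal_ne_top]
          exact lintegral_add_left (measurable_gagInt_right h.meas x).ennreal_ofReal _
      _ = _ := by
          have := truncMass_nonneg N s ℓ
          rw [← ofReal_measureReal hZfin, ← ENNReal.ofReal_mul this,
            two_mul, ← ENNReal.ofReal_add (by positivity) (by positivity),
            ← ENNReal.ofReal_mul hc0]
          congr 2; ring
  have hsum : gagliardoSq N s v + gagliardoSq N s w ≠ ⊤ :=
    ne_top_of_le_ne_top (ENNReal.add_ne_top.2 ⟨h.gag, ENNReal.ofReal_ne_top⟩) hgag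
  have hva : Adm N s v := ⟨hvm, fun x => mul_nonneg (hcos x) (h.nonneg x),
    ⟨k, fun x => (hvle x).trans (hk x)⟩,
    ne_top_of_le_ne_top h.supp (measure_mono (hvs.trans Set.inter_subset_left)),
    (ENNReal.add_ne_top.1 hsum).1⟩
  have hwa : Adm N s w := ⟨hwm, fun x => mul_nonneg (hsin x) (h.nonneg x),
    ⟨k, fun x => (hwle x).trans (hk x)⟩,
    ne_top_of_le_ne_top h.supp (measure_mono (hws.trans Set.sdiff_subset)),
    (ENNReal.add_ne_top.1 hsum).2⟩
  refine ⟨v, w, hva, hwa, hvle, hvs, hws, ?_⟩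
  have hJ := truncMass_nonneg N s ℓ
  have h1 := ENNReal.toReal_mono (ENNReal.add_ne_top.2 ⟨h.gag, ENNReal.ofReal_ne_top⟩) hgag
  rw [ENNReal.toReal_add hva.gag hwa.gag, ENNReal.toReal_add h.gag ENNReal.ofReal_ne_top,
    ENNReal.toReal_ofReal (by positivity)] at h1
  have h2 : ∫ x, u x ≤ (∫ x, v x) + ∫ x, w x := by
    rw [← integral_add hva.integrable hwa.integrable]
    refine integral_mono h.integrable (hva.integrable.add hwa.integrable) fun x => ?_
    change u x ≤ Real.cos (θ x) * u x + Real.sin (θ x) * u x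
    rw [← add_mul]
    refine le_mul_of_one_le_left (h.nonneg x) ?_
    nlinarith [Real.sin_sq_add_cos_sq (θ x), hcos x, hsin x]
  have e : Real.pi ^ 2 / 2 * k ^ 2 * truncMass N s ℓ * volume.real Z =
      2 * c * truncMass N s ℓ * volume.real Z := by rw [hc]; ring
  rw [e]
  unfold torsionEnergy gagliardoSqR
  linarith

end Cut

section Tightness

variable {N : ℕ} {s : ℝ} {u : Eu N → ℝ}

/-- If the support of `u` fills at most half of every ball of radius `ρ`, its energy is small. -/
lemma Adm.torsionEnergy_le_of_thin (h : Adm N s u) (hN : 2 ≤ N) (hs : 0 < s) {ρ : ℝ}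
    (hρ : 0 < ρ)
    (hthin : ∀ p, volume.real (Function.support u ∩ Metric.ball p ρ) ≤
      1 / 2 * (ρ ^ N * unitBallVol N)) :
    torsionEnergy N s u ≤ supportVol u * (2 * ρ ^ (2 * s) / unitBallVol N) := by
  have hω := unitBallVol_pos N
  have hSm : MeasurableSet (Function.support u) := h.supp_measurable
  set b := 1 / 2 * (ρ ^ N * unitBallVol N) with hb
  set Λ := b / ρ ^ ((N : ℝ) + 2 * s) with hΛ
  have hΛ0 : 0 < Λ := by positivity
  have hΛinv : 1 / Λ = 2 * ρ ^ (2 * s) / unitBallVol N := by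
    rw [hΛ, hb, Real.rpow_add hρ, Real.rpow_natCast]
    field_simp
  have hker : ∀ x, ENNReal.ofReal Λ ≤
      ∫⁻ y in (Function.support u)ᶜ, ENNReal.ofReal (fracKernel N s (x - y)) := by
    intro x
    refine le_lintegral_kernel_compl hN hs h.supp_measurable hρ ?_
    have hfin : volume (Metric.ball x ρ \ Function.support u) ≠ ⊤ :=
      ne_top_of_le_ne_top measure_ball_lt_top.ne (measure_mono Set.sdiff_subset)
    have h1 := measureReal_sdiff_add_inter (μ := volume) (s := Metric.ball x ρ) hSm
      measure_ball_lt_top.ne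
    change _ ≤ volume (Metric.ball x ρ \ Function.support u)
    rw [← ofReal_measureReal hfin]
    refine ENNReal.ofReal_le_ofReal ?_
    have h2 : volume.real (Metric.ball x ρ) = ρ ^ N * unitBallVol N := by
      rw [measureReal_def, volume_ball_eq x hρ, ENNReal.toReal_ofReal (by positivity)]
    have h3 := hthin x
    rw [Set.inter_comm] at h3
    rw [hb]; linarith
  have hlow : ENNReal.ofReal (∫ x, Λ * u x ^ 2) ≤ gagliardoSq N s u := by
    obtain ⟨k, hk⟩ := h.bdd
    have hint : Integrable fun x => Λ * u x ^ 2 := by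
      refine (h.integrable.const_mul (Λ * k)).mono'
        ((h.meas.pow_const 2).const_mul Λ).aestronglyMeasurable
        (Eventually.of_forall fun x => ?_)
      rw [Real.norm_of_nonneg (by positivity), mul_assoc]
      have := h.nonneg x
      have := hk x
      gcongr
      nlinarith
    rw [ofReal_integral_eq_lintegral_ofReal hint
      (Eventually.of_forall fun x => by positivity), gagliardoSq_eq]
    refine lintegral_mono fun x => ?_
    calc ENNReal.ofReal (Λ * u x ^ 2) = ENNReal.ofReal (u x ^ 2) * ENNReal.ofReal Λ := by
          rw [← ENNReal.ofReal_mul (by positivity), mul_comm]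
      _ ≤ ENNReal.ofReal (u x ^ 2) *
          ∫⁻ y in (Function.support u)ᶜ, ENNReal.ofReal (fracKernel N s (x - y)) := by
          gcongr; exact hker x
      _ = ∫⁻ y in (Function.support u)ᶜ, ENNReal.ofReal (gagInt N s u x y) := by
          rw [← lintegral_const_mul' _ _ ENNReal.ofReal_ne_top]
          refine setLIntegral_congr_fun (h.supp_measurable.compl) fun y hy => ?_
          have hy0 : u y = 0 := by simpa using hy
          simp only [gagInt_eq, hy0, sub_zero, sq_abs]
          rw [ENNReal.ofReal_mul (by positivity)]
      _ ≤ _ := setLIntegral_le_lintegral _ _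
  have h1 := ENNReal.toReal_mono h.gag hlow
  rw [ENNReal.toReal_ofReal (integral_nonneg fun x => by positivity)] at h1
  have h2 : ∫ x in Function.support u, (2 * u x - Λ * u x ^ 2) =
      ∫ x, (2 * u x - Λ * u x ^ 2) :=
    setIntegral_eq_integral_of_forall_compl_eq_zero fun x hx => by
      have : u x = 0 := by simpa using hx
      simp [this]
  obtain ⟨k, hk⟩ := h.bdd
  have hint : Integrable fun x => Λ * u x ^ 2 := by
    refine (h.integrable.const_mul (Λ * k)).mono'
      ((h.meas.pow_const 2).const_mul Λ).aestronglyMeasurable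
      (Eventually.of_forall fun x => ?_)
    rw [Real.norm_of_nonneg (by positivity), mul_assoc]
    have := h.nonneg x
    have := hk x
    gcongr
    nlinarith
  have h3 : ∫ x in Function.support u, (2 * u x - Λ * u x ^ 2) ≤ 1 / Λ * supportVol u := by
    have h3 := setIntegral_mono_on (μ := volume) (s := Function.support u)
      (f := fun x => 2 * u x - Λ * u x ^ 2) (g := fun _ => 1 / Λ)
      ((h.integrable.const_mul 2).sub hint).integrableOn (integrableOn_const h.supp)
      h.supp_measurable (fun x _ => by
        rw [le_div_iff₀ hΛ0]; nlinarith [sq_nonneg (Λ * u x - 1)])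
    rwa [setIntegral_const, smul_eq_mul, mul_comm] at h3
  rw [h2, integral_sub (h.integrable.const_mul 2) hint, integral_const_mul, hΛinv] at h3
  unfold torsionEnergy gagliardoSqR
  linarith

/-- A function of large energy occupies a substantial part of some ball of fixed radius. -/
lemma exists_nonvanishing (hN : 2 ≤ N) (hs0 : 0 < s) (hs1 : s < 1) :
    ∃ ρ : ℝ, 0 < ρ ∧ ∀ u : Eu N → ℝ, Adm N s u → supportVol u ≤ unitBallVol N →
      maxEnergy N s / 2 ≤ torsionEnergy N s u →
      ∃ p, 1 / 2 * (ρ ^ N * unitBallVol N) ≤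
        volume.real (Function.support u ∩ Metric.ball p ρ) := by
  have hω := unitBallVol_pos N
  have hM := maxEnergy_pos hN hs0 hs1
  set ρ := (maxEnergy N s / 8) ^ (1 / (2 * s)) with hρ
  have hρ0 : 0 < ρ := by positivity
  have hρs : ρ ^ (2 * s) = maxEnergy N s / 8 := by
    rw [hρ, ← Real.rpow_mul (by positivity), one_div_mul_cancel (by positivity), Real.rpow_one]
  refine ⟨ρ, hρ0, fun u hu hS hE => ?_⟩
  by_contra hcon
  push Not at hcon
  have h1 := hu.torsionEnergy_le_of_thin hN hs0 hρ0 fun p => (hcon p).le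
  rw [hρs] at h1
  have h2 : supportVol u * (2 * (maxEnergy N s / 8) / unitBallVol N) ≤
      unitBallVol N * (2 * (maxEnergy N s / 8) / unitBallVol N) := by gcongr
  have h3 : unitBallVol N * (2 * (maxEnergy N s / 8) / unitBallVol N) = maxEnergy N s / 4 := by
    field_simp; ring
  linarith

/-- Among `J` consecutive shells of a set of finite measure, one carries at most its share. -/
lemma exists_thin_shell {S : Set (Eu N)} (hSm : MeasurableSet S) (hSf : volume S ≠ ⊤) (p : Eu N)
    (ρ : ℝ) {ℓ b : ℝ} (hℓ0 : 0 < ℓ) {J : ℕ} (hb : volume.real S < J * b) :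
    ∃ j < J, volume.real (S ∩ (Metric.ball p (ρ + j * ℓ + ℓ) \
      Metric.ball p (ρ + j * ℓ))) ≤ b := by
  by_contra hcon
  push Not at hcon
  have hdis : Pairwise fun i j : ℕ =>
      Disjoint (S ∩ (Metric.ball p (ρ + i * ℓ + ℓ) \ Metric.ball p (ρ + i * ℓ)))
      (S ∩ (Metric.ball p (ρ + j * ℓ + ℓ) \ Metric.ball p (ρ + j * ℓ))) := by
    intro i j hij
    rw [Set.disjoint_left]
    rintro x ⟨-, hx1, hx2⟩ ⟨-, hx3, hx4⟩
    rw [Metric.mem_ball] at hx1 hx2 hx3 hx4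
    rcases lt_or_gt_of_ne hij with h | h
    · have : ((i : ℝ) + 1) * ℓ ≤ j * ℓ := by gcongr; exact_mod_cast h
      linarith
    · have : ((j : ℝ) + 1) * ℓ ≤ i * ℓ := by gcongr; exact_mod_cast h
      linarith
  have h1 : ∑ i ∈ Finset.range J, volume.real (S ∩ (Metric.ball p (ρ + i * ℓ + ℓ) \
      Metric.ball p (ρ + i * ℓ))) ≤ volume.real S := by
    rw [← measureReal_biUnion_finset (fun i _ j _ hij => hdis hij)
      (fun i _ => hSm.inter (measurableSet_ball.diff measurableSet_ball))
      (fun i _ => ne_top_of_le_ne_top hSf (measure_mono Set.inter_subset_left))]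
    exact measureReal_mono (Set.iUnion₂_subset fun i _ => Set.inter_subset_left) hSf
  have h2 : ∑ i ∈ Finset.range J, b ≤
      ∑ i ∈ Finset.range J, volume.real (S ∩ (Metric.ball p (ρ + i * ℓ + ℓ) \
      Metric.ball p (ρ + i * ℓ))) :=
    Finset.sum_le_sum fun i hi => (hcon i (Finset.mem_range.1 hi)).le
  rw [Finset.sum_const, Finset.card_range, nsmul_eq_mul] at h2
  linarith

/-- A near-extremal splitting for a superlinear power leaves almost all mass in one part. -/
lemma le_of_rpow_add_rpow {θ f₁ f₂ κ q δ : ℝ} (hθ0 : 0 < θ) (hf₁0 : 0 ≤ f₁) (hf₂0 : 0 ≤ f₂)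
    (hq : q = (1 - κ) ^ θ) (hq1 : q < 1) (hδ : δ = (1 - q) / 8)
    (hf12 : f₁ + f₂ ≤ 1 + δ) (hf₂ : f₂ < 1 - κ)
    (hmain : 1 - 2 * δ ≤ f₁ ^ (θ + 1) + f₂ ^ (θ + 1)) : 1 - κ ≤ f₁ := by
  by_contra hlt
  push Not at hlt
  have hq0 : 0 ≤ q := hq ▸ Real.rpow_nonneg (by linarith) _
  have hb : ∀ f : ℝ, 0 ≤ f → f < 1 - κ → f ^ (θ + 1) ≤ q * f := by
    intro f hf0 hf
    rw [Real.rpow_add_one' hf0 (by linarith), hq]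
    exact mul_le_mul_of_nonneg_right (Real.rpow_le_rpow hf0 hf.le hθ0.le) hf0
  have h1 := hb f₁ hf₁0 hlt
  have h2 := hb f₂ hf₂0 hf₂
  have h3 : q * (f₁ + f₂) ≤ q * (1 + δ) := by gcongr
  have h4 : q * δ ≤ 1 * δ := mul_le_mul_of_nonneg_right hq1.le (by linarith)
  linarith

/-- Almost maximising functions are uniformly concentrated. -/
lemma exists_tight (hN : 2 ≤ N) (hs0 : 0 < s) (hs1 : s < 1) (k : ℝ) {κ : ℝ} (hκ : 0 < κ) :
    ∃ η R : ℝ, 0 < η ∧ 0 < R ∧ ∀ u : Eu N → ℝ, Adm N s u → (∀ x, u x ≤ k) →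
      supportVol u ≤ unitBallVol N → maxEnergy N s - η ≤ torsionEnergy N s u →
      ∃ p, volume.real (Function.support u \ Metric.ball p R) ≤ κ * unitBallVol N := by
  have hω := unitBallVol_pos N
  have hM := maxEnergy_pos hN hs0 hs1
  obtain ⟨ρ, hρ, hnv⟩ := exists_nonvanishing hN hs0 hs1
  set β := 1 / 2 * ρ ^ N with hβ
  have hβ0 : 0 < β := by positivity
  set κ₃ := min (min κ (β / 2)) (1 / 2) with hκ₃
  have hκ₃0 : 0 < κ₃ := by positivity
  have hκ₃1 : κ₃ ≤ 1 / 2 := min_le_right _ _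
  have hκ₃κ : κ₃ ≤ κ := (min_le_left _ _).trans (min_le_left _ _)
  have hκ₃β : κ₃ ≤ β / 2 := (min_le_left _ _).trans (min_le_right _ _)
  set θ := volExp N s - 1 with hθ
  have hθ0 : 0 < θ := sub_pos.2 (one_lt_volExp hN hs0)
  set q := (1 - κ₃) ^ θ with hq
  have hq1 : q < 1 := Real.rpow_lt_one (by linarith) (by linarith) hθ0
  have hq0 : 0 < q := Real.rpow_pos_of_pos (by linarith) _
  set δ := (1 - q) / 8 with hδ
  have hδ0 : 0 < δ := by rw [hδ]; linarith
  obtain ⟨J, hJ⟩ := exists_nat_gt (1 / δ)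
  have hJ0 : 0 < J := by
    rcases Nat.eq_zero_or_pos J with h | h
    · rw [h] at hJ; have : 0 < 1 / δ := by positivity
      simp at hJ; linarith
    · exact h
  obtain ⟨ℓ, hℓ0, hℓ⟩ : ∃ ℓ : ℝ, 0 < ℓ ∧
      Real.pi ^ 2 / 2 * k ^ 2 * truncMass N s ℓ * unitBallVol N ≤ maxEnergy N s * δ := by
    have h1 : Tendsto (fun ℓ => Real.pi ^ 2 / 2 * k ^ 2 * truncMass N s ℓ * unitBallVol N) atTop
        (𝓝 (Real.pi ^ 2 / 2 * k ^ 2 * 0 * unitBallVol N)) :=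
      ((tendsto_truncMass hN hs0 hs1).const_mul _).mul_const _
    rw [mul_zero, zero_mul] at h1
    have h2 := (h1.eventually (gt_mem_nhds (show 0 < maxEnergy N s * δ by positivity))).and
      (eventually_gt_atTop 0)
    obtain ⟨ℓ, h3, h4⟩ := h2.exists
    exact ⟨ℓ, h4, h3.le⟩
  refine ⟨min (maxEnergy N s * δ) (maxEnergy N s / 2), ρ + J * ℓ, by positivity, by positivity,
    fun u hu huk hS hE => ?_⟩
  have hE1 : maxEnergy N s - maxEnergy N s * δ ≤ torsionEnergy N s u :=
    le_trans (by linarith [min_le_left (maxEnergy N s * δ) (maxEnergy N s / 2)]) hE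
  have hE2 : maxEnergy N s / 2 ≤ torsionEnergy N s u :=
    le_trans (by linarith [min_le_right (maxEnergy N s * δ) (maxEnergy N s / 2)]) hE
  obtain ⟨p, hp⟩ := hnv u hu hS hE2
  refine ⟨p, ?_⟩
  set S := Function.support u with hSdef
  have hSm : MeasurableSet S := hu.supp_measurable
  have hfin : ∀ {T : Set (Eu N)}, T ⊆ S → volume T ≠ ⊤ :=
    fun hT => ne_top_of_le_ne_top hu.supp (measure_mono hT)
  obtain ⟨j, hjJ, hj⟩ := exists_thin_shell hSm hu.supp p ρ hℓ0 (J := J)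
    (b := δ * unitBallVol N) (by
      have h3 : 1 < J * δ := by rwa [div_lt_iff₀ hδ0] at hJ
      have h4 : volume.real S ≤ unitBallVol N := hS
      have h5 : 1 * unitBallVol N < J * δ * unitBallVol N := by gcongr
      linarith)
  set r := ρ + j * ℓ with hr
  have hjℓ : 0 ≤ (j : ℝ) * ℓ := by positivity
  obtain ⟨v, w, hv, hw, -, hvs, hws, hcut⟩ := hu.exists_cut hN hs0 hs1 huk p r hℓ0
  have hv1 : supportVol v ≤ volume.real (S ∩ Metric.ball p (r + ℓ)) :=
    measureReal_mono hvs (hfin Set.inter_subset_left)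
  have hw1 : supportVol w ≤ volume.real (S \ Metric.ball p r) :=
    measureReal_mono (hws.trans (Set.sdiff_subset_sdiff_right Metric.ball_subset_closedBall))
      (hfin Set.sdiff_subset)
  have hsum : volume.real (S ∩ Metric.ball p (r + ℓ)) + volume.real (S \ Metric.ball p r) ≤
      (1 + δ) * unitBallVol N := by
    rw [← measureReal_union_add_inter (hSm.diff measurableSet_ball) (hfin Set.inter_subset_left)
      (hfin Set.sdiff_subset)]
    have h1 : volume.real (S ∩ Metric.ball p (r + ℓ) ∪ S \ Metric.ball p r) ≤ supportVol u :=
      measureReal_mono (Set.union_subset Set.inter_subset_left Set.sdiff_subset) hu.supp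
    have h2 : S ∩ Metric.ball p (r + ℓ) ∩ (S \ Metric.ball p r) =
        S ∩ (Metric.ball p (r + ℓ) \ Metric.ball p r) := by
      ext x; simp only [Set.mem_inter_iff, Set.mem_sdiff]; tauto
    rw [h2]; linarith
  have hwβ : supportVol w ≤ (1 - β) * unitBallVol N := by
    refine hw1.trans ?_
    have h1 : volume.real (S \ Metric.ball p r) ≤ volume.real (S \ Metric.ball p ρ) :=
      measureReal_mono (Set.sdiff_subset_sdiff_right (Metric.ball_subset_ball (by linarith)))
        (hfin Set.sdiff_subset)
    have h2 := measureReal_sdiff_add_inter (μ := volume) (s := S) (t := Metric.ball p ρ)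
      measurableSet_ball hu.supp
    have : volume.real S ≤ unitBallVol N := hS
    rw [hβ]; linarith
  set f₁ := supportVol v / unitBallVol N with hf₁
  set f₂ := supportVol w / unitBallVol N with hf₂
  have hf₁0 : 0 ≤ f₁ := div_nonneg (supportVol_nonneg v) hω.le
  have hf₂0 : 0 ≤ f₂ := div_nonneg (supportVol_nonneg w) hω.le
  have hf₂β : f₂ ≤ 1 - β := by rwa [hf₂, div_le_iff₀ hω]
  have hf12 : f₁ + f₂ ≤ 1 + δ := by
    rw [hf₁, hf₂, ← add_div, div_le_iff₀ hω]; linarith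
  have hDv := hv.torsionEnergy_le_rpow hN hs0
  have hDw := hw.torsionEnergy_le_rpow hN hs0
  rw [← hf₁] at hDv
  rw [← hf₂] at hDw
  have hJnn := truncMass_nonneg N s ℓ
  have herr : Real.pi ^ 2 / 2 * k ^ 2 * truncMass N s ℓ *
      volume.real (S \ Metric.closedBall p r) ≤ maxEnergy N s * δ := by
    refine le_trans (mul_le_mul_of_nonneg_left ?_ (by positivity)) hℓ
    exact (measureReal_mono Set.sdiff_subset hu.supp).trans hS
  have hmain : 1 - 2 * δ ≤ f₁ ^ volExp N s + f₂ ^ volExp N s := by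
    have : maxEnergy N s * (1 - 2 * δ) ≤
        maxEnergy N s * (f₁ ^ volExp N s + f₂ ^ volExp N s) := by linarith
    exact le_of_mul_le_mul_left this hM
  have hvolθ : volExp N s = θ + 1 := by rw [hθ]; ring
  have hf₁κ : 1 - κ₃ ≤ f₁ :=
    le_of_rpow_add_rpow hθ0 hf₁0 hf₂0 hq hq1 hδ hf12 (by linarith)
      (by rwa [← hvolθ])
  have hfin1 : (1 - κ₃) * unitBallVol N ≤ volume.real (S ∩ Metric.ball p (r + ℓ)) := by
    refine le_trans ?_ hv1
    rwa [hf₁, le_div_iff₀ hω] at hf₁κ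
  have hrR : r + ℓ ≤ ρ + J * ℓ := by
    have : ((j : ℝ) + 1) * ℓ ≤ J * ℓ := by gcongr; exact_mod_cast hjJ
    rw [hr]; linarith
  have h5 : volume.real (S \ Metric.ball p (ρ + J * ℓ)) ≤ volume.real (S \ Metric.ball p (r + ℓ)) :=
    measureReal_mono (Set.sdiff_subset_sdiff_right (Metric.ball_subset_ball hrR))
      (hfin Set.sdiff_subset)
  have h6 := measureReal_sdiff_add_inter (μ := volume) (s := S) (t := Metric.ball p (r + ℓ))
    measurableSet_ball hu.supp
  have h7 : volume.real S ≤ unitBallVol N := hS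
  have h8 : κ₃ * unitBallVol N ≤ κ * unitBallVol N := by gcongr
  linarith

end Tightness

section Centering

variable {N : ℕ} {s : ℝ} {u : Eu N → ℝ}

/-- Gaussian potential of `u` at scale `lam`. -/
def gaussPot (lam : ℝ) (u : Eu N → ℝ) (p : Eu N) : ℝ :=
  ∫ x, u x * Real.exp (-(‖x - p‖ ^ 2 / lam ^ 2))

lemma exp_neg_midpoint_eq (a b Q : ℝ) :
    Real.exp (-((a + b) / 2 - Q / 4)) - (Real.exp (-a) + Real.exp (-b)) / 2 =
      Real.exp (-((a + b) / 2)) * (Real.exp (Q / 4) - Real.cosh ((a - b) / 2)) := by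
  rw [Real.cosh_eq, mul_sub, ← Real.exp_add, mul_div_assoc', mul_add, ← Real.exp_add,
    ← Real.exp_add]
  ring_nf

lemma exp_neg_midpoint_near {a b Q : ℝ} (hQ0 : 0 ≤ Q) (hab : a + b ≤ 1 / 2)
    (hΔ : (a - b) ^ 2 ≤ Q * (2 * (a + b))) :
    (Real.exp (-a) + Real.exp (-b)) / 2 + Q / 16 ≤ Real.exp (-((a + b) / 2 - Q / 4)) := by
  have h1 := exp_neg_midpoint_eq a b Q
  have h2 : Real.cosh ((a - b) / 2) ≤ Real.exp (Q / 8) := by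
    refine (Real.cosh_le_exp_half_sq _).trans (Real.exp_le_exp.2 ?_)
    nlinarith
  have h3 : Real.exp (Q / 4) = Real.exp (Q / 8) * Real.exp (Q / 8) := by
    rw [← Real.exp_add]; ring_nf
  have h4 := Real.add_one_le_exp (Q / 8)
  have h5 : Q / 8 ≤ Real.exp (Q / 4) - Real.cosh ((a - b) / 2) := by nlinarith
  have h6 : 1 / 2 ≤ Real.exp (-((a + b) / 2)) := by
    have := Real.add_one_le_exp (-((a + b) / 2)); linarith
  have h7 : 1 / 2 * (Q / 8) ≤
      Real.exp (-((a + b) / 2)) * (Real.exp (Q / 4) - Real.cosh ((a - b) / 2)) := by gcongr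
  linarith

lemma exp_neg_midpoint_far {a b Q : ℝ} (hQ0 : 0 ≤ Q) (hQ1 : Q ≤ 1) (hab : 0 ≤ a + b)
    (hΔ : (a - b) ^ 2 ≤ Q * (2 * (a + b))) :
    (Real.exp (-a) + Real.exp (-b)) / 2 - Q ≤ Real.exp (-((a + b) / 2 - Q / 4)) := by
  have h1 := exp_neg_midpoint_eq a b Q
  set t := (a + b) / 4 with ht
  have ht0 : 0 ≤ t := by positivity
  have h2 : Real.cosh ((a - b) / 2) ≤ Real.exp (Q * t) := by
    refine (Real.cosh_le_exp_half_sq _).trans (Real.exp_le_exp.2 ?_)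
    rw [ht]; nlinarith
  have h3 : Real.exp (Q * t) - 1 ≤ Q * t * Real.exp t := by
    have h4 := Real.add_one_le_exp (-(Q * t))
    have h5 : Real.exp (Q * t) * Real.exp (-(Q * t)) = 1 := by
      rw [← Real.exp_add]; simp
    have h6 : Real.exp (Q * t) ≤ Real.exp t := Real.exp_le_exp.2 (by nlinarith)
    have h7 : Real.exp (Q * t) * (-(Q * t) + 1) ≤ 1 :=
      (mul_le_mul_of_nonneg_left h4 (Real.exp_pos _).le).trans h5.le
    have h8 : Q * t * Real.exp (Q * t) ≤ Q * t * Real.exp t := by gcongr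
    linarith
  have h4 : 1 ≤ Real.exp (Q / 4) := Real.one_le_exp (by positivity)
  have h5 : Real.exp (-((a + b) / 2)) * (Q * t * Real.exp t) ≤ Q := by
    have e1 : Real.exp (-((a + b) / 2)) * Real.exp t = Real.exp (-t) := by
      rw [← Real.exp_add]; congr 1; rw [ht]; ring
    have e2 : t * Real.exp (-t) ≤ 1 := by
      rw [Real.exp_neg, ← div_eq_mul_inv, div_le_one (Real.exp_pos _)]
      linarith [Real.add_one_le_exp t]
    calc Real.exp (-((a + b) / 2)) * (Q * t * Real.exp t)
        = Q * (t * (Real.exp (-((a + b) / 2)) * Real.exp t)) := by ring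
      _ = Q * (t * Real.exp (-t)) := by rw [e1]
      _ ≤ Q * 1 := by gcongr
      _ = Q := mul_one Q
  have h6 : -(Q * t * Real.exp t) ≤ Real.exp (Q / 4) - Real.cosh ((a - b) / 2) := by linarith
  have h7 : Real.exp (-((a + b) / 2)) * -(Q * t * Real.exp t) ≤
      Real.exp (-((a + b) / 2)) * (Real.exp (Q / 4) - Real.cosh ((a - b) / 2)) := by gcongr
  linarith

lemma continuous_gaussPot (lam : ℝ) (hu : Integrable u) : Continuous (gaussPot lam u) := by
  unfold gaussPot
  refine continuous_of_dominated (bound := fun x => ‖u x‖) (fun p => ?_) (fun p => ?_) hu.norm ?_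
  · exact hu.aestronglyMeasurable.mul (Continuous.aestronglyMeasurable (by fun_prop))
  · refine Eventually.of_forall fun x => ?_
    rw [norm_mul, Real.norm_of_nonneg (Real.exp_pos _).le]
    refine mul_le_of_le_one_right (norm_nonneg _) (Real.exp_le_one_iff.2 ?_)
    have : 0 ≤ ‖x - p‖ ^ 2 / lam ^ 2 := by positivity
    linarith
  · exact Eventually.of_forall fun x => by fun_prop

lemma integrable_mul_gauss (lam : ℝ) (hu : Integrable u) (p : Eu N) :
    Integrable fun x => u x * Real.exp (-(‖x - p‖ ^ 2 / lam ^ 2)) := by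
  refine hu.norm.mono' (hu.aestronglyMeasurable.mul
    (Continuous.aestronglyMeasurable (by fun_prop))) (Eventually.of_forall fun x => ?_)
  rw [norm_mul, Real.norm_of_nonneg (Real.exp_pos _).le]
  refine mul_le_of_le_one_right (norm_nonneg _) (Real.exp_le_one_iff.2 ?_)
  have : 0 ≤ ‖x - p‖ ^ 2 / lam ^ 2 := by positivity
  linarith

/-- A concentrated function has a quantitative Gaussian center. -/
lemma exists_center (hu : Integrable u) (hu0 : ∀ x, 0 ≤ u x) {lam R : ℝ} (hlam : 0 < lam)
    (hR : 256 * R ≤ lam) (p₀ : Eu N)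
    (hout : 100000 * ∫ x in (Metric.ball p₀ R)ᶜ, u x ≤ ∫ x in Metric.ball p₀ R, u x)
    (hin : 0 < ∫ x in Metric.ball p₀ R, u x) :
    ∃ p, 64 * ‖p - p₀‖ ≤ lam ∧ ∀ q, 8 * ‖q - p‖ ≤ lam →
      (∫ x in Metric.ball p₀ R, u x) * (‖q - p‖ ^ 2 / (16 * lam ^ 2)) ≤
        gaussPot lam u p - gaussPot lam u q := by
  set Ui := ∫ x in Metric.ball p₀ R, u x with hUi
  set Uo := ∫ x in (Metric.ball p₀ R)ᶜ, u x with hUo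
  have hRpos : 0 < R := by
    by_contra h
    rw [hUi, Metric.ball_eq_empty.2 (not_lt.1 h)] at hin
    simp at hin
  have hsplit : ∀ f : Eu N → ℝ, Integrable f → ∫ x, f x =
      (∫ x in Metric.ball p₀ R, f x) + ∫ x in (Metric.ball p₀ R)ᶜ, f x := fun f hf =>
    (integral_add_compl measurableSet_ball hf).symm
  obtain ⟨p, hpK, hpmax⟩ := (isCompact_closedBall p₀ (lam / 4)).exists_isMaxOn
    ⟨p₀, Metric.mem_closedBall_self (by positivity)⟩ (continuous_gaussPot lam hu).continuousOn
  have hcmp : ∀ (p : Eu N) (f : Eu N → ℝ) (i o : ℝ), Integrable f →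
      (∀ x ∈ Metric.ball p₀ R, u x * i ≤ f x) → (∀ x ∈ (Metric.ball p₀ R)ᶜ, u x * o ≤ f x) →
      Ui * i + Uo * o ≤ ∫ x, f x := by
    intro p f i o hf h1 h2
    rw [hsplit f hf, hUi, hUo, ← integral_mul_const, ← integral_mul_const]
    exact add_le_add
      (setIntegral_mono_on (hu.mul_const i).integrableOn hf.integrableOn measurableSet_ball h1)
      (setIntegral_mono_on (hu.mul_const o).integrableOn hf.integrableOn
        measurableSet_ball.compl h2)
  have hcenter : 64 * ‖p - p₀‖ ≤ lam := by
    by_contra hcon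
    push Not at hcon
    have h1 : Ui * (1 - 1 / 65536) + Uo * 0 ≤ gaussPot lam u p₀ := by
      refine hcmp p₀ _ _ _ (integrable_mul_gauss lam hu p₀) (fun x hx => ?_) fun x _ => ?_
      · refine mul_le_mul_of_nonneg_left ?_ (hu0 x)
        have h2 : ‖x - p₀‖ ^ 2 / lam ^ 2 ≤ 1 / 65536 := by
          rw [div_le_iff₀ (by positivity)]
          rw [mem_ball_iff_norm] at hx
          have : ‖x - p₀‖ ^ 2 ≤ (lam / 256) ^ 2 := by gcongr; linarith
          linarith
        have := Real.add_one_le_exp (-(‖x - p₀‖ ^ 2 / lam ^ 2))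
        linarith
      · rw [mul_zero]; exact mul_nonneg (hu0 x) (Real.exp_pos _).le
    have h2 : Ui * -(1 - 8 / 65536) + Uo * -1 ≤ -gaussPot lam u p := by
      rw [gaussPot, ← integral_neg]
      refine hcmp p _ _ _ (integrable_mul_gauss lam hu p).neg (fun x hx => ?_) fun x _ => ?_
      · rw [mul_neg, neg_le_neg_iff]
        refine mul_le_mul_of_nonneg_left ?_ (hu0 x)
        have h2 : 9 / 65536 ≤ ‖x - p‖ ^ 2 / lam ^ 2 := by
          rw [le_div_iff₀ (by positivity)]
          rw [mem_ball_iff_norm] at hx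
          have h3 : ‖p - p₀‖ ≤ ‖x - p₀‖ + ‖x - p‖ := by
            have := norm_sub_le (x - p₀) (x - p)
            rwa [sub_sub_sub_cancel_left] at this
          have : (3 * lam / 256) ^ 2 ≤ ‖x - p‖ ^ 2 := by gcongr; linarith
          linarith
        calc Real.exp (-(‖x - p‖ ^ 2 / lam ^ 2)) ≤ Real.exp (-(9 / 65536)) :=
              Real.exp_le_exp.2 (by linarith)
          _ ≤ (1 + 9 / 65536)⁻¹ := by
              rw [Real.exp_neg]
              have := Real.add_one_le_exp (9 / 65536 : ℝ)
              gcongr; linarith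
          _ ≤ _ := by norm_num
      · rw [mul_neg, mul_one, neg_le_neg_iff]
        refine mul_le_of_le_one_right (hu0 x) (Real.exp_le_one_iff.2 ?_)
        have : 0 ≤ ‖x - p‖ ^ 2 / lam ^ 2 := by positivity
        linarith
    have h3 : gaussPot lam u p₀ ≤ gaussPot lam u p :=
      hpmax (Metric.mem_closedBall_self (by positivity))
    linarith
  refine ⟨p, hcenter, fun q hq => ?_⟩
  set Q := ‖q - p‖ ^ 2 / lam ^ 2 with hQ
  have hQ0 : 0 ≤ Q := by positivity
  have hQ1 : Q ≤ 1 := by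
    rw [hQ, div_le_one (by positivity)]
    gcongr
    linarith [norm_nonneg (q - p)]
  have hqK : q ∈ Metric.closedBall p₀ (lam / 4) := by
    rw [mem_closedBall_iff_norm]
    have := norm_add_le (q - p) (p - p₀)
    rw [sub_add_sub_cancel] at this
    linarith
  have hmid : gaussPot lam u (midpoint ℝ p q) ≤ gaussPot lam u p :=
    hpmax ((convex_closedBall p₀ (lam / 4)).midpoint_mem hpK hqK)
  have hpar : ∀ x, ‖x - midpoint ℝ p q‖ ^ 2 / lam ^ 2 =
      (‖x - p‖ ^ 2 / lam ^ 2 + ‖x - q‖ ^ 2 / lam ^ 2) / 2 - Q / 4 := by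
    intro x
    have h1 : x - midpoint ℝ p q = (1 / 2 : ℝ) • ((x - p) + (x - q)) := by
      rw [midpoint_eq_smul_add, invOf_eq_inv]; module
    have h2 : q - p = (x - p) - (x - q) := by abel
    have h3 := parallelogram_law_with_norm ℝ (x - p) (x - q)
    rw [hQ, h1, h2, norm_smul, mul_pow, Real.norm_of_nonneg (by norm_num)]
    have : ‖x - p + (x - q)‖ ^ 2 = 2 * (‖x - p‖ ^ 2 + ‖x - q‖ ^ 2) -
        ‖x - p - (x - q)‖ ^ 2 := by nlinarith
    rw [this]; ring
  have hΔ : ∀ x, (‖x - p‖ ^ 2 / lam ^ 2 - ‖x - q‖ ^ 2 / lam ^ 2) ^ 2 ≤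
      Q * (2 * (‖x - p‖ ^ 2 / lam ^ 2 + ‖x - q‖ ^ 2 / lam ^ 2)) := by
    intro x
    have h1 : |‖x - p‖ - ‖x - q‖| ≤ ‖q - p‖ := by
      refine (abs_norm_sub_norm_le _ _).trans ?_
      rw [sub_sub_sub_cancel_left]
    have h2 : (‖x - p‖ - ‖x - q‖) ^ 2 ≤ ‖q - p‖ ^ 2 := sq_le_sq' (by
      linarith [(abs_le.1 h1).1]) (abs_le.1 h1).2
    have h3 : (‖x - p‖ + ‖x - q‖) ^ 2 ≤ 2 * (‖x - p‖ ^ 2 + ‖x - q‖ ^ 2) := by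
      nlinarith [sq_nonneg (‖x - p‖ - ‖x - q‖)]
    have h4 : (‖x - p‖ - ‖x - q‖) ^ 2 * (‖x - p‖ + ‖x - q‖) ^ 2 ≤
      ‖q - p‖ ^ 2 * (2 * (‖x - p‖ ^ 2 + ‖x - q‖ ^ 2)) := by gcongr
    rw [hQ, ← sub_div, ← add_div, div_pow, mul_div_assoc', div_mul_div_comm,
      ← pow_two (lam ^ 2)]
    gcongr
    linarith
  have hkey : Ui * (Q / 16) + Uo * -Q ≤ gaussPot lam u (midpoint ℝ p q) -
      (gaussPot lam u p + gaussPot lam u q) / 2 := by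
    have h1 : gaussPot lam u (midpoint ℝ p q) -
      (gaussPot lam u p + gaussPot lam u q) / 2 =
        ∫ x, (u x * Real.exp (-(‖x - midpoint ℝ p q‖ ^ 2 / lam ^ 2)) -
          (u x * Real.exp (-(‖x - p‖ ^ 2 / lam ^ 2)) +
            u x * Real.exp (-(‖x - q‖ ^ 2 / lam ^ 2))) / 2) := by
      have h2 := integral_add (integrable_mul_gauss lam hu p) (integrable_mul_gauss lam hu q)
      have h3 := integral_sub (integrable_mul_gauss lam hu (midpoint ℝ p q))
        (((integrable_mul_gauss lam hu p).add (integrable_mul_gauss lam hu q)).div_const 2)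
      rw [integral_div] at h3
      simp only [Pi.add_apply] at h3 h2
      rw [h2] at h3
      exact h3.symm
    rw [h1]
    refine hcmp p _ _ _ ((integrable_mul_gauss lam hu _).sub
        (((integrable_mul_gauss lam hu p).add (integrable_mul_gauss lam hu q)).div_const 2))
        (fun x hx => ?_) fun x _ => ?_
    · have hxp : ‖x - p‖ ^ 2 / lam ^ 2 + ‖x - q‖ ^ 2 / lam ^ 2 ≤ 1 / 2 := by
        rw [mem_ball_iff_norm] at hx
        have h2 : ‖x - p‖ ≤ ‖x - p₀‖ + ‖p - p₀‖ := by
          have := norm_sub_le (x - p₀) (p - p₀)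
          rwa [sub_sub_sub_cancel_right] at this
        have h3 : ‖x - q‖ ≤ ‖x - p‖ + ‖q - p‖ := by
          have := norm_sub_le (x - p) (q - p)
          rwa [sub_sub_sub_cancel_right] at this
        have h4 : ‖x - p‖ ^ 2 ≤ (lam / 2) ^ 2 := by gcongr; linarith
        have h5 : ‖x - q‖ ^ 2 ≤ (lam / 2) ^ 2 := by gcongr; linarith
        rw [← add_div, div_le_iff₀ (by positivity)]
        linarith
      have h2 := mul_le_mul_of_nonneg_left (exp_neg_midpoint_near hQ0 hxp (hΔ x)) (hu0 x)
      rw [← hpar x] at h2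
      linarith
    · have h2 := mul_le_mul_of_nonneg_left
        (exp_neg_midpoint_far hQ0 hQ1 (by positivity) (hΔ x)) (hu0 x)
      rw [← hpar x] at h2
      linarith
  have h5 : Ui * (‖q - p‖ ^ 2 / (16 * lam ^ 2)) = Ui * (Q / 16) := by
    rw [hQ]; congr 1; field_simp
  rw [h5]
  have h6 : 100000 * Uo * Q ≤ Ui * Q := by gcongr
  have h7 : 0 ≤ Ui * Q := by positivity
  linarith

end Centering

section Polarization

variable {N : ℕ} {s : ℝ} {u : Eu N → ℝ}

/-- Signed distance to the hyperplane `⟪x, e⟫ = c`. -/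
def sdist (e : Eu N) (c : ℝ) (x : Eu N) : ℝ := c - inner ℝ x e

/-- Reflection across the hyperplane `⟪x, e⟫ = c`. -/
def hrefl (e : Eu N) (c : ℝ) (x : Eu N) : Eu N := x + (2 * sdist e c x) • e

lemma continuous_sdist (e : Eu N) (c : ℝ) : Continuous (sdist e c) := by
  unfold sdist; fun_prop

lemma continuous_hrefl (e : Eu N) (c : ℝ) : Continuous (hrefl e c) := by
  unfold hrefl sdist; fun_prop

lemma hrefl_of_sdist_eq_zero (e : Eu N) (c : ℝ) {x : Eu N} (h : sdist e c x = 0) : hrefl e c x = x := by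
  simp [hrefl, h]

lemma sdist_hrefl {e : Eu N} (he : ‖e‖ = 1) (c : ℝ) (x : Eu N) :
    sdist e c (hrefl e c x) = -sdist e c x := by
  unfold hrefl sdist
  rw [inner_add_left, inner_smul_left, real_inner_self_eq_norm_sq, he]
  simp; ring

lemma hrefl_hrefl {e : Eu N} (he : ‖e‖ = 1) (c : ℝ) (x : Eu N) : hrefl e c (hrefl e c x) = x := by
  conv_lhs => rw [hrefl, sdist_hrefl he]
  unfold hrefl
  module

lemma norm_sub_hrefl_sq {e : Eu N} (he : ‖e‖ = 1) (c : ℝ) (x y : Eu N) :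
    ‖x - hrefl e c y‖ ^ 2 = ‖x - y‖ ^ 2 + 4 * sdist e c x * sdist e c y := by
  have h1 : x - hrefl e c y = (x - y) - (2 * sdist e c y) • e := by unfold hrefl; abel
  have h2 : inner ℝ (x - y) e = sdist e c y - sdist e c x := by
    unfold sdist; rw [inner_sub_left]; ring
  rw [h1, norm_sub_sq_real, inner_smul_right, h2, norm_smul, he, mul_one, Real.norm_eq_abs, sq_abs]
  ring

lemma norm_sub_hrefl_comm {e : Eu N} (he : ‖e‖ = 1) (c : ℝ) (x y : Eu N) :
    ‖hrefl e c x - y‖ = ‖x - hrefl e c y‖ := by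
  rw [← sq_eq_sq₀ (norm_nonneg _) (norm_nonneg _), norm_sub_rev, norm_sub_hrefl_sq he,
    norm_sub_hrefl_sq he, norm_sub_rev]
  ring

lemma norm_hrefl_sub_hrefl {e : Eu N} (he : ‖e‖ = 1) (c : ℝ) (x y : Eu N) :
    ‖hrefl e c x - hrefl e c y‖ = ‖x - y‖ := by
  rw [norm_sub_hrefl_comm he, hrefl_hrefl he]

lemma measurePreserving_hrefl {e : Eu N} (he : ‖e‖ = 1) (c : ℝ) : MeasurePreserving (hrefl e c) := by
  have h1 : hrefl e c = (fun x => x + (2 * c) • e) ∘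
      ((ℝ ∙ e)ᗮ.reflection : Eu N → Eu N) := by
    funext x
    have h2 := (ℝ ∙ e).reflection_orthogonal_apply (v := x)
    rw [Submodule.reflection_singleton_apply] at h2
    simp only [Function.comp_apply, h2, he, hrefl, sdist]
    rw [real_inner_comm]
    simp
    module
  rw [h1]
  exact (measurePreserving_add_right volume _).comp
    ((ℝ ∙ e)ᗮ.reflection : Eu N ≃ₗᵢ[ℝ] Eu N).measurePreserving

lemma lintegral_comp_hrefl {e : Eu N} (he : ‖e‖ = 1) (c : ℝ) (f : Eu N → ℝ≥0∞) :
    ∫⁻ x, f (hrefl e c x) = ∫⁻ x, f x := by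
  have hm := measurePreserving_hrefl he c
  let E : Eu N ≃ᵐ Eu N :=
    { toFun := hrefl e c, invFun := hrefl e c, left_inv := hrefl_hrefl he c,
      right_inv := hrefl_hrefl he c, measurable_toFun := hm.measurable,
      measurable_invFun := hm.measurable }
  exact hm.lintegral_comp_emb E.measurableEmbedding f

/-- Polarization of `u` with respect to the half-space `sdist e c > 0`. -/
def polarize (e : Eu N) (c : ℝ) (u : Eu N → ℝ) (x : Eu N) : ℝ :=
  if 0 < sdist e c x then max (u x) (u (hrefl e c x)) else min (u x) (u (hrefl e c x))

lemma measurable_polarize (e : Eu N) (c : ℝ) (hu : Measurable u) :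
    Measurable (polarize e c u) :=
  Measurable.ite (measurableSet_lt measurable_const (continuous_sdist e c).measurable)
    (hu.max (hu.comp (continuous_hrefl e c).measurable))
    (hu.min (hu.comp (continuous_hrefl e c).measurable))

lemma polarize_pair {e : Eu N} (he : ‖e‖ = 1) (c : ℝ) (u : Eu N → ℝ) (x : Eu N) :
    (0 ≤ sdist e c x ∧ polarize e c u x = max (u x) (u (hrefl e c x)) ∧
      polarize e c u (hrefl e c x) = min (u x) (u (hrefl e c x))) ∨
    (sdist e c x < 0 ∧ polarize e c u x = min (u x) (u (hrefl e c x)) ∧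
      polarize e c u (hrefl e c x) = max (u x) (u (hrefl e c x))) := by
  unfold polarize
  rw [sdist_hrefl he, hrefl_hrefl he]
  rcases lt_trichotomy (sdist e c x) 0 with h | h | h
  · right
    rw [if_neg (not_lt.2 h.le), if_pos (by linarith)]
    exact ⟨h, rfl, max_comm _ _⟩
  · left
    have := hrefl_of_sdist_eq_zero e c h
    simp [h, this]
  · left
    rw [if_pos h, if_neg (by linarith)]
    exact ⟨h.le, rfl, min_comm _ _⟩

lemma lintegral_polarize {e : Eu N} (he : ‖e‖ = 1) (c : ℝ) (hu : Measurable u)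
    {Φ : ℝ → ℝ≥0∞} (hΦ : Measurable Φ) :
    ∫⁻ x, Φ (polarize e c u x) = ∫⁻ x, Φ (u x) := by
  have hv := measurable_polarize e c hu
  have key : ∀ w : Eu N → ℝ, Measurable w →
      ∫⁻ x, (Φ (w x) + Φ (w (hrefl e c x))) = 2 * ∫⁻ x, Φ (w x) := by
    intro w hw
    have hΦw : Measurable fun x => Φ (w x) := hΦ.comp hw
    rw [lintegral_add_left hΦw, lintegral_comp_hrefl he c fun x => Φ (w x), two_mul]
  have h1 : ∫⁻ x, (Φ (polarize e c u x) + Φ (polarize e c u (hrefl e c x))) =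
      ∫⁻ x, (Φ (u x) + Φ (u (hrefl e c x))) := by
    refine lintegral_congr fun x => ?_
    rcases polarize_pair he c u x with ⟨-, h1, h2⟩ | ⟨-, h1, h2⟩ <;> rw [h1, h2] <;>
      rcases le_total (u x) (u (hrefl e c x)) with h | h <;> simp [h, add_comm]
  rw [key _ hv, key _ hu] at h1
  exact (ENNReal.mul_right_inj two_ne_zero ENNReal.ofNat_ne_top).1 h1

lemma lintegral_lintegral_hrefl_symm {e : Eu N} (he : ‖e‖ = 1) (c : ℝ)
    {F : Eu N → Eu N → ℝ≥0∞} (hF : Measurable fun p : Eu N × Eu N => F p.1 p.2) :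
    ∫⁻ x, ∫⁻ y, (F x y + F (hrefl e c x) (hrefl e c y) + F (hrefl e c x) y +
      F x (hrefl e c y)) = 4 * ∫⁻ x, ∫⁻ y, F x y := by
  have hr := (continuous_hrefl e c).measurable
  have hs : ∀ x, Measurable (F x) := fun x => hF.of_uncurry_left
  have hs' : ∀ x, Measurable fun y => F x (hrefl e c y) := fun x => (hs x).comp hr
  have hI : Measurable fun x => ∫⁻ y, F x y := hF.lintegral_prod_right'
  have h1 : ∀ x, ∫⁻ y, (F x y + F (hrefl e c x) (hrefl e c y) + F (hrefl e c x) y +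
      F x (hrefl e c y)) = 2 * (∫⁻ y, F x y) + 2 * ∫⁻ y, F (hrefl e c x) y := by
    intro x
    have m1 : Measurable fun y => F x y + F (hrefl e c x) (hrefl e c y) := (hs x).add (hs' _)
    have m2 : Measurable fun y => F x y + F (hrefl e c x) (hrefl e c y) + F (hrefl e c x) y :=
      m1.add (hs _)
    rw [lintegral_add_left m2, lintegral_add_left m1, lintegral_add_left (hs x),
      lintegral_comp_hrefl he c (F x), lintegral_comp_hrefl he c (F (hrefl e c x))]
    ring
  simp_rw [h1]
  have hI' : Measurable fun x => ∫⁻ y, F (hrefl e c x) y := hI.comp hr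
  rw [lintegral_add_left (hI.const_mul 2), lintegral_const_mul 2 hI,
    lintegral_const_mul 2 hI', lintegral_comp_hrefl he c fun x => ∫⁻ y, F x y]
  ring

end Polarization

section PolarizationEnergy

variable {N : ℕ} {s : ℝ} {u : Eu N → ℝ}

lemma two_point_polarize_same {a a' b b' K₁ K₂ : ℝ} (hK : K₂ ≤ K₁ ∨ (a = b ∧ a' = b')) :
    |max a a' - max b b'| ^ 2 * K₁ + |min a a' - min b b'| ^ 2 * K₁ +
      |min a a' - max b b'| ^ 2 * K₂ + |max a a' - min b b'| ^ 2 * K₂ +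
      2 * max (a - a') 0 * max (b' - b) 0 * (K₁ - K₂) ≤
    |a - b| ^ 2 * K₁ + |a' - b'| ^ 2 * K₁ + |a' - b| ^ 2 * K₂ + |a - b'| ^ 2 * K₂ := by
  simp only [sq_abs]
  rcases hK with hK | ⟨rfl, rfl⟩
  · rcases le_total a a' with h1 | h1 <;> rcases le_total b b' with h2 | h2
    · rw [max_eq_right h1, max_eq_right h2, min_eq_left h1, min_eq_left h2,
        max_eq_right (sub_nonpos.2 h1)]
      linarith
    · rw [max_eq_right h1, max_eq_left h2, min_eq_left h1, min_eq_right h2,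
        max_eq_right (sub_nonpos.2 h1)]
      nlinarith [mul_nonneg (mul_nonneg (sub_nonneg.2 h1) (sub_nonneg.2 h2)) (sub_nonneg.2 hK)]
    · rw [max_eq_left h1, max_eq_right h2, min_eq_right h1, min_eq_left h2,
        max_eq_left (sub_nonneg.2 h1), max_eq_left (sub_nonneg.2 h2)]
      nlinarith
    · rw [max_eq_left h1, max_eq_left h2, min_eq_right h1, min_eq_right h2,
        max_eq_right (sub_nonpos.2 h2)]
      linarith
  · rcases le_total a a' with h1 | h1
    · rw [max_eq_right h1, min_eq_left h1, max_eq_right (sub_nonpos.2 h1)]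
      linarith
    · rw [max_eq_left h1, min_eq_right h1, max_eq_right (sub_nonpos.2 h1)]
      linarith

lemma two_point_polarize_opp {a a' b b' K₁ K₂ : ℝ} (hK : K₁ ≤ K₂ ∨ (a = b' ∧ a' = b)) :
    |max a a' - min b b'| ^ 2 * K₁ + |min a a' - max b b'| ^ 2 * K₁ +
      |min a a' - min b b'| ^ 2 * K₂ + |max a a' - max b b'| ^ 2 * K₂ ≤
    |a - b| ^ 2 * K₁ + |a' - b'| ^ 2 * K₁ + |a' - b| ^ 2 * K₂ + |a - b'| ^ 2 * K₂ := by
  have h := two_point_polarize_same (a := a) (a' := a') (b := b') (b' := b) hK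
  rw [max_comm b', min_comm b'] at h
  have h0 : 0 ≤ 2 * max (a - a') 0 * max (b - b') 0 * (K₂ - K₁) := by
    rcases hK with hK | ⟨rfl, rfl⟩
    · have := sub_nonneg.2 hK; positivity
    · rcases le_total a a' with h1 | h1
      · rw [max_eq_right (sub_nonpos.2 h1)]; simp
      · rw [max_eq_right (b := (0 : ℝ)) (a := a' - a) (sub_nonpos.2 h1)]; simp
  linarith

/-- The pointwise gain of energy under polarization. -/
def polarGain (N : ℕ) (s : ℝ) (e : Eu N) (c : ℝ) (u : Eu N → ℝ) (x y : Eu N) : ℝ :=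
  if 0 < sdist e c x ∧ 0 < sdist e c y then
    2 * max (u x - u (hrefl e c x)) 0 * max (u (hrefl e c y) - u y) 0 *
      (fracKernel N s (x - y) - fracKernel N s (x - hrefl e c y)) else 0

lemma fracKernel_anti (hs : 0 < s) {z w : Eu N} (hz : z ≠ 0) (h : ‖z‖ ≤ ‖w‖) :
    fracKernel N s w ≤ fracKernel N s z := by
  unfold fracKernel
  have := norm_pos_iff.2 hz
  gcongr

lemma fracKernel_congr {z w : Eu N} (h : ‖z‖ = ‖w‖) : fracKernel N s z = fracKernel N s w := by
  rw [fracKernel, fracKernel, h]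

lemma kernel_le_of_same_side (hs : 0 < s) {e : Eu N} (he : ‖e‖ = 1) {c : ℝ} {x y : Eu N}
    (hxy : 0 ≤ sdist e c x * sdist e c y) (hne : x ≠ y) :
    fracKernel N s (x - hrefl e c y) ≤ fracKernel N s (x - y) := by
  refine fracKernel_anti hs (sub_ne_zero.2 hne) ?_
  rw [← sq_le_sq₀ (norm_nonneg _) (norm_nonneg _), norm_sub_hrefl_sq he]
  linarith

lemma polarGain_nonneg (hs : 0 < s) {e : Eu N} (he : ‖e‖ = 1) (c : ℝ) (u : Eu N → ℝ)
    (x y : Eu N) : 0 ≤ polarGain N s e c u x y := by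
  unfold polarGain
  split_ifs with h
  · by_cases hxy : x = y
    · subst hxy
      rcases le_total (u x) (u (hrefl e c x)) with h1 | h1
      · rw [max_eq_right (sub_nonpos.2 h1)]; simp
      · rw [max_eq_right (b := (0 : ℝ)) (a := u (hrefl e c x) - u x) (sub_nonpos.2 h1)]; simp
    · have := sub_nonneg.2 (kernel_le_of_same_side hs he (mul_pos h.1 h.2).le hxy)
      positivity
  · exact le_rfl

lemma gagInt_polarize (hs : 0 < s) {e : Eu N} (he : ‖e‖ = 1) (c : ℝ) (u : Eu N → ℝ)
    (x y : Eu N) :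
    gagInt N s (polarize e c u) x y +
      gagInt N s (polarize e c u) (hrefl e c x) (hrefl e c y) +
      gagInt N s (polarize e c u) (hrefl e c x) y +
      gagInt N s (polarize e c u) x (hrefl e c y) + polarGain N s e c u x y ≤
    gagInt N s u x y + gagInt N s u (hrefl e c x) (hrefl e c y) +
      gagInt N s u (hrefl e c x) y + gagInt N s u x (hrefl e c y) := by
  simp only [gagInt_eq]
  rw [fracKernel_congr (norm_hrefl_sub_hrefl he c x y),
    fracKernel_congr (norm_sub_hrefl_comm he c x y)]
  set K₁ := fracKernel N s (x - y) with hK₁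
  set K₂ := fracKernel N s (x - hrefl e c y) with hK₂
  have hsame : 0 ≤ sdist e c x * sdist e c y →
      K₂ ≤ K₁ ∨ (u x = u y ∧ u (hrefl e c x) = u (hrefl e c y)) := by
    intro h
    by_cases hxy : x = y
    · exact Or.inr ⟨by rw [hxy], by rw [hxy]⟩
    · exact Or.inl (kernel_le_of_same_side hs he h hxy)
  have hopp : sdist e c x * sdist e c y ≤ 0 →
      K₁ ≤ K₂ ∨ (u x = u (hrefl e c y) ∧ u (hrefl e c x) = u y) := by
    intro h
    by_cases hxy : x = hrefl e c y
    · exact Or.inr ⟨by rw [hxy], by rw [hxy, hrefl_hrefl he]⟩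
    · refine Or.inl ?_
      have h1 := kernel_le_of_same_side (s := s) (c := c) hs he (x := x) (y := hrefl e c y)
        (by rw [sdist_hrefl he]; linarith) hxy
      rwa [hrefl_hrefl he] at h1
  have hg0 : ¬ (0 < sdist e c x ∧ 0 < sdist e c y) → polarGain N s e c u x y = 0 :=
    fun h => by rw [polarGain, if_neg h]
  have hgain : (0 ≤ sdist e c x * sdist e c y) → polarGain N s e c u x y ≤
      2 * max (u x - u (hrefl e c x)) 0 * max (u (hrefl e c y) - u y) 0 * (K₁ - K₂) := by
    intro h
    unfold polarGain
    split_ifs with h1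
    · exact le_rfl
    · rcases hsame h with h2 | ⟨h2, h3⟩
      · have := sub_nonneg.2 h2; positivity
      · rw [← h2, ← h3]
        rcases le_total (u x) (u (hrefl e c x)) with h1 | h1
        · rw [max_eq_right (sub_nonpos.2 h1)]; simp
        · rw [max_eq_right (b := (0 : ℝ)) (a := u (hrefl e c x) - u x) (sub_nonpos.2 h1)]; simp
  rcases polarize_pair he c u x with ⟨hx, hx1, hx2⟩ | ⟨hx, hx1, hx2⟩ <;>
    rcases polarize_pair he c u y with ⟨hy, hy1, hy2⟩ | ⟨hy, hy1, hy2⟩ <;>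
    rw [hx1, hx2, hy1, hy2]
  · have h := mul_nonneg hx hy
    have h1 := two_point_polarize_same (hsame h)
    have h2 := hgain h
    linarith
  · have h1 := two_point_polarize_opp (hopp (mul_nonpos_of_nonneg_of_nonpos hx hy.le))
    rw [hg0 (fun h => absurd h.2 (not_lt.2 hy.le))]
    linarith
  · have h1 := two_point_polarize_opp (hopp (mul_nonpos_of_nonpos_of_nonneg hx.le hy))
    rw [hg0 (fun h => absurd h.1 (not_lt.2 hx.le))]
    linarith
  · have h := (mul_pos_of_neg_of_neg hx hy).le
    have h1 := two_point_polarize_same (hsame h)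
    have h2 := hgain h
    linarith

lemma lintegral_symm_add_le {e : Eu N} (he : ‖e‖ = 1) (c : ℝ) {F F' G : Eu N → Eu N → ℝ}
    (hF : Measurable fun p : Eu N × Eu N => F p.1 p.2)
    (hF' : Measurable fun p : Eu N × Eu N => F' p.1 p.2)
    (h0 : ∀ x y, 0 ≤ F x y) (h0' : ∀ x y, 0 ≤ F' x y) (hG : ∀ x y, 0 ≤ G x y)
    (h : ∀ x y, F' x y + F' (hrefl e c x) (hrefl e c y) + F' (hrefl e c x) y +
      F' x (hrefl e c y) + G x y ≤ F x y + F (hrefl e c x) (hrefl e c y) +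
      F (hrefl e c x) y + F x (hrefl e c y)) :
    4 * (∫⁻ x, ∫⁻ y, ENNReal.ofReal (F' x y)) + ∫⁻ x, ∫⁻ y, ENNReal.ofReal (G x y) ≤
      4 * ∫⁻ x, ∫⁻ y, ENNReal.ofReal (F x y) := by
  rw [← lintegral_lintegral_hrefl_symm he c
      (F := fun x y => ENNReal.ofReal (F x y)) hF.ennreal_ofReal,
    ← lintegral_lintegral_hrefl_symm he c
      (F := fun x y => ENNReal.ofReal (F' x y)) hF'.ennreal_ofReal]
  have hr := (continuous_hrefl e c).measurable
  have hr1 : Measurable fun p : Eu N × Eu N => hrefl e c p.1 := hr.comp measurable_fst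
  have hr2 : Measurable fun p : Eu N × Eu N => hrefl e c p.2 := hr.comp measurable_snd
  have m1 := hF'.ennreal_ofReal
  have m2 : Measurable fun p : Eu N × Eu N => ENNReal.ofReal
      (F' (hrefl e c p.1) (hrefl e c p.2)) := m1.comp (hr1.prodMk hr2)
  have m3 : Measurable fun p : Eu N × Eu N => ENNReal.ofReal
      (F' (hrefl e c p.1) p.2) := m1.comp (hr1.prodMk measurable_snd)
  have m4 : Measurable fun p : Eu N × Eu N => ENNReal.ofReal
      (F' p.1 (hrefl e c p.2)) := m1.comp (measurable_fst.prodMk hr2)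
  have m5 := ((m1.add m2).add m3).add m4
  have m6 : Measurable fun x => ∫⁻ y,
      (ENNReal.ofReal (F' x y) + ENNReal.ofReal (F' (hrefl e c x) (hrefl e c y)) +
      ENNReal.ofReal (F' (hrefl e c x) y) +
      ENNReal.ofReal (F' x (hrefl e c y))) := m5.lintegral_prod_right'
  rw [← lintegral_add_left m6]
  refine lintegral_mono fun x => ?_
  have g1 : ∀ x, Measurable fun y => ENNReal.ofReal (F' x y) :=
    fun x => (hF'.of_uncurry_left (x := x)).ennreal_ofReal
  have g2 : ∀ x, Measurable fun y => ENNReal.ofReal (F' x (hrefl e c y)) :=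
    fun x => (g1 x).comp hr
  have m7 : Measurable fun y =>
      (ENNReal.ofReal (F' x y) + ENNReal.ofReal (F' (hrefl e c x) (hrefl e c y)) +
      ENNReal.ofReal (F' (hrefl e c x) y) +
      ENNReal.ofReal (F' x (hrefl e c y))) := (((g1 x).add (g2 _)).add (g1 _)).add (g2 x)
  rw [← lintegral_add_left m7]
  refine lintegral_mono fun y => ?_
  rw [← ENNReal.ofReal_add (h0' _ _) (h0' _ _),
    ← ENNReal.ofReal_add (add_nonneg (h0' _ _) (h0' _ _)) (h0' _ _),
    ← ENNReal.ofReal_add (add_nonneg (add_nonneg (h0' _ _) (h0' _ _)) (h0' _ _)) (h0' _ _),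
    ← ENNReal.ofReal_add (add_nonneg (add_nonneg (add_nonneg (h0' _ _) (h0' _ _)) (h0' _ _))
      (h0' _ _)) (hG x y),
    ← ENNReal.ofReal_add (h0 _ _) (h0 _ _),
    ← ENNReal.ofReal_add (add_nonneg (h0 _ _) (h0 _ _)) (h0 _ _),
    ← ENNReal.ofReal_add (add_nonneg (add_nonneg (h0 _ _) (h0 _ _)) (h0 _ _)) (h0 _ _)]
  exact ENNReal.ofReal_le_ofReal (h x y)

lemma gagliardoSq_polarize (hs : 0 < s) {e : Eu N} (he : ‖e‖ = 1) (c : ℝ) (hu : Measurable u) :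
    4 * gagliardoSq N s (polarize e c u) +
      ∫⁻ x, ∫⁻ y, ENNReal.ofReal (polarGain N s e c u x y) ≤ 4 * gagliardoSq N s u := by
  rw [gagliardoSq_eq, gagliardoSq_eq]
  exact lintegral_symm_add_le he c (measurable_gagInt hu)
    (measurable_gagInt (measurable_polarize e c hu)) (gagInt_nonneg N s u)
    (gagInt_nonneg N s (polarize e c u)) (polarGain_nonneg hs he c u) (gagInt_polarize hs he c u)

/-- Polarization deficit bound: the gain of energy is controlled by the energy deficit. -/
lemma Adm.lintegral_polarGain_le (h : Adm N s u) (hN : 2 ≤ N) (hs : 0 < s)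
    (hS : supportVol u ≤ unitBallVol N) {e : Eu N} (he : ‖e‖ = 1) (c : ℝ) :
    ∫⁻ x, ∫⁻ y, ENNReal.ofReal (polarGain N s e c u x y) ≤
      ENNReal.ofReal (4 * (maxEnergy N s - torsionEnergy N s u)) := by
  have hv := measurable_polarize e c h.meas
  have hv0 : ∀ x, 0 ≤ polarize e c u x := fun x => by
    have h1 := h.nonneg x
    have h2 := h.nonneg (hrefl e c x)
    unfold polarize; split_ifs <;> positivity
  have hmain := gagliardoSq_polarize (s := s) hs he c h.meas
  have h4 : 4 * gagliardoSq N s u ≠ ⊤ := ENNReal.mul_ne_top ENNReal.ofNat_ne_top h.gag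
  have hvol : volume (Function.support (polarize e c u)) = volume (Function.support u) := by
    have h1 := lintegral_polarize (Φ := ({0}ᶜ : Set ℝ).indicator 1) he c h.meas
      (measurable_one.indicator (measurableSet_singleton 0).compl)
    have h2 : ∀ w : Eu N → ℝ, Measurable w →
        ∫⁻ x, ({0}ᶜ : Set ℝ).indicator (1 : ℝ → ℝ≥0∞) (w x) = volume (Function.support w) := by
      intro w hw
      rw [← lintegral_indicator_one
        (show MeasurableSet (Function.support w) from (hw (measurableSet_singleton 0)).compl)]
      rfl
    rwa [h2 _ hv, h2 _ h.meas] at h1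
  have hA : Adm N s (polarize e c u) := by
    obtain ⟨k, hk⟩ := h.bdd
    refine ⟨hv, hv0, ⟨k, fun x => ?_⟩, ?_, ?_⟩
    · unfold polarize
      split_ifs
      · exact max_le (hk _) (hk _)
      · exact (min_le_left _ _).trans (hk _)
    · change volume (Function.support _) ≠ ⊤
      rw [hvol]; exact h.supp
    · intro htop
      rw [htop, ENNReal.mul_top (by norm_num), top_add] at hmain
      exact h4 (top_le_iff.1 hmain)
  have hint : ∫ x, polarize e c u x = ∫ x, u x := by
    rw [integral_eq_lintegral_of_nonneg_ae (Eventually.of_forall hv0) hv.aestronglyMeasurable,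
      integral_eq_lintegral_of_nonneg_ae (Eventually.of_forall h.nonneg)
        h.meas.aestronglyMeasurable,
      lintegral_polarize he c h.meas ENNReal.measurable_ofReal]
  have hE := hA.torsionEnergy_le_maxEnergy hN hs (by rwa [supportVol, measureReal_def, hvol])
  have hG : ∫⁻ x, ∫⁻ y, ENNReal.ofReal (polarGain N s e c u x y) ≠ ⊤ := fun htop => by
    rw [htop, add_top] at hmain
    exact h4 (top_le_iff.1 hmain)
  rw [← ENNReal.ofReal_toReal hG]
  refine ENNReal.ofReal_le_ofReal ?_
  have h5 := ENNReal.toReal_mono h4 hmain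
  rw [ENNReal.toReal_add (ENNReal.mul_ne_top ENNReal.ofNat_ne_top hA.gag) hG, ENNReal.toReal_mul,
    ENNReal.toReal_mul] at h5
  unfold torsionEnergy gagliardoSqR at *
  rw [hint] at hE
  simp only [ENNReal.toReal_ofNat] at h5
  linarith

end PolarizationEnergy

section PolarizationGain

variable {N : ℕ} {s : ℝ} {u : Eu N → ℝ}

/-- Positive part of the reflection asymmetry of `u`, weighted by the distance to the hyperplane
and a Gaussian. -/
def gaussAsym (lam : ℝ) (e : Eu N) (c : ℝ) (p : Eu N) (u : Eu N → ℝ) (x : Eu N) : ℝ :=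
  if 0 < sdist e c x then
    max (u x - u (hrefl e c x)) 0 * sdist e c x * Real.exp (-(‖x - p‖ ^ 2 / lam ^ 2)) else 0

lemma gaussAsym_nonneg (lam : ℝ) (e : Eu N) (c : ℝ) (p : Eu N) (u : Eu N → ℝ) (x : Eu N) :
    0 ≤ gaussAsym lam e c p u x := by
  unfold gaussAsym
  split_ifs <;> positivity

/-- If the Gaussian potential drops under reflection, `u` is asymmetric on the side of `p`. -/
lemma le_lintegral_gaussAsym (hu : Integrable u) {lam κ : ℝ} (hlam : 0 < lam)
    {e p : Eu N} (he : ‖e‖ = 1) {c : ℝ} (hcp : 0 < sdist e c p)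
    (hP : κ * (sdist e c p ^ 2 / (4 * lam ^ 2)) ≤
      gaussPot lam u p - gaussPot lam u (hrefl e c p)) :
    ENNReal.ofReal (κ * sdist e c p / 16) ≤
      ∫⁻ x, ENNReal.ofReal (gaussAsym lam e c p u x) := by
  set q := sdist e c p with hq
  set g := fun x => Real.exp (-(‖x - p‖ ^ 2 / lam ^ 2)) with hg
  set F := fun x => 4 * q / lam ^ 2 * gaussAsym lam e c p u x with hF
  have hF0 : ∀ x, 0 ≤ F x := fun x => mul_nonneg (by positivity) (gaussAsym_nonneg _ _ _ _ _ _)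
  set h := fun x => u x * (g x - g (hrefl e c x)) with hh
  have hmp := measurePreserving_hrefl he c
  have hint1 := integrable_mul_gauss lam hu p
  have hint2 : Integrable fun x => u x * g (hrefl e c x) := by
    have := integrable_mul_gauss lam hu (hrefl e c p)
    refine this.congr (Eventually.of_forall fun x => ?_)
    simp only [hg, norm_sub_hrefl_comm he]
  have hP2 : gaussPot lam u p - gaussPot lam u (hrefl e c p) = ∫ x, h x := by
    have h1 : gaussPot lam u (hrefl e c p) = ∫ x, u x * g (hrefl e c x) := by
      unfold gaussPot
      simp only [hg, norm_sub_hrefl_comm he]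
    rw [h1, gaussPot, ← integral_sub hint1 hint2]
    refine integral_congr_ae (Eventually.of_forall fun x => ?_)
    simp only [hh, hg]; ring
  have hhint : Integrable h := by
    refine (hint1.sub hint2).congr (Eventually.of_forall fun x => ?_)
    simp only [hh, hg, Pi.sub_apply]; ring
  have hhσ : Integrable fun x => h (hrefl e c x) := hmp.integrable_comp_of_integrable hhint
  have hsymm : ∫ x, h (hrefl e c x) = ∫ x, h x := by
    have h1 := integral_map (μ := volume) hmp.measurable.aemeasurable
      (f := h) (by rw [hmp.map_eq]; exact hhint.aestronglyMeasurable)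
    rw [hmp.map_eq] at h1
    exact h1.symm
  have hcl : ∀ x, 0 < sdist e c x → h x + h (hrefl e c x) ≤ F x := by
    intro x hx
    simp only [hh, hF, hrefl_hrefl he, gaussAsym, if_pos hx]
    have h1 : g (hrefl e c x) = g x * Real.exp (-(4 * sdist e c x * q / lam ^ 2)) := by
      simp only [hg]
      rw [norm_sub_hrefl_comm he, norm_sub_hrefl_sq he, ← Real.exp_add, add_div]
      congr 1; ring
    have h2 := Real.add_one_le_exp (-(4 * sdist e c x * q / lam ^ 2))
    have h3 : Real.exp (-(4 * sdist e c x * q / lam ^ 2)) ≤ 1 :=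
      Real.exp_le_one_iff.2 (neg_nonpos.2 (by positivity))
    have h4 : 0 < g x := Real.exp_pos _
    set E := Real.exp (-(4 * sdist e c x * q / lam ^ 2)) with hE
    have h5 : 0 ≤ g x - g (hrefl e c x) := by rw [h1]; nlinarith
    have h6 : g x - g (hrefl e c x) ≤ g x * (4 * sdist e c x * q / lam ^ 2) := by
      rw [h1]; nlinarith
    calc u x * (g x - g (hrefl e c x)) + u (hrefl e c x) * (g (hrefl e c x) - g x)
        = (u x - u (hrefl e c x)) * (g x - g (hrefl e c x)) := by ring
      _ ≤ max (u x - u (hrefl e c x)) 0 * (g x - g (hrefl e c x)) := by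
          gcongr; exact le_max_left _ _
      _ ≤ max (u x - u (hrefl e c x)) 0 * (g x * (4 * sdist e c x * q / lam ^ 2)) := by gcongr
      _ = _ := by simp only [hg]; ring
  have hpt : ∀ x, h x + h (hrefl e c x) ≤ F x + F (hrefl e c x) := by
    intro x
    rcases lt_trichotomy (sdist e c x) 0 with hx | hx | hx
    · have h1 := hcl (hrefl e c x) (by rw [sdist_hrefl he]; linarith)
      rw [hrefl_hrefl he] at h1
      linarith [hF0 x]
    · have h1 := hrefl_of_sdist_eq_zero e c hx
      have h2 : h x = 0 := by simp [hh, h1]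
      rw [h1, h2]
      linarith [hF0 x]
    · linarith [hcl x hx, hF0 (hrefl e c x)]
  have hFmeas : AEMeasurable (fun x => ENNReal.ofReal (F x)) := by
    have h1 : AEMeasurable (fun x => u (hrefl e c x)) :=
      hu.aemeasurable.comp_quasiMeasurePreserving hmp.quasiMeasurePreserving
    have h2 : AEMeasurable (gaussAsym lam e c p u) := by
      have h3 : AEMeasurable fun x => max (u x - u (hrefl e c x)) 0 * sdist e c x *
          Real.exp (-(‖x - p‖ ^ 2 / lam ^ 2)) :=
        (((hu.aemeasurable.sub h1).max aemeasurable_const).mul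
          (continuous_sdist e c).measurable.aemeasurable).mul
          (Continuous.measurable (by fun_prop)).aemeasurable
      have h4 : MeasurableSet {x | 0 < sdist e c x} :=
        measurableSet_lt measurable_const (continuous_sdist e c).measurable
      have h5 := h3.indicator h4
      exact h5
    exact (h2.const_mul _).ennreal_ofReal
  have h2 : ENNReal.ofReal (2 * ∫ x, h x) ≤ 2 * ∫⁻ x, ENNReal.ofReal (F x) := by
    calc ENNReal.ofReal (2 * ∫ x, h x) = ENNReal.ofReal (∫ x, (h x + h (hrefl e c x))) := by
          rw [integral_add hhint hhσ, hsymm, two_mul]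
      _ ≤ ENNReal.ofReal (∫ x, max (h x + h (hrefl e c x)) 0) := by
          refine ENNReal.ofReal_le_ofReal (integral_mono (hhint.add hhσ)
            (hhint.add hhσ).pos_part fun x => le_max_left _ _)
      _ = ∫⁻ x, ENNReal.ofReal (max (h x + h (hrefl e c x)) 0) :=
          ofReal_integral_eq_lintegral_ofReal (hhint.add hhσ).pos_part
            (Eventually.of_forall fun x => le_max_right _ _)
      _ ≤ ∫⁻ x, (ENNReal.ofReal (F x) + ENNReal.ofReal (F (hrefl e c x))) := by
          refine lintegral_mono fun x => ?_
          rw [← ENNReal.ofReal_add (hF0 _) (hF0 _)]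
          exact ENNReal.ofReal_le_ofReal
            (max_le (hpt x) (add_nonneg (hF0 _) (hF0 _)))
      _ = 2 * ∫⁻ x, ENNReal.ofReal (F x) := by
          rw [lintegral_add_left' hFmeas,
            lintegral_comp_hrefl he c fun x => ENNReal.ofReal (F x), two_mul]
  have h3 : ∫⁻ x, ENNReal.ofReal (F x) =
      ENNReal.ofReal (4 * q / lam ^ 2) * ∫⁻ x, ENNReal.ofReal (gaussAsym lam e c p u x) := by
    rw [← lintegral_const_mul' _ _ ENNReal.ofReal_ne_top]
    refine lintegral_congr fun x => ?_
    rw [← ENNReal.ofReal_mul (by positivity)]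
  rw [ENNReal.ofReal_mul two_pos.le, ENNReal.ofReal_ofNat] at h2
  have h4 := (ENNReal.mul_le_mul_iff_right two_ne_zero ENNReal.ofNat_ne_top).1 h2
  rw [h3] at h4
  have h5 : ENNReal.ofReal (4 * q / lam ^ 2) * ENNReal.ofReal (κ * q / 16) ≤
      ENNReal.ofReal (4 * q / lam ^ 2) * ∫⁻ x, ENNReal.ofReal (gaussAsym lam e c p u x) := by
    refine le_trans ?_ h4
    rw [← ENNReal.ofReal_mul (by positivity), ← hP2]
    refine ENNReal.ofReal_le_ofReal (le_trans (le_of_eq ?_) hP)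
    field_simp; ring
  exact (ENNReal.mul_le_mul_iff_right (by simp; positivity) ENNReal.ofReal_ne_top).1 h5

lemma rpow_le_const_mul_exp {a t : ℝ} (ha : 0 < a) (ht : 0 ≤ t) :
    t ^ a ≤ a ^ a * Real.exp t := by
  have h1 : t / a ≤ Real.exp (t / a) := by linarith [Real.add_one_le_exp (t / a)]
  have h2 := Real.rpow_le_rpow (by positivity) h1 ha.le
  rw [Real.div_rpow ht ha.le, ← Real.exp_mul, div_mul_cancel₀ _ ha.ne',
    div_le_iff₀ (by positivity)] at h2
  linarith

lemma one_div_rpow_sub_ge {m a b : ℝ} (hm : 1 ≤ m) (ha : 0 < a) (hab : a ≤ b) :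
    m * (b - a) / b ^ (m + 1) ≤ 1 / a ^ m - 1 / b ^ m := by
  have hb : 0 < b := ha.trans_le hab
  have h1 := one_add_mul_self_le_rpow_one_add (s := b / a - 1) (p := m)
    (by have : 0 ≤ b / a := by positivity
        linarith) hm
  rw [add_sub_cancel, Real.div_rpow hb.le ha.le] at h1
  have h2 : (b - a) / b ≤ b / a - 1 := by
    rw [div_le_iff₀ hb, sub_mul, one_mul, div_mul_eq_mul_div]
    have : b ≤ b * b / a := by rw [le_div_iff₀ ha]; gcongr
    have h3 : 2 * b - a ≤ b * b / a := by
      rw [le_div_iff₀ ha]; nlinarith [sq_nonneg (b - a)]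
    linarith
  have hbm : 0 < b ^ m := by positivity
  have ham : 0 < a ^ m := by positivity
  rw [Real.rpow_add hb, Real.rpow_one]
  have h3 : m * (b - a) / (b ^ m * b) = (m * ((b - a) / b)) * (1 / b ^ m) := by field_simp
  have h4 : 1 / a ^ m - 1 / b ^ m = (b ^ m / a ^ m - 1) * (1 / b ^ m) := by
    field_simp
  rw [h3, h4]
  gcongr
  have : m * ((b - a) / b) ≤ m * (b / a - 1) := by gcongr
  linarith

lemma norm_rpow_eq_sq_rpow {E : Type*} [NormedAddCommGroup E] (z : E) (m : ℝ) :
    ‖z‖ ^ (2 * m) = (‖z‖ ^ 2) ^ m := by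
  rw [Real.rpow_mul (norm_nonneg z), Real.rpow_two]

/-- Lower bound for the polarization gain near the center. -/
lemma exists_le_polarGain (hN : 2 ≤ N) (hs : 0 < s) {lam : ℝ} (hlam : 0 < lam) :
    ∃ κ : ℝ, 0 < κ ∧ ∀ (u : Eu N → ℝ) (p e : Eu N) (c : ℝ), ‖e‖ = 1 → (∀ x, 0 ≤ u x) →
      sdist e c p ≤ lam → ∀ x y, ‖y - p‖ ≤ 2 → u y = 0 →
      κ * (gaussAsym lam e c p u x *
        (if 0 < sdist e c y then u (hrefl e c y) * sdist e c y else 0)) ≤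
      polarGain N s e c u x y := by
  set m := ((N : ℝ) + 2 * s) / 2 with hm
  have hN2 : (2 : ℝ) ≤ N := by exact_mod_cast hN
  have hm1 : 1 ≤ m := by rw [hm]; linarith
  set D := 2 * lam + 6 with hD
  set τ := D ^ 2 / lam ^ 2 with hτ
  set C := (2 * lam ^ 2) ^ (m + 1) * ((m + 1) ^ (m + 1) * Real.exp τ) with hC
  have hC0 : 0 < C := by positivity
  refine ⟨8 * m / C, by positivity, fun u p e c he hu0 hcp x y hy huy => ?_⟩
  by_cases hxy : 0 < sdist e c x ∧ 0 < sdist e c y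
  swap
  · refine le_trans (le_of_eq ?_) (polarGain_nonneg hs he c u x y)
    rcases not_and_or.1 hxy with h | h
    · simp [gaussAsym, h]
    · simp [h]
  obtain ⟨hx, hy0⟩ := hxy
  by_cases hne : x = y
  · refine le_trans (le_of_eq ?_) (polarGain_nonneg hs he c u x y)
    rw [gaussAsym, if_pos hx, hne, huy, zero_sub,
      max_eq_right (neg_nonpos.2 (hu0 _))]
    simp
  rw [polarGain, if_pos (show 0 < sdist e c x ∧ 0 < sdist e c y from ⟨hx, hy0⟩), gaussAsym,
    if_pos hx, if_pos hy0, huy, sub_zero, max_eq_left (hu0 (hrefl e c y))]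
  set a := ‖x - y‖ ^ 2 with ha
  have ha0 : 0 < a := by have := norm_pos_iff.2 (sub_ne_zero.2 hne); positivity
  set b := ‖x - hrefl e c y‖ ^ 2 with hb
  have hba : b = a + 4 * sdist e c x * sdist e c y := norm_sub_hrefl_sq he c x y
  have hprod := mul_pos hx hy0
  have hK := one_div_rpow_sub_ge hm1 ha0 (show a ≤ b by linarith)
  set T := ‖x - p‖ ^ 2 / lam ^ 2 with hT
  have hT0 : 0 ≤ T := by positivity
  have hbT : b ≤ 2 * lam ^ 2 * (T + τ) := by
    have h1 : sdist e c y ≤ lam + 2 := by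
      have h2 : sdist e c y = sdist e c p - inner ℝ (y - p) e := by
        unfold sdist; rw [inner_sub_left]; ring
      have h3 := abs_le.1 (abs_real_inner_le_norm (y - p) e)
      rw [he, mul_one] at h3
      linarith [h3.1]
    have h2 : ‖hrefl e c y - p‖ ≤ D := by
      have h3 : hrefl e c y - p = (y - p) + (2 * sdist e c y) • e := by unfold hrefl; abel
      rw [h3]
      refine (norm_add_le _ _).trans ?_
      rw [norm_smul, he, mul_one, Real.norm_of_nonneg (by positivity)]
      linarith
    have h3 : ‖x - hrefl e c y‖ ≤ ‖x - p‖ + ‖hrefl e c y - p‖ := by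
      have := norm_sub_le (x - p) (hrefl e c y - p)
      rwa [sub_sub_sub_cancel_right] at this
    have h4 : b ≤ (‖x - p‖ + D) ^ 2 := by
      rw [hb]; gcongr; linarith
    have h5 : 2 * lam ^ 2 * (T + τ) = 2 * (‖x - p‖ ^ 2 + D ^ 2) := by
      rw [hT, hτ]; field_simp
    rw [h5]
    nlinarith [sq_nonneg (‖x - p‖ - D)]
  have hbC : b ^ (m + 1) ≤ C * Real.exp T := by
    have hb0 : 0 ≤ b := by positivity
    calc b ^ (m + 1) ≤ (2 * lam ^ 2 * (T + τ)) ^ (m + 1) := by gcongr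
      _ = (2 * lam ^ 2) ^ (m + 1) * (T + τ) ^ (m + 1) :=
          Real.mul_rpow (by positivity) (by positivity)
      _ ≤ (2 * lam ^ 2) ^ (m + 1) * ((m + 1) ^ (m + 1) * Real.exp (T + τ)) := by
          gcongr
          exact rpow_le_const_mul_exp (by positivity) (by positivity)
      _ = C * Real.exp T := by rw [hC, Real.exp_add]; ring
  have hb0 : 0 < b := by linarith
  have hK2 : m * (4 * sdist e c x * sdist e c y) / C * Real.exp (-T) ≤
      fracKernel N s (x - y) - fracKernel N s (x - hrefl e c y) := by
    have e1 : (N : ℝ) + 2 * s = 2 * m := by rw [hm]; ring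
    rw [fracKernel, fracKernel, e1, norm_rpow_eq_sq_rpow, norm_rpow_eq_sq_rpow]
    refine le_trans ?_ hK
    have e2 : b - a = 4 * sdist e c x * sdist e c y := by linarith
    rw [e2, Real.exp_neg, ← div_eq_mul_inv, div_div]
    gcongr
  have hW : 0 ≤ 2 * max (u x - u (hrefl e c x)) 0 * u (hrefl e c y) := by
    have := hu0 (hrefl e c y); positivity
  have := mul_le_mul_of_nonneg_left hK2 hW
  refine le_trans (le_of_eq ?_) this
  ring

/-- The reflected trace of `u` on a set of the complement near the center is controlled by the
energy deficit. -/
lemma exists_lintegral_reflected_le (hN : 2 ≤ N) (hs : 0 < s) {lam : ℝ} (hlam : 0 < lam) :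
    ∃ C : ℝ, 0 < C ∧ ∀ (u : Eu N → ℝ) (κ : ℝ) (p : Eu N), Adm N s u →
      supportVol u ≤ unitBallVol N → 0 < κ →
      (∀ q, 8 * ‖q - p‖ ≤ lam →
        κ * (‖q - p‖ ^ 2 / (16 * lam ^ 2)) ≤ gaussPot lam u p - gaussPot lam u q) →
      ∀ Y ⊆ Metric.closedBall p 2, MeasurableSet Y → (∀ y ∈ Y, u y = 0) →
      ∀ (e : Eu N) (c : ℝ), ‖e‖ = 1 → 0 < sdist e c p → 16 * sdist e c p ≤ lam →
      ∫⁻ y in Y, ENNReal.ofReal (if 0 < sdist e c y then u (hrefl e c y) * sdist e c y else 0) ≤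
        ENNReal.ofReal (C * (maxEnergy N s - torsionEnergy N s u) / (κ * sdist e c p)) := by
  obtain ⟨g, hg, hgain⟩ := exists_le_polarGain (s := s) hN hs hlam
  refine ⟨64 / g, by positivity, fun u κ p h hS hκ hcen Y hY hYm hY0 e c he hcp hclam => ?_⟩
  set q := sdist e c p with hq
  have hrp : ‖hrefl e c p - p‖ = 2 * q := by
    rw [hrefl, add_sub_cancel_left, norm_smul, he, mul_one, Real.norm_of_nonneg (by positivity)]
  have h1 := hcen (hrefl e c p) (by rw [hrp]; linarith)
  rw [hrp] at h1
  have hJ := le_lintegral_gaussAsym h.integrable hlam he hcp (κ := κ) (by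
    refine le_trans (le_of_eq ?_) h1
    rw [← hq]; field_simp; ring)
  have hgl := h.lintegral_polarGain_le hN hs hS he c
  set i := fun y => if 0 < sdist e c y then u (hrefl e c y) * sdist e c y else 0 with hi
  have hi0 : ∀ y, 0 ≤ i y := fun y => by
    simp only [hi]; split_ifs with h2
    · exact mul_nonneg (h.nonneg _) h2.le
    · exact le_rfl
  set I := ∫⁻ y in Y, ENNReal.ofReal (i y) with hI
  have hlow : (∫⁻ x, ENNReal.ofReal (gaussAsym lam e c p u x)) * (ENNReal.ofReal g * I) ≤
      ∫⁻ x, ∫⁻ y, ENNReal.ofReal (polarGain N s e c u x y) := by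
    refine (lintegral_mul_const_le _ _).trans (lintegral_mono fun x => ?_)
    refine le_trans ?_ (setLIntegral_le_lintegral Y _)
    rw [← mul_assoc, hI]
    refine (lintegral_const_mul_le _ _).trans (setLIntegral_mono' hYm fun y hy => ?_)
    rw [← ENNReal.ofReal_mul (gaussAsym_nonneg _ _ _ _ _ _),
      ← ENNReal.ofReal_mul (mul_nonneg (gaussAsym_nonneg _ _ _ _ _ _) hg.le)]
    refine ENNReal.ofReal_le_ofReal (le_trans (le_of_eq ?_)
      (hgain u p e c he h.nonneg (by linarith) x y (mem_closedBall_iff_norm.1 (hY hy)) (hY0 y hy)))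
    simp only [hi]; ring
  have h2 : ENNReal.ofReal (κ * q / 16 * g) * I ≤
      ENNReal.ofReal (4 * (maxEnergy N s - torsionEnergy N s u)) := by
    refine le_trans ?_ (hlow.trans hgl)
    rw [ENNReal.ofReal_mul (by positivity), mul_assoc]
    gcongr
  have h3 : 64 / g * (maxEnergy N s - torsionEnergy N s u) / (κ * q) =
      4 * (maxEnergy N s - torsionEnergy N s u) / (κ * q / 16 * g) := by
    field_simp; ring
  rw [h3, ENNReal.ofReal_div_of_pos (by positivity),
    ENNReal.le_div_iff_mul_le (Or.inl (by simp; positivity)) (Or.inl ENNReal.ofReal_ne_top),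
    mul_comm]
  exact h2

end PolarizationGain

section Polar
variable {N : ℕ} {s : ℝ} {u : Eu N → ℝ}

lemma lintegral_polar (hN : 2 ≤ N) {F : Eu N → ℝ≥0∞} (hF : Measurable F) :
    ∫⁻ z, F z = ∫⁻ e : Metric.sphere (0 : Eu N) 1,
      (∫⁻ ρ in Set.Ioi (0 : ℝ), ENNReal.ofReal (ρ ^ (N - 1)) * F (ρ • (e : Eu N)))
        ∂(volume : Measure (Eu N)).toSphere := by
  have := nontrivial_eu hN
  have hmp := (volume : Measure (Eu N)).measurePreserving_homeomorphUnitSphereProd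
  have h1 : ∫⁻ z, F z = ∫⁻ z : ({(0 : Eu N)}ᶜ : Set (Eu N)), F z
      ∂((volume : Measure (Eu N)).comap (↑)) := by
    rw [lintegral_subtype_comap (measurableSet_singleton _).compl,
      restrict_compl_singleton]
  rw [h1]
  have h2 : ∀ z : ({(0 : Eu N)}ᶜ : Set (Eu N)), F z =
      (fun q : Metric.sphere (0 : Eu N) 1 × Set.Ioi (0 : ℝ) => F ((q.2 : ℝ) • (q.1 : Eu N)))
        (homeomorphUnitSphereProd (Eu N) z) := by
    intro z
    have h3 := congrArg Subtype.val ((homeomorphUnitSphereProd (Eu N)).symm_apply_apply z)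
    simp only [homeomorphUnitSphereProd_symm_apply_coe] at h3
    simp only [h3]
  have hm : Measurable fun q : Metric.sphere (0 : Eu N) 1 × Set.Ioi (0 : ℝ) =>
      F ((q.2 : ℝ) • (q.1 : Eu N)) :=
    hF.comp ((measurable_subtype_coe.comp measurable_snd).smul
      (measurable_subtype_coe.comp measurable_fst))
  simp_rw [h2]
  rw [hmp.lintegral_comp hm, lintegral_prod _ hm.aemeasurable, finrank_euclideanSpace_fin]
  refine lintegral_congr fun e => ?_
  have hm' : Measurable fun ρ : Set.Ioi (0 : ℝ) => F ((ρ : ℝ) • (e : Eu N)) :=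
    hm.comp measurable_prodMk_left
  rw [Measure.volumeIoiPow]
  refine (lintegral_withDensity_eq_lintegral_mul _ (by fun_prop) hm').trans ?_
  exact lintegral_subtype_comap measurableSet_Ioi
    (fun ρ : ℝ => ENNReal.ofReal (ρ ^ (N - 1)) * F (ρ • (e : Eu N)))

lemma lintegral_comp_two_mul_sub {G : ℝ → ℝ≥0∞} (hG : Measurable G) (a : ℝ) :
    ∫⁻ ρ, G ρ = ENNReal.ofReal 2 * ∫⁻ b, G (2 * (b - a)) := by
  rw [lintegral_sub_right_eq_self (fun b => G (2 * b)) a]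
  have h := Real.smul_map_volume_mul_left (a := 2) two_ne_zero
  rw [← lintegral_map hG (measurable_const_mul (2 : ℝ)), ← smul_eq_mul,
    ← lintegral_smul_measure]
  rw [abs_of_pos two_pos] at h
  exact congrArg (fun μ => lintegral μ G) h.symm

lemma lintegral_indicator_inv {c₁ c₂ Q : ℝ} (hc₁ : 0 < c₁) (hc : c₁ ≤ c₂) (hQ : 0 ≤ Q) :
    ∫⁻ b in Set.Icc c₁ c₂, ENNReal.ofReal (Q / b) =
      ENNReal.ofReal (Q * Real.log (c₂ / c₁)) := by
  have h0 : (0 : ℝ) ∉ Set.uIcc c₁ c₂ := by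
    rw [Set.uIcc_of_le hc]; exact fun h => absurd h.1 (not_le.2 hc₁)
  have hi : IntervalIntegrable (fun b : ℝ => Q / b) volume c₁ c₂ := by
    simp_rw [div_eq_mul_inv]
    exact (intervalIntegral.intervalIntegrable_inv (fun x hx => fun h => h0 (h ▸ hx))
      continuousOn_id).const_mul Q
  rw [intervalIntegrable_iff_integrableOn_Icc_of_le hc] at hi
  rw [← ofReal_integral_eq_lintegral_ofReal hi]
  · congr 1
    rw [integral_Icc_eq_integral_Ioc, ← intervalIntegral.integral_of_le hc]
    simp_rw [div_eq_mul_inv Q]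
    rw [intervalIntegral.integral_const_mul, integral_inv h0]
  · refine (ae_restrict_iff' measurableSet_Icc).2 (Eventually.of_forall fun b hb => ?_)
    have : 0 < b := hc₁.trans_le hb.1
    show 0 ≤ Q / b
    positivity

/-- Polar coordinates around each `y ∈ Y` turn an estimate over all reflections into
an estimate for `|X| |Y|`. -/
lemma volume_mul_volume_le (hN : 2 ≤ N) {X Y : Set (Eu N)} (hX : MeasurableSet X)
    (hY : MeasurableSet Y) (p : Eu N) {c₁ c₂ R Q : ℝ} (hc₁ : 0 < c₁)
    (hc : c₁ ≤ c₂) (hQ : 0 ≤ Q)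
    (hXY : ∀ x ∈ X, ∀ y ∈ Y, ‖x - y‖ ≤ R ∧
      c₁ * (2 * ‖x - y‖) ≤ ‖x - p‖ ^ 2 - ‖y - p‖ ^ 2 ∧
      ‖x - p‖ ^ 2 - ‖y - p‖ ^ 2 ≤ c₂ * (2 * ‖x - y‖))
    (h : ∀ e c, ‖e‖ = 1 → c₁ ≤ sdist e c p → sdist e c p ≤ c₂ →
      ∫⁻ y in Y, X.indicator 1 (hrefl e c y) * ENNReal.ofReal (2 * sdist e c y) ≤
        ENNReal.ofReal (Q / sdist e c p)) :
    volume X * volume Y ≤ ENNReal.ofReal (2 * R ^ (N - 2) *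
      (volume : Measure (Eu N)).toSphere.real Set.univ * (Q * Real.log (c₂ / c₁))) := by
  have hlog : 0 ≤ Real.log (c₂ / c₁) := Real.log_nonneg ((one_le_div hc₁).2 hc)
  set I : Eu N → ℝ≥0∞ := X.indicator 1 with hI
  have hIm : Measurable I := measurable_one.indicator hX
  set J : ℝ → ℝ≥0∞ := (Set.Icc c₁ c₂).indicator 1 with hJ
  have hJm : Measurable J := measurable_one.indicator measurableSet_Icc
  set Φ : Eu N → Eu N → ℝ → ℝ≥0∞ := fun y e b =>
    J b * (I (y + (2 * (b - inner ℝ (y - p) e)) • e) *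
      ENNReal.ofReal (2 * (b - inner ℝ (y - p) e))) with hΦ
  have hΦm : Measurable fun q : (Eu N × Eu N) × ℝ => Φ q.1.1 q.1.2 q.2 := by
    have hc1 : Continuous fun q : (Eu N × Eu N) × ℝ =>
        2 * (q.2 - (inner ℝ (q.1.1 - p) q.1.2 : ℝ)) := by fun_prop
    have hc2 : Continuous fun q : (Eu N × Eu N) × ℝ =>
        q.1.1 + (2 * (q.2 - (inner ℝ (q.1.1 - p) q.1.2 : ℝ))) • q.1.2 := by fun_prop
    exact (hJm.comp measurable_snd).mul
      ((hIm.comp hc2.measurable).mul hc1.measurable.ennreal_ofReal)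
  have hΦ1 : Measurable fun q : Eu N × Eu N => ∫⁻ b, Φ q.1 q.2 b := hΦm.lintegral_prod_right'
  have hpt : ∀ y ∈ Y, ∀ e : Metric.sphere (0 : Eu N) 1,
      ∫⁻ ρ in Set.Ioi (0 : ℝ), ENNReal.ofReal (ρ ^ (N - 1)) * I (y + ρ • (e : Eu N)) ≤
        ENNReal.ofReal (2 * R ^ (N - 2)) * ∫⁻ b, Φ y e b := by
    intro y hy e
    set a : ℝ := inner ℝ (y - p) (e : Eu N) with ha
    have he : ‖(e : Eu N)‖ = 1 := by simp
    set G : ℝ → ℝ≥0∞ := fun ρ => J (ρ / 2 + a) * (I (y + ρ • (e : Eu N)) * ENNReal.ofReal ρ)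
      with hG
    have hGm : Measurable G := by
      have hc2 : Continuous fun ρ : ℝ => y + ρ • (e : Eu N) := by fun_prop
      exact (hJm.comp (by fun_prop)).mul ((hIm.comp hc2.measurable).mul (by fun_prop))
    have h1 : ∀ ρ ∈ Set.Ioi (0 : ℝ), ENNReal.ofReal (ρ ^ (N - 1)) * I (y + ρ • (e : Eu N)) ≤
        ENNReal.ofReal (R ^ (N - 2)) * G ρ := by
      intro ρ hρ
      rw [Set.mem_Ioi] at hρ
      by_cases hx : y + ρ • (e : Eu N) ∈ X
      · obtain ⟨h2, h3, h4⟩ := hXY _ hx y hy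
        have h5 : ‖y + ρ • (e : Eu N) - y‖ = ρ := by
          rw [add_sub_cancel_left, norm_smul, he, mul_one, Real.norm_of_nonneg hρ.le]
        have h6 : ‖y + ρ • (e : Eu N) - p‖ ^ 2 = ‖y - p‖ ^ 2 + 2 * (ρ * a) + ρ ^ 2 := by
          rw [add_sub_right_comm, norm_add_sq_real, inner_smul_right, norm_smul, he, mul_one,
            Real.norm_of_nonneg hρ.le]
        rw [h5] at h2
        rw [h5, h6] at h3 h4
        have h7 : ρ / 2 + a ∈ Set.Icc c₁ c₂ := by
          constructor
          · refine le_of_mul_le_mul_right ?_ (show 0 < 2 * ρ by linarith)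
            linarith [show (ρ / 2 + a) * (2 * ρ) = 2 * (ρ * a) + ρ ^ 2 by ring]
          · refine le_of_mul_le_mul_right ?_ (show 0 < 2 * ρ by linarith)
            linarith [show (ρ / 2 + a) * (2 * ρ) = 2 * (ρ * a) + ρ ^ 2 by ring]
        have h8 : ρ ^ (N - 1) ≤ R ^ (N - 2) * ρ := by
          rw [show N - 1 = N - 2 + 1 by omega, pow_succ]
          gcongr
        simp only [hG, hI, hJ, Set.indicator_of_mem hx, Set.indicator_of_mem h7, Pi.one_apply,
          one_mul, mul_one]
        rw [← ENNReal.ofReal_mul (pow_nonneg (hρ.le.trans h2) _)]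
        exact ENNReal.ofReal_le_ofReal h8
      · simp [hI, Set.indicator_of_notMem hx]
    calc ∫⁻ ρ in Set.Ioi (0 : ℝ), ENNReal.ofReal (ρ ^ (N - 1)) * I (y + ρ • (e : Eu N))
        ≤ ∫⁻ ρ in Set.Ioi (0 : ℝ), ENNReal.ofReal (R ^ (N - 2)) * G ρ :=
          setLIntegral_mono' measurableSet_Ioi h1
      _ ≤ ∫⁻ ρ, ENNReal.ofReal (R ^ (N - 2)) * G ρ := setLIntegral_le_lintegral _ _
      _ = ENNReal.ofReal (R ^ (N - 2)) * ∫⁻ ρ, G ρ := lintegral_const_mul _ hGm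
      _ = ENNReal.ofReal (2 * R ^ (N - 2)) * ∫⁻ b, Φ y e b := by
          rw [lintegral_comp_two_mul_sub hGm a, ← mul_assoc, mul_comm (ENNReal.ofReal (_ ^ _)),
            ← ENNReal.ofReal_mul zero_le_two]
          congr 1
          refine lintegral_congr fun b => ?_
          simp only [hG, hΦ, ← ha]
          rw [show 2 * (b - a) / 2 + a = b by ring]
  have hsph : ∀ e : Metric.sphere (0 : Eu N) 1, ∫⁻ y in Y, ∫⁻ b, Φ y e b ≤
      ENNReal.ofReal (Q * Real.log (c₂ / c₁)) := by
    intro e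
    have he : ‖(e : Eu N)‖ = 1 := by simp
    have hm2 : Measurable fun q : Eu N × ℝ => Φ q.1 e q.2 :=
      hΦm.comp ((measurable_fst.prodMk measurable_const).prodMk measurable_snd)
    rw [lintegral_lintegral_swap hm2.aemeasurable, ← lintegral_indicator_inv hc₁ hc hQ,
      ← lintegral_indicator measurableSet_Icc]
    refine lintegral_mono fun b => ?_
    by_cases hb : b ∈ Set.Icc c₁ c₂
    · rw [Set.indicator_of_mem hb]
      have h1 : ∀ y, sdist (e : Eu N) (b + inner ℝ p (e : Eu N)) y =
          b - inner ℝ (y - p) (e : Eu N) := by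
        intro y; unfold sdist; rw [inner_sub_left]; ring
      have h2 : sdist (e : Eu N) (b + inner ℝ p (e : Eu N)) p = b := by
        rw [h1]; simp
      have h3 := h e (b + inner ℝ p (e : Eu N)) he (by rw [h2]; exact hb.1)
        (by rw [h2]; exact hb.2)
      rw [h2] at h3
      refine le_trans (le_of_eq ?_) h3
      refine lintegral_congr fun y => ?_
      simp only [hΦ, hJ, Set.indicator_of_mem hb, Pi.one_apply, one_mul, hrefl, h1, hI]
    · simp [hΦ, hJ, Set.indicator_of_notMem hb]
  calc volume X * volume Y = ∫⁻ y in Y, volume X := by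
        rw [lintegral_const, Measure.restrict_apply_univ]
    _ = ∫⁻ y in Y, ∫⁻ z, I (y + z) := by
        refine lintegral_congr fun y => ?_
        rw [lintegral_add_left_eq_self I y, hI, lintegral_indicator_one hX]
    _ = ∫⁻ y in Y, ∫⁻ e : Metric.sphere (0 : Eu N) 1, (∫⁻ ρ in Set.Ioi (0 : ℝ),
          ENNReal.ofReal (ρ ^ (N - 1)) * I (y + ρ • (e : Eu N)))
          ∂(volume : Measure (Eu N)).toSphere := by
        refine lintegral_congr fun y => ?_
        exact lintegral_polar hN (F := fun z => I (y + z)) (hIm.comp (measurable_const_add y))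
    _ ≤ ∫⁻ y in Y, ∫⁻ e : Metric.sphere (0 : Eu N) 1,
          (ENNReal.ofReal (2 * R ^ (N - 2)) * ∫⁻ b, Φ y e b)
          ∂(volume : Measure (Eu N)).toSphere :=
        setLIntegral_mono' hY fun y hy => lintegral_mono fun e => hpt y hy e
    _ = ∫⁻ e : Metric.sphere (0 : Eu N) 1, (∫⁻ y in Y,
          ENNReal.ofReal (2 * R ^ (N - 2)) * ∫⁻ b, Φ y e b)
          ∂(volume : Measure (Eu N)).toSphere := by
        refine lintegral_lintegral_swap (f := fun y (e : Metric.sphere (0 : Eu N) 1) =>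
          ENNReal.ofReal (2 * R ^ (N - 2)) * ∫⁻ b, Φ y e b) (Measurable.aemeasurable ?_)
        exact (hΦ1.comp (measurable_fst.prodMk
          (measurable_subtype_coe.comp measurable_snd))).const_mul _
    _ ≤ ∫⁻ e : Metric.sphere (0 : Eu N) 1, (ENNReal.ofReal (2 * R ^ (N - 2)) *
          ENNReal.ofReal (Q * Real.log (c₂ / c₁)))
          ∂(volume : Measure (Eu N)).toSphere := by
        refine lintegral_mono fun e => ?_
        rw [lintegral_const_mul' _ _ ENNReal.ofReal_ne_top]
        gcongr
        exact hsph e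
    _ = _ := by
        rw [lintegral_const, ← ofReal_measureReal (measure_ne_top _ _), ← ENNReal.ofReal_mul'
          (by positivity), ← ENNReal.ofReal_mul' measureReal_nonneg]
        congr 1; ring

end Polar

section Interaction
variable {N : ℕ} {s : ℝ} {u : Eu N → ℝ}

/-- `p` maximizes the Gaussian potential of `u` with a quadratic gap. -/
def IsGaussCenter (lam κ : ℝ) (u : Eu N → ℝ) (p : Eu N) : Prop :=
  ∀ q, 8 * ‖q - p‖ ≤ lam →
    κ * (‖q - p‖ ^ 2 / (16 * lam ^ 2)) ≤ gaussPot lam u p - gaussPot lam u q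

/-- The volumes of a superlevel piece far from the center and of a piece of the zero set
close to the center are controlled by the energy deficit. -/
lemma exists_volume_annulus_le (hN : 2 ≤ N) (hs : 0 < s) {L : ℝ} (hL : 1 ≤ L) :
    ∃ C : ℝ, 0 < C ∧ ∀ (u : Eu N → ℝ) (κ T : ℝ) (p : Eu N) (r₁ r₂ r₃ : ℝ) (X Y : Set (Eu N)),
      Adm N s u → supportVol u ≤ unitBallVol N → 0 < κ → 0 < T →
      IsGaussCenter (32 * L) κ u p → 0 ≤ r₁ → r₁ ≤ 2 → r₁ < r₂ → r₂ ≤ r₃ → r₃ ≤ 2 * L →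
      MeasurableSet X → MeasurableSet Y →
      (∀ x ∈ X, T ≤ u x ∧ r₂ ≤ ‖x - p‖ ∧ ‖x - p‖ ≤ r₃) →
      (∀ y ∈ Y, u y = 0 ∧ ‖y - p‖ ≤ r₁) →
      volume.real X * volume.real Y ≤ C * ((maxEnergy N s - torsionEnergy N s u) / (κ * T)) *
        Real.log ((r₃ + r₁) / (r₂ - r₁)) := by
  obtain ⟨C, hC, hlem⟩ := exists_lintegral_reflected_le (s := s) hN hs
    (show 0 < 32 * L by linarith)
  set S := (volume : Measure (Eu N)).toSphere.real Set.univ with hS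
  have hS0 : 0 ≤ S := measureReal_nonneg
  refine ⟨4 * C * (4 * L) ^ (N - 2) * (S + 1), by positivity,
    fun u κ T p r₁ r₂ r₃ X Y h hSu hκ hT hcen h0 h2 h12 h23 h3L hX hY hXu hYu => ?_⟩
  set δ := maxEnergy N s - torsionEnergy N s u with hδ
  have hδ0 : 0 ≤ δ := sub_nonneg.2 (h.torsionEnergy_le_maxEnergy hN hs hSu)
  have hlog : 0 ≤ Real.log ((r₃ + r₁) / (r₂ - r₁)) :=
    Real.log_nonneg ((one_le_div (by linarith)).2 (by linarith))
  have hR0 : 0 ≤ r₃ + r₁ := by linarith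
  have key := volume_mul_volume_le hN hX hY p (c₁ := (r₂ - r₁) / 2) (c₂ := (r₃ + r₁) / 2)
    (R := r₃ + r₁) (Q := 2 / T * (C * δ / κ)) (by linarith) (by linarith) (by positivity) ?_ ?_
  · rw [div_div_div_cancel_right₀ two_ne_zero] at key
    have h4 := ENNReal.toReal_le_of_le_ofReal (by positivity) key
    rw [ENNReal.toReal_mul] at h4
    refine h4.trans ?_
    have h5 : (r₃ + r₁) ^ (N - 2) ≤ (4 * L) ^ (N - 2) := by gcongr; linarith
    calc 2 * (r₃ + r₁) ^ (N - 2) * S * (2 / T * (C * δ / κ) *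
          Real.log ((r₃ + r₁) / (r₂ - r₁)))
        ≤ 2 * (4 * L) ^ (N - 2) * (S + 1) * (2 / T * (C * δ / κ) *
          Real.log ((r₃ + r₁) / (r₂ - r₁))) := by gcongr; linarith
      _ = _ := by field_simp; ring
  · intro x hx y hy
    obtain ⟨-, h5, h6⟩ := hXu x hx
    obtain ⟨-, h7⟩ := hYu y hy
    have h8 : ‖x - y‖ ≤ ‖x - p‖ + ‖y - p‖ := by
      have := norm_sub_le (x - p) (y - p)
      rwa [sub_sub_sub_cancel_right] at this
    have h9 : ‖x - p‖ - ‖y - p‖ ≤ ‖x - y‖ := by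
      have := norm_sub_norm_le (x - p) (y - p)
      rwa [sub_sub_sub_cancel_right] at this
    have h10 := norm_nonneg (y - p)
    refine ⟨by linarith, ?_, ?_⟩
    · nlinarith [norm_nonneg (x - y)]
    · nlinarith [norm_nonneg (x - y)]
  · intro e c he hc1 hc2
    have hcp : 0 < sdist e c p := by linarith
    have h5 := hlem u κ p h hSu hκ hcen Y (fun y hy => mem_closedBall_iff_norm.2
      ((hYu y hy).2.trans h2)) hY (fun y hy => (hYu y hy).1) e c he hcp (by linarith)
    calc ∫⁻ y in Y, X.indicator 1 (hrefl e c y) * ENNReal.ofReal (2 * sdist e c y)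
        ≤ ∫⁻ y in Y, ENNReal.ofReal (2 / T) * ENNReal.ofReal
            (if 0 < sdist e c y then u (hrefl e c y) * sdist e c y else 0) := by
          refine lintegral_mono fun y => ?_
          by_cases hx : hrefl e c y ∈ X
          · rw [Set.indicator_of_mem hx, Pi.one_apply, one_mul,
              ← ENNReal.ofReal_mul (by positivity)]
            refine ENNReal.ofReal_le_ofReal ?_
            split_ifs with hd
            · rw [div_mul_eq_mul_div, le_div_iff₀ hT]
              have := mul_le_mul_of_nonneg_left (hXu _ hx).1 hd.le
              linarith
            · linarith
          · simp [Set.indicator_of_notMem hx]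
      _ = ENNReal.ofReal (2 / T) * ∫⁻ y in Y, ENNReal.ofReal
            (if 0 < sdist e c y then u (hrefl e c y) * sdist e c y else 0) :=
          lintegral_const_mul' _ _ ENNReal.ofReal_ne_top
      _ ≤ ENNReal.ofReal (2 / T) * ENNReal.ofReal (C * δ / (κ * sdist e c p)) := by gcongr
      _ = _ := by
          rw [← ENNReal.ofReal_mul (by positivity)]
          congr 1; field_simp

/-- Near-maximizers are concentrated around a Gaussian center. -/
lemma exists_isGaussCenter (hN : 2 ≤ N) (hs0 : 0 < s) (hs1 : s < 1) {k κ₀ : ℝ} (hk : 0 < k)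
    (hκ₀ : 0 < κ₀) (L₀ : ℝ) :
    ∃ η L κ : ℝ, 0 < η ∧ 2 ≤ L ∧ L₀ ≤ L ∧ 0 < κ ∧ ∀ u : Eu N → ℝ, Adm N s u → (∀ x, u x ≤ k) →
      supportVol u ≤ unitBallVol N → maxEnergy N s - η ≤ torsionEnergy N s u →
      ∃ p, volume.real (Function.support u \ Metric.ball p L) ≤ κ₀ * unitBallVol N ∧
        IsGaussCenter (32 * L) κ u p := by
  have hω := unitBallVol_pos N
  have hM := maxEnergy_pos hN hs0 hs1
  set ω := unitBallVol N
  set M := maxEnergy N s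
  set κ₁ := min κ₀ (M / (500000 * (k * ω))) with hκ₁
  have hκ₁0 : 0 < κ₁ := lt_min hκ₀ (by positivity)
  obtain ⟨η, R, hη, hR, htight⟩ := exists_tight hN hs0 hs1 k hκ₁0
  refine ⟨min η (M / 2), max (8 * R) (max L₀ 2), M / 5, lt_min hη (by linarith),
    (le_max_right _ _).trans (le_max_right _ _), (le_max_left _ _).trans (le_max_right _ _),
    by linarith, fun u h huk hS hD => ?_⟩
  set L := max (8 * R) (max L₀ 2) with hL
  have hLR : 8 * R ≤ L := le_max_left _ _
  have hL0 : 0 < L := by linarith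
  obtain ⟨p₀, hp₀⟩ := htight u h huk hS (by linarith [min_le_left η (M / 2)])
  have hint := h.integrable
  have hsplit := integral_add_compl (μ := volume) (s := Metric.ball p₀ R)
    measurableSet_ball hint
  have hU : M / 4 ≤ ∫ x, u x := by
    have h1 : torsionEnergy N s u = 2 * (∫ x, u x) - gagliardoSqR N s u := rfl
    linarith [min_le_right η (M / 2), gagliardoSqR_nonneg N s u]
  have hout : ∫ x in (Metric.ball p₀ R)ᶜ, u x ≤ k * (κ₁ * ω) := by
    have hfin : volume (Function.support u \ Metric.ball p₀ R) ≠ ⊤ :=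
      ne_top_of_le_ne_top h.supp (measure_mono Set.sdiff_subset)
    have h1 : ∫ x in (Metric.ball p₀ R)ᶜ, u x =
        ∫ x in Function.support u \ Metric.ball p₀ R, u x := by
      refine setIntegral_eq_of_subset_of_forall_sdiff_eq_zero measurableSet_ball.compl
        (fun x hx => hx.2) fun x hx => ?_
      by_contra hne
      exact hx.2 ⟨hne, hx.1⟩
    have h2 : ∫ x in Function.support u \ Metric.ball p₀ R, u x ≤
        ∫ x in Function.support u \ Metric.ball p₀ R, k :=
      setIntegral_mono hint.integrableOn (integrableOn_const hfin) huk
    rw [setIntegral_const, smul_eq_mul] at h2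
    rw [h1]
    nlinarith
  have hout' : 100000 * ∫ x in (Metric.ball p₀ R)ᶜ, u x ≤ M / 5 := by
    have h1 : κ₁ ≤ M / (500000 * (k * ω)) := min_le_right _ _
    rw [le_div_iff₀ (by positivity)] at h1
    linarith
  have hin : M / 5 ≤ ∫ x in Metric.ball p₀ R, u x := by linarith
  obtain ⟨p, hp, hcen⟩ := exists_center hint h.nonneg (show 0 < 32 * L by linarith)
    (R := R) (by linarith) p₀ (by linarith) (by linarith)
  refine ⟨p, ?_, fun q hq => le_trans ?_ (hcen q hq)⟩
  · have hsub : Function.support u \ Metric.ball p L ⊆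
        Function.support u \ Metric.ball p₀ R := by
      refine Set.sdiff_subset_sdiff_right (Metric.ball_subset_ball' ?_)
      rw [dist_comm, dist_eq_norm]; linarith
    have hfin : volume (Function.support u \ Metric.ball p₀ R) ≠ ⊤ :=
      ne_top_of_le_ne_top h.supp (measure_mono Set.sdiff_subset)
    refine (measureReal_mono hsub hfin).trans (hp₀.trans ?_)
    gcongr
    exact min_le_left _ _
  · gcongr

end Interaction

section Deficit
variable {N : ℕ} {s : ℝ} {u : Eu N → ℝ}

/-- Mass of a near-maximizer far away is controlled by mass in an annulus. -/
lemma exists_tail_le (hN : 2 ≤ N) (hs0 : 0 < s) (hs1 : s < 1) (k : ℝ) :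
    ∃ κ₀ L₀ : ℝ, 0 < κ₀ ∧ ∀ L, L₀ ≤ L → 0 < L → ∀ (u : Eu N → ℝ) (p : Eu N), Adm N s u →
      (∀ x, u x ≤ k) → supportVol u ≤ unitBallVol N →
      volume.real (Function.support u \ Metric.ball p L) ≤ κ₀ * unitBallVol N →
      maxEnergy N s * volume.real (Function.support u \ Metric.closedBall p L) ≤
        2 * unitBallVol N * (maxEnergy N s - torsionEnergy N s u) + 2 * maxEnergy N s *
          volume.real ((Function.support u \ Metric.closedBall p L) ∩ Metric.ball p (2 * L)) := by
  have hω := unitBallVol_pos N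
  have hM := maxEnergy_pos hN hs0 hs1
  set ω := unitBallVol N
  set M := maxEnergy N s
  have hθ : 0 < volExp N s - 1 := sub_pos.2 (one_lt_volExp hN hs0)
  set θ := volExp N s - 1 with hθdef
  have h1 : ∀ᶠ L in atTop, Real.pi ^ 2 / 2 * k ^ 2 * truncMass N s L < M / (4 * ω) := by
    have h2 := (tendsto_truncMass hN hs0 hs1).const_mul (Real.pi ^ 2 / 2 * k ^ 2)
    rw [mul_zero] at h2
    exact h2.eventually_lt_const (by positivity)
  obtain ⟨L₀, hL₀⟩ := eventually_atTop.1 h1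
  refine ⟨(1 / 4) ^ (1 / θ), L₀, by positivity, fun L hL hLpos u p h huk hS htail => ?_⟩
  obtain ⟨v, w, hv, hw, -, hSv, hSw, hD⟩ := h.exists_cut hN hs0 hs1 huk p L hLpos
  rw [← two_mul] at hSv
  set S := Function.support u with hSdef
  have hSm : MeasurableSet S := h.supp_measurable
  have hSfin : volume S ≠ ⊤ := h.supp
  set f := volume.real (S \ Metric.closedBall p L) with hf
  set g := volume.real ((S \ Metric.closedBall p L) ∩ Metric.ball p (2 * L)) with hg
  set G := volume.real (S \ Metric.ball p (2 * L)) with hG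
  have hf0 : 0 ≤ f := measureReal_nonneg
  have hfG : f ≤ G + g := by
    have h2 := measureReal_sdiff_add_inter (μ := volume) (s := S \ Metric.closedBall p L)
      (measurableSet_ball (x := p) (ε := 2 * L))
      (ne_top_of_le_ne_top hSfin (measure_mono Set.sdiff_subset))
    have h3 : volume.real ((S \ Metric.closedBall p L) \ Metric.ball p (2 * L)) ≤ G :=
      measureReal_mono (Set.sdiff_subset_sdiff_left Set.sdiff_subset)
        (ne_top_of_le_ne_top hSfin (measure_mono Set.sdiff_subset))
    linarith
  have hSG := measureReal_sdiff_add_inter (μ := volume) (s := S)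
      (measurableSet_ball (x := p) (ε := 2 * L)) hSfin
  have hSS : volume.real S ≤ ω := hS
  have hvV : supportVol v ≤ ω - G := by
    have h2 : supportVol v ≤ volume.real (S ∩ Metric.ball p (2 * L)) :=
      measureReal_mono hSv (ne_top_of_le_ne_top hSfin (measure_mono Set.inter_subset_left))
    linarith
  have hDv : torsionEnergy N s v ≤ M * ((ω - G) / ω) := by
    refine (hv.torsionEnergy_le_linear hN hs0 hs1 ?_).trans (by gcongr)
    have : 0 ≤ G := measureReal_nonneg
    linarith
  have hwf : supportVol w ≤ f := measureReal_mono hSw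
    (ne_top_of_le_ne_top hSfin (measure_mono Set.sdiff_subset))
  have hfκ : f ≤ (1 / 4) ^ (1 / θ) * ω := by
    refine le_trans (measureReal_mono ?_
      (ne_top_of_le_ne_top hSfin (measure_mono Set.sdiff_subset))) htail
    exact Set.sdiff_subset_sdiff_right Metric.ball_subset_closedBall
  have hDw : torsionEnergy N s w ≤ M * (f / ω) / 4 := by
    have h2 : (supportVol w / ω) ^ volExp N s ≤ f / ω * (1 / 4) := by
      have h3 : (supportVol w / ω) ^ volExp N s ≤ (f / ω) ^ (1 + θ) := by
        rw [show 1 + θ = volExp N s by rw [hθdef]; ring]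
        have := supportVol_nonneg w
        have h4 : 0 ≤ volExp N s := by linarith
        gcongr
      rw [Real.rpow_add_of_nonneg (by positivity) zero_le_one hθ.le, Real.rpow_one] at h3
      refine h3.trans ?_
      gcongr
      have h5 : f / ω ≤ (1 / 4) ^ (1 / θ) := by rwa [div_le_iff₀ hω]
      calc (f / ω) ^ θ ≤ (((1 / 4 : ℝ)) ^ (1 / θ)) ^ θ := by gcongr
        _ = 1 / 4 := by rw [← Real.rpow_mul (by norm_num), one_div_mul_cancel hθ.ne',
            Real.rpow_one]
    refine (hw.torsionEnergy_le_rpow hN hs0).trans ?_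
    have := mul_le_mul_of_nonneg_right h2 hM.le
    linarith
  have hE : Real.pi ^ 2 / 2 * k ^ 2 * truncMass N s L * f ≤ M * (f / ω) / 4 := by
    have := mul_le_mul_of_nonneg_right (hL₀ L hL).le hf0
    refine this.trans (le_of_eq (by field_simp))
  have hfin : torsionEnergy N s u * ω ≤ M * (ω - G) + M * f / 2 := by
    have h2 : torsionEnergy N s u ≤ M * ((ω - G) / ω) + M * (f / ω) / 4 + M * (f / ω) / 4 := by
      linarith
    have h3 := mul_le_mul_of_nonneg_right h2 hω.le
    refine h3.trans (le_of_eq (by field_simp; ring))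
  have := mul_le_mul_of_nonneg_left hfG hM.le
  linarith

lemma measureReal_sdiff_eq_half {A B : Set (Eu N)} (hA : MeasurableSet A) (hB : MeasurableSet B)
    (hAt : volume A ≠ ⊤) (hBt : volume B ≠ ⊤) (h : volume.real A = volume.real B) :
    volume.real (A \ B) = volume.real (symmDiff A B) / 2 ∧
      volume.real (B \ A) = volume.real (symmDiff A B) / 2 := by
  have h1 := measureReal_sdiff_add_inter (μ := volume) (s := A) hB hAt
  have h2 := measureReal_sdiff_add_inter (μ := volume) (s := B) hA hBt
  rw [Set.inter_comm] at h2
  have h3 : volume.real (symmDiff A B) = volume.real (A \ B) + volume.real (B \ A) := by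
    rw [Set.symmDiff_def]
    exact measureReal_union (Set.disjoint_left.2 fun x hx hx' => hx.2 hx'.1) (hB.diff hA)
      (ne_top_of_le_ne_top hAt (measure_mono Set.sdiff_subset))
      (ne_top_of_le_ne_top hBt (measure_mono Set.sdiff_subset))
  constructor <;> linarith

lemma measureReal_ball_eq (p : Eu N) {r : ℝ} (hr : 0 < r) :
    volume.real (Metric.ball p r) = r ^ N * unitBallVol N := by
  rw [measureReal_def, volume_ball_eq p hr, ENNReal.toReal_ofReal]
  have := unitBallVol_pos N
  positivity

lemma measureReal_shell_le (p : Eu N) {t : ℝ} (ht0 : 0 ≤ t) (ht1 : t ≤ 1) :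
    volume.real (Metric.ball p (1 + t) \ Metric.ball p 1) ≤
      (N * 2 ^ N * t) * unitBallVol N := by
  have h1 := measureReal_sdiff_add_inter (μ := volume) (s := Metric.ball p (1 + t))
    (measurableSet_ball (x := p) (ε := 1)) measure_ball_lt_top.ne
  rw [Set.inter_eq_right.2 (Metric.ball_subset_ball (by linarith)),
    measureReal_ball_eq p one_pos, measureReal_ball_eq p (show 0 < 1 + t by linarith), one_pow, one_mul] at h1
  have hω := unitBallVol_pos N
  have h2 : (1 + t) ^ N - 1 ≤ N * 2 ^ N * t := by
    have h3 := one_add_mul_le_pow (a := -(t / (1 + t))) (by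
      have : t / (1 + t) ≤ 1 := (div_le_one (by linarith)).2 (by linarith)
      linarith) N
    have h4 : 1 + -(t / (1 + t)) = (1 + t)⁻¹ := by field_simp; ring
    rw [h4, inv_pow] at h3
    have h5 : 0 < (1 + t) ^ N := by positivity
    have h6 := mul_le_mul_of_nonneg_right h3 h5.le
    rw [inv_mul_cancel₀ h5.ne'] at h6
    have h7 : t / (1 + t) ≤ t := div_le_self ht0 (by linarith)
    have h8 : (1 + t) ^ N ≤ 2 ^ N := by gcongr; linarith
    have h9 : (N : ℝ) * (t / (1 + t)) * (1 + t) ^ N ≤ N * t * 2 ^ N := by gcongr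
    nlinarith
  have := mul_le_mul_of_nonneg_right h2 hω.le
  linarith

end Deficit

section Core
variable {N : ℕ} {s : ℝ} {u : Eu N → ℝ}

lemma exists_pos_mul_le (K₁ K₂ K₃ K₄ : ℝ) :
    ∃ ε : ℝ, 0 < ε ∧ ε * K₁ ≤ 1 ∧ ε * K₂ ≤ 1 ∧ ε * K₃ ≤ 1 ∧ ε * K₄ ≤ 1 := by
  set K := |K₁| + |K₂| + |K₃| + |K₄| + 1 with hK
  have hK0 : 0 < K := by positivity
  have h : ∀ x, |x| ≤ K → K⁻¹ * x ≤ 1 := fun x hx => by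
    rw [inv_mul_le_iff₀ hK0]; linarith [le_abs_self x]
  have h1 := abs_nonneg K₁
  have h2 := abs_nonneg K₂
  have h3 := abs_nonneg K₃
  have h4 := abs_nonneg K₄
  refine ⟨K⁻¹, by positivity, h _ ?_, h _ ?_, h _ ?_, h _ ?_⟩ <;> linarith

set_option maxHeartbeats 1000000 in
/-- At a Gaussian center, the energy deficit controls the distance of `Ω` from the unit ball. -/
lemma exists_deficit_lt (hN : 2 ≤ N) (hs0 : 0 < s) (hs1 : s < 1) {L κ γ : ℝ} (hL : 3 ≤ L)
    (hκ : 0 < κ) (hγ : 0 < γ) :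
    ∃ ε : ℝ, 0 < ε ∧ ∀ (u : Eu N → ℝ) (Ω : Set (Eu N)) (p : Eu N) (a : ℝ), Adm N s u →
      MeasurableSet Ω → volume Ω ≠ ⊤ → volume.real Ω = unitBallVol N → (∀ x ∉ Ω, u x = 0) →
      IsGaussCenter (32 * L) κ u p →
      maxEnergy N s * volume.real (Function.support u \ Metric.closedBall p L) ≤
        2 * unitBallVol N * (maxEnergy N s - torsionEnergy N s u) + 2 * maxEnergy N s *
          volume.real ((Function.support u \ Metric.closedBall p L) ∩
            Metric.ball p (2 * L)) →
      0 < a → a ≤ 2 → volume.real (symmDiff Ω (Metric.ball p 1)) = a * unitBallVol N →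
      ε * a ^ (3 + γ) < maxEnergy N s - torsionEnergy N s u := by
  have hω := unitBallVol_pos N
  have hM := maxEnergy_pos hN hs0 hs1
  have hN2 : (2 : ℝ) ≤ N := by exact_mod_cast hN
  set ω := unitBallVol N with hωdef
  set M := maxEnergy N s with hMdef
  obtain ⟨C, hC, hann⟩ := exists_volume_annulus_le (s := s) hN hs0 (show 1 ≤ L by linarith)
  set τ := M / (192 * ω) with hτ
  have hτ0 : 0 < τ := by positivity
  set P : ℝ := 2 ^ γ with hP
  set ε₁ : ℝ := 1 / (64 * (N * 2 ^ N)) with hε₁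
  have hNN : 1 ≤ (N : ℝ) * 2 ^ N := by
    have : (1 : ℝ) ≤ 2 ^ N := one_le_pow₀ one_le_two
    nlinarith
  have hε₁0 : 0 < ε₁ := by positivity
  have hε₁1 : ε₁ ≤ 1 / 64 := by rw [hε₁]; gcongr; linarith
  have hlogL : 0 ≤ Real.log (2 * L + 2) := Real.log_nonneg (by linarith)
  obtain ⟨ε, hε, hk1, hk2, hk3, hk4⟩ := exists_pos_mul_le (4 * P / (τ * ω))
    (C * (2 * P / (κ * τ)) * Real.log (2 * L + 2) * (128 / ω ^ 2)) (512 * P / M)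
    (16 * C * ((4 / ε₁) ^ γ / γ) / (κ * τ * ω ^ 2))
  refine ⟨ε, hε, fun u Ω p a h hΩ hΩt hΩv hu hcen htail ha0 ha2 hsd => ?_⟩
  by_contra hcon
  push Not at hcon
  set δ := M - torsionEnergy N s u with hδdef
  set b := a ^ γ with hb
  have hb0 : 0 < b := by positivity
  have hbP : b ≤ P := by rw [hb, hP]; gcongr
  rw [Real.rpow_add ha0, show (3 : ℝ) = (3 : ℕ) by norm_num, Real.rpow_natCast, ← hb] at hcon
  have hSΩ : Function.support u ⊆ Ω := fun x hx => by
    by_contra hx'; exact hx (hu x hx')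
  have hS : supportVol u ≤ ω := by
    rw [← hΩv]; exact measureReal_mono hSΩ hΩt
  have hδ1 : δ ≤ ε * (2 * P) * a * a := by
    refine hcon.trans ?_
    have h1 : a ^ 3 * b ≤ (2 * a * a) * P := by
      have : a ^ 3 ≤ 2 * a * a := by nlinarith [mul_pos ha0 ha0]
      gcongr
    nlinarith
  have hδ2 : δ ≤ ε * (4 * P) * a := by
    refine hδ1.trans ?_
    have h1 : ε * (2 * P) * a * a ≤ ε * (2 * P) * a * 2 := by gcongr
    linarith
  have hT : 0 < τ * a := by positivity
  set E := {x | τ * a < u x} with hE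
  have hEm : MeasurableSet E := measurableSet_lt measurable_const h.meas
  have hfinΩ : ∀ {A : Set (Eu N)}, A ⊆ Ω → volume A ≠ ⊤ := fun hA =>
    ne_top_of_le_ne_top hΩt (measure_mono hA)
  have hEΩ : E ⊆ Ω := fun x hx => by
    by_contra hx'
    have h1 : τ * a < u x := hx
    rw [hu x hx'] at h1; linarith
  have hΩE : volume.real (Ω \ E) ≤ ω * a / 64 := by
    have h1 := h.volume_sublevel_le hN hs0 hs1 hΩ hΩv hu hT.le
    have h2 : δ ≤ τ * ω * a := by
      refine hδ2.trans ?_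
      have : ε * (4 * P) ≤ τ * ω := by
        rw [mul_div_assoc', div_le_one (by positivity)] at hk1; exact hk1
      gcongr
    have h3 : M = 192 * ω * τ := by rw [hτ]; field_simp
    have h4 : M * volume.real (Ω \ E) ≤ M * (ω * a / 64) := by
      refine h1.trans ?_
      have : ω * (δ + 2 * (τ * a) * ω) ≤ ω * (τ * ω * a + 2 * (τ * a) * ω) := by gcongr
      refine this.trans (le_of_eq ?_)
      rw [h3]; ring
    exact le_of_mul_le_mul_left h4 hM
  have hballt : ∀ r, volume (Metric.ball p r) ≠ ⊤ := fun r => measure_ball_lt_top.ne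
  obtain ⟨hd1, hd2⟩ := measureReal_sdiff_eq_half hΩ (measurableSet_ball (x := p) (ε := 1)) hΩt
    (hballt 1) (by rw [hΩv, measureReal_ball_eq p one_pos, one_pow, one_mul])
  rw [hsd] at hd1 hd2
  -- the part of `E` away from the center
  set X₁ := E ∩ {x | 3 ≤ ‖x - p‖ ∧ ‖x - p‖ ≤ 2 * L} with hX₁
  have hnm : Measurable fun x : Eu N => ‖x - p‖ := by fun_prop
  have hX₁m : MeasurableSet X₁ := hEm.inter
    ((measurableSet_le measurable_const hnm).inter (measurableSet_le hnm measurable_const))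
  have hX₁v : volume.real X₁ ≤ ω * a / 128 := by
    have hY : ω ≤ volume.real (Metric.ball p 2 \ Ω) := by
      have h1 := le_measureReal_sdiff (μ := volume) (s₁ := Metric.ball p 2) (s₂ := Ω) hΩt
      rw [measureReal_ball_eq p two_pos, hΩv] at h1
      have h2 : (4 : ℝ) ≤ 2 ^ N := by
        calc (4 : ℝ) = 2 ^ 2 := by norm_num
          _ ≤ 2 ^ N := pow_le_pow_right₀ one_le_two hN
      nlinarith
    have h1 := hann u κ (τ * a) p 2 3 (2 * L) X₁ (Metric.ball p 2 \ Ω) h hS hκ hT hcen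
      zero_le_two le_rfl (by norm_num) (by linarith) le_rfl hX₁m (measurableSet_ball.diff hΩ)
      (fun x hx => ⟨le_of_lt hx.1, hx.2⟩)
      (fun y hy => ⟨hu y hy.2, (mem_ball_iff_norm.1 hy.1).le⟩)
    rw [show (3 : ℝ) - 2 = 1 by norm_num, div_one] at h1
    have h2 : δ / (κ * (τ * a)) ≤ ε * (2 * P / (κ * τ)) * a := by
      rw [div_le_iff₀ (by positivity)]
      refine hδ1.trans (le_of_eq ?_)
      field_simp
    have h3 : volume.real X₁ * ω ≤ C * (ε * (2 * P / (κ * τ)) * a) * Real.log (2 * L + 2) := by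
      refine le_trans (by gcongr) (h1.trans ?_)
      gcongr
    have h4 : ε * (C * (2 * P / (κ * τ)) * Real.log (2 * L + 2) * (128 / ω ^ 2)) * (a * ω ^ 2)
      ≤ 1 * (a * ω ^ 2) := by gcongr
    have h5 : ε * (C * (2 * P / (κ * τ)) * Real.log (2 * L + 2) * (128 / ω ^ 2)) * (a * ω ^ 2)
      = C * (ε * (2 * P / (κ * τ)) * a) * Real.log (2 * L + 2) * 128 := by
      generalize Real.log (2 * L + 2) = l
      field_simp
    have h6 : volume.real X₁ * ω ≤ (ω * a / 128) * ω := by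
      rw [h5] at h4
      linarith
    exact le_of_mul_le_mul_right h6 hω
  set f := volume.real (Function.support u \ Metric.closedBall p L) with hf
  have hfv : f ≤ ω * a / 16 := by
    have h1 : volume.real ((Function.support u \ Metric.closedBall p L) ∩
        Metric.ball p (2 * L)) ≤ volume.real (Ω \ E) + volume.real X₁ := by
      refine (measureReal_mono (fun x hx => ?_) (hfinΩ (Set.union_subset Set.sdiff_subset
        (Set.inter_subset_left.trans hEΩ)))).trans (measureReal_union_le _ _)
      by_cases hxE : x ∈ E
      · refine Or.inr ⟨hxE, ?_, (mem_ball_iff_norm.1 hx.2).le⟩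
        have h2 := hx.1.2
        rw [mem_closedBall_iff_norm, not_le] at h2
        linarith
      · exact Or.inl ⟨hSΩ hx.1.1, hxE⟩
    have h2 : δ ≤ M / 128 * a := by
      refine hδ2.trans ?_
      have : ε * (4 * P) ≤ M / 128 := by
        rw [mul_div_assoc', div_le_one (by positivity)] at hk3; linarith
      gcongr
    have h3 : M * f ≤ M * (ω * a / 16) := by
      refine htail.trans ?_
      have h4 : 2 * ω * δ ≤ 2 * ω * (M / 128 * a) := by gcongr
      have h5 := mul_le_mul_of_nonneg_left (h1.trans (add_le_add hΩE hX₁v))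
        (show 0 ≤ 2 * M by linarith)
      linarith
    exact le_of_mul_le_mul_left h3 hM
  have hΩ3 : volume.real (Ω \ Metric.ball p 3) ≤ ω * a / 8 := by
    have h1 : Ω \ Metric.ball p 3 ⊆ ((Ω \ E) ∪ X₁) ∪
        (Function.support u \ Metric.closedBall p L) := by
      intro x hx
      have h2 := hx.2
      rw [mem_ball_iff_norm, not_lt] at h2
      by_cases hxE : x ∈ E
      · by_cases hxL : ‖x - p‖ ≤ 2 * L
        · exact Or.inl (Or.inr ⟨hxE, h2, hxL⟩)
        · refine Or.inr ⟨(hT.trans hxE).ne', ?_⟩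
          rw [mem_closedBall_iff_norm, not_le]
          linarith
      · exact Or.inl (Or.inl ⟨hx.1, hxE⟩)
    have h2 := (measureReal_mono h1 (hfinΩ (Set.union_subset (Set.union_subset Set.sdiff_subset
      (Set.inter_subset_left.trans hEΩ)) (Set.sdiff_subset.trans hSΩ)))).trans
      ((measureReal_union_le _ _).trans (add_le_add_left (measureReal_union_le _ _) _))
    have : 0 < ω * a := by positivity
    linarith
  -- the part of `E` in the intermediate annulus
  set X₂ := E ∩ {x | 1 + ε₁ * a ≤ ‖x - p‖ ∧ ‖x - p‖ ≤ 3} with hX₂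
  have hX₂m : MeasurableSet X₂ := hEm.inter
    ((measurableSet_le measurable_const hnm).inter (measurableSet_le hnm measurable_const))
  have hεa : ε₁ * a ≤ 1 := by nlinarith
  have hX₂v : ω * a / 4 ≤ volume.real X₂ := by
    have h1 : Ω \ Metric.ball p 1 ⊆ (((Ω \ E) ∪ (Ω \ Metric.ball p 3)) ∪ X₂) ∪
        (Metric.ball p (1 + ε₁ * a) \ Metric.ball p 1) := by
      intro x hx
      by_cases hxE : x ∈ E
      · by_cases hx1 : ‖x - p‖ < 1 + ε₁ * a
        · exact Or.inr ⟨mem_ball_iff_norm.2 hx1, hx.2⟩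
        · by_cases hx3 : ‖x - p‖ < 3
          · exact Or.inl (Or.inr ⟨hxE, not_lt.1 hx1, hx3.le⟩)
          · exact Or.inl (Or.inl (Or.inr ⟨hx.1, fun h => hx3 (mem_ball_iff_norm.1 h)⟩))
      · exact Or.inl (Or.inl (Or.inl ⟨hx.1, hxE⟩))
    have hfin : volume ((((Ω \ E) ∪ (Ω \ Metric.ball p 3)) ∪ X₂) ∪
        (Metric.ball p (1 + ε₁ * a) \ Metric.ball p 1)) ≠ ⊤ :=
      measure_union_ne_top (hfinΩ (Set.union_subset (Set.union_subset Set.sdiff_subset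
        Set.sdiff_subset) (Set.inter_subset_left.trans hEΩ)))
        (ne_top_of_le_ne_top (hballt _) (measure_mono Set.sdiff_subset))
    have h2 := (measureReal_mono h1 hfin).trans ((measureReal_union_le _ _).trans
      (add_le_add_left ((measureReal_union_le _ _).trans
        (add_le_add_left (measureReal_union_le _ _) _)) _))
    have h3 := measureReal_shell_le p (show 0 ≤ ε₁ * a by positivity) hεa
    have h4 : (N * 2 ^ N * (ε₁ * a)) * ω = ω * a / 64 := by rw [hε₁]; field_simp
    rw [h4] at h3
    have : 0 < ω * a := by positivity
    linarith
  have hfinal := hann u κ (τ * a) p 1 (1 + ε₁ * a) 3 X₂ (Metric.ball p 1 \ Ω) h hS hκ hT hcen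
    zero_le_one one_le_two (by linarith [mul_pos hε₁0 ha0]) (by linarith) (by linarith) hX₂m
    (measurableSet_ball.diff hΩ) (fun x hx => ⟨le_of_lt hx.1, hx.2⟩)
    (fun y hy => ⟨hu y hy.2, (mem_ball_iff_norm.1 hy.1).le⟩)
  rw [hd2, add_sub_cancel_left, show (3 : ℝ) + 1 = 4 by norm_num] at hfinal
  have hlog : Real.log (4 / (ε₁ * a)) ≤ (4 / ε₁) ^ γ / γ / b := by
    refine (Real.log_le_rpow_div (by positivity) hγ).trans (le_of_eq ?_)
    rw [← div_div, Real.div_rpow (by positivity) ha0.le, ← hb]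
    field_simp
  have hlog0 : 0 ≤ Real.log (4 / (ε₁ * a)) :=
    Real.log_nonneg ((one_le_div (by positivity)).2 (by linarith))
  have h2 : δ / (κ * (τ * a)) ≤ ε * (a ^ 2 * b) / (κ * τ) := by
    rw [div_le_iff₀ (by positivity)]
    refine hcon.trans (le_of_eq ?_)
    field_simp
  set W := (4 / ε₁) ^ γ / γ with hW
  have hW0 : 0 < W := by positivity
  have h3 : C * (δ / (κ * (τ * a))) * Real.log (4 / (ε₁ * a)) ≤
      C * (ε * (a ^ 2 * b) / (κ * τ)) * (W / b) := by gcongr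
  have h4 : C * (ε * (a ^ 2 * b) / (κ * τ)) * (W / b) =
      (ε * (16 * C * W / (κ * τ * ω ^ 2))) * (ω ^ 2 * a ^ 2 / 16) := by field_simp
  have h5 : (ε * (16 * C * W / (κ * τ * ω ^ 2))) * (ω ^ 2 * a ^ 2 / 16) ≤
      1 * (ω ^ 2 * a ^ 2 / 16) := by gcongr
  have h6 : ω * a / 4 * (a * ω / 2) ≤ volume.real X₂ * (a * ω / 2) := by gcongr
  have h7 : 0 < ω ^ 2 * a ^ 2 := by positivity
  linarith [show ω * a / 4 * (a * ω / 2) = ω ^ 2 * a ^ 2 / 8 by ring]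

end Core

section Stability
variable {N : ℕ} {s : ℝ} {u : Eu N → ℝ}

/-- Quantitative stability of the maximization of the torsion energy. -/
lemma exists_stability (hN : 2 ≤ N) (hs0 : 0 < s) (hs1 : s < 1) :
    ∃ ε : ℝ, 0 < ε ∧ ∀ (u : Eu N → ℝ) (Ω : Set (Eu N)) (A : ℝ), Adm N s u → MeasurableSet Ω →
      volume Ω ≠ ⊤ → volume.real Ω = unitBallVol N → (∀ x ∉ Ω, u x = 0) → 0 ≤ A →
      (∀ p, A * unitBallVol N ≤ volume.real (symmDiff Ω (Metric.ball p 1))) →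
      torsionEnergy N s u ≤ maxEnergy N s - ε * A ^ (3 / s) := by
  have hω := unitBallVol_pos N
  have hk : 0 < 1 / kerMass N s := one_div_pos.2 (kerMass_pos N s)
  set k := 1 / kerMass N s with hkdef
  obtain ⟨γ, hγ, hγs⟩ : ∃ γ : ℝ, 0 < γ ∧ 3 / s = 3 + γ := by
    refine ⟨3 / s - 3, sub_pos.2 ?_, by ring⟩
    rw [lt_div_iff₀ hs0]; linarith
  obtain ⟨κ₀, L₀, hκ₀, htail⟩ := exists_tail_le hN hs0 hs1 k
  obtain ⟨η, L, κ, hη, -, hL, hκ, hcen⟩ := exists_isGaussCenter hN hs0 hs1 hk hκ₀ (max L₀ 3)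
  have hL3 : 3 ≤ L := (le_max_right _ _).trans hL
  obtain ⟨ε, hε, hdef⟩ := exists_deficit_lt hN hs0 hs1 hL3 hκ hγ
  refine ⟨min ε (η / 2 ^ (3 + γ)), lt_min hε (by positivity),
    fun u₀ Ω A h₀ hΩ hΩt hΩv hu₀ hA hsd => ?_⟩
  have hS₀ : supportVol u₀ ≤ unitBallVol N := by
    rw [← hΩv]
    refine measureReal_mono (fun x hx => ?_) hΩt
    by_contra hx'
    exact hx (hu₀ x hx')
  refine (h₀.torsionEnergy_le_min hN hs0 (h₀.volume_support_le hS₀)).trans ?_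
  have h := h₀.min_const hk.le
  have hS : supportVol (fun x => min (u₀ x) k) ≤ unitBallVol N := by
    rw [supportVol, support_min_const hk]; exact hS₀
  have huk : ∀ x, min (u₀ x) k ≤ k := fun x => min_le_right _ _
  have hu : ∀ x ∉ Ω, min (u₀ x) k = 0 := fun x hx => by rw [hu₀ x hx, min_eq_left hk.le]
  set u := fun x => min (u₀ x) k
  rcases hA.eq_or_lt with hA0 | hA0
  · rw [← hA0, Real.zero_rpow (by positivity), mul_zero, sub_zero]
    exact h.torsionEnergy_le_maxEnergy hN hs0 hS
  by_contra hcon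
  push Not at hcon
  have ha2 : ∀ p, volume.real (symmDiff Ω (Metric.ball p 1)) ≤ 2 * unitBallVol N := fun p => by
    have h1 : volume.real (Metric.ball p 1) = unitBallVol N := by
      rw [measureReal_ball_eq p one_pos, one_pow, one_mul]
    have h2 : symmDiff Ω (Metric.ball p 1) ⊆ Ω ∪ Metric.ball p 1 := symmDiff_le_sup
    refine (measureReal_mono h2 (measure_union_ne_top hΩt measure_ball_lt_top.ne)).trans
      ((measureReal_union_le _ _).trans ?_)
    rw [h1, hΩv]; linarith
  have hA2 : A ≤ 2 := le_of_mul_le_mul_right ((hsd 0).trans (ha2 0)) hω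
  have hAη : min ε (η / 2 ^ (3 + γ)) * A ^ (3 / s) ≤ η := by
    rw [hγs]
    calc min ε (η / 2 ^ (3 + γ)) * A ^ (3 + γ) ≤ η / 2 ^ (3 + γ) * 2 ^ (3 + γ) := by
          gcongr
          exact min_le_right _ _
      _ = η := by field_simp
  obtain ⟨p, hp1, hp2⟩ := hcen u h huk hS (by linarith)
  set a := volume.real (symmDiff Ω (Metric.ball p 1)) / unitBallVol N with ha
  have hAa : A ≤ a := (le_div_iff₀ hω).2 (hsd p)
  have h1 := hdef u Ω p a h hΩ hΩt hΩv hu hp2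
    (htail L ((le_max_left _ _).trans hL) (by linarith) u p h huk hS hp1) (hA0.trans_le hAa)
    ((div_le_iff₀ hω).2 (ha2 p)) (by rw [ha, div_mul_cancel₀ _ hω.ne'])
  have h2 : min ε (η / 2 ^ (3 + γ)) * A ^ (3 / s) ≤ ε * a ^ (3 + γ) := by
    rw [hγs]; gcongr; exact min_le_left _ _
  linarith

lemma asym_le (Ω : Set (Eu N)) {x₀ : Eu N} {r : ℝ} (hr : 0 < r)
    (h : volume (Metric.ball x₀ r) = volume Ω) :
    asym N Ω ≤ volume.real (symmDiff Ω (Metric.ball x₀ r)) / volume.real Ω := by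
  refine csInf_le ⟨0, ?_⟩ ⟨x₀, r, hr, h, rfl⟩
  rintro c ⟨x, ρ, -, -, rfl⟩
  positivity

lemma asym_nonneg (Ω : Set (Eu N)) : 0 ≤ asym N Ω := by
  refine Real.sInf_nonneg ?_
  rintro c ⟨x, ρ, -, -, rfl⟩
  positivity

lemma measureReal_preimage_smul (Ω : Set (Eu N)) {r : ℝ} (hr : 0 < r) :
    volume.real ((fun x : Eu N => r • x) ⁻¹' Ω) = (r ^ N)⁻¹ * volume.real Ω := by
  rw [measureReal_def, Measure.addHaar_preimage_smul _ hr.ne', ENNReal.toReal_mul,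
    finrank_euclideanSpace_fin, ENNReal.toReal_ofReal (abs_nonneg _),
    abs_of_nonneg (by positivity), measureReal_def]

/-- The normalized asymmetry is a lower bound for all unit balls after rescaling. -/
lemma asym_mul_le_symmDiff {Ω : Set (Eu N)} (hΩt : volume Ω ≠ ⊤) {r : ℝ} (hr : 0 < r)
    (hΩr : volume.real Ω = r ^ N * unitBallVol N) (p : Eu N) :
    asym N Ω * unitBallVol N ≤
      volume.real (symmDiff ((fun x : Eu N => r • x) ⁻¹' Ω) (Metric.ball p 1)) := by
  have hω := unitBallVol_pos N
  have h1 : Metric.ball p 1 = (fun x : Eu N => r • x) ⁻¹' Metric.ball (r • p) r := by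
    ext x
    rw [Set.mem_preimage, mem_ball_iff_norm, mem_ball_iff_norm, ← smul_sub, norm_smul,
      Real.norm_of_nonneg hr.le, mul_lt_iff_lt_one_right hr]
  have h2 : volume (Metric.ball (r • p) r) = volume Ω := by
    rw [← ENNReal.toReal_eq_toReal_iff' measure_ball_lt_top.ne hΩt]
    exact (measureReal_ball_eq _ hr).trans hΩr.symm
  have h3 := asym_le Ω hr h2
  rw [hΩr, le_div_iff₀ (by positivity)] at h3
  rw [h1, ← Set.preimage_symmDiff, measureReal_preimage_smul _ hr]
  rw [le_inv_mul_iff₀ (by positivity)]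
  linarith

/-- Upper bound for the competitors in the torsional rigidity. -/
lemma exists_integral_sq_le (hN : 2 ≤ N) (hs0 : 0 < s) (hs1 : s < 1) :
    ∃ ε : ℝ, 0 < ε ∧ ∀ (Ω : Set (Eu N)) (r : ℝ), MeasurableSet Ω → volume Ω ≠ ⊤ → 0 < r →
      volume.real Ω = r ^ N * unitBallVol N →
      0 ≤ maxEnergy N s - ε * asym N Ω ^ (3 / s) ∧ ∀ u : Eu N → ℝ, Continuous u →
        HasCompactSupport u → tsupport u ⊆ Ω → gagliardoSqR N s u = 1 →
        (∫ x in Ω, |u x|) ^ 2 ≤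
          r ^ ((N : ℝ) + 2 * s) * (maxEnergy N s - ε * asym N Ω ^ (3 / s)) := by
  obtain ⟨ε, hε, hst⟩ := exists_stability hN hs0 hs1
  refine ⟨ε, hε, fun Ω r hΩ hΩt hr hΩr => ?_⟩
  have hω := unitBallVol_pos N
  set Ω' := (fun x : Eu N => r • x) ⁻¹' Ω with hΩ'
  have hΩ'm : MeasurableSet Ω' := (measurable_const_smul r) hΩ
  have hΩ'v : volume.real Ω' = unitBallVol N := by
    rw [hΩ', measureReal_preimage_smul _ hr, hΩr, inv_mul_cancel_left₀ (by positivity)]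
  have hΩ't : volume Ω' ≠ ⊤ := fun h => by
    rw [measureReal_def, h, ENNReal.toReal_top] at hΩ'v; linarith
  have hst' := fun v hv h0 => hst v Ω' (asym N Ω) hv hΩ'm hΩ't hΩ'v h0 (asym_nonneg Ω)
    (asym_mul_le_symmDiff hΩt hr hΩr)
  constructor
  · have h1 := hst' _ (adm_zero N s) (fun _ _ => rfl)
    have h2 : torsionEnergy N s (fun _ => 0) = 0 := by
      simp [torsionEnergy, gagliardoSqR, gagliardoSq]
    linarith
  intro u hu hc hsupp hgag
  have hgt : gagliardoSq N s u ≠ ⊤ := fun h => by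
    rw [gagliardoSqR, h, ENNReal.toReal_top] at hgag; exact zero_ne_one hgag
  have hmono : gagliardoSq N s (fun x => |u x|) ≤ gagliardoSq N s u :=
    gagliardoSq_mono fun x y => abs_abs_sub_abs_le_abs_sub _ _
  have hzero : ∀ x ∉ Ω, u x = 0 := fun x hx => image_eq_zero_of_notMem_tsupport
    fun h => hx (hsupp h)
  have hadm : Adm N s (fun x => |u x|) := by
    refine ⟨hu.abs.measurable, fun x => abs_nonneg _, ?_, ?_, ne_top_of_le_ne_top hgt hmono⟩
    · obtain ⟨k, hk⟩ := hu.bounded_above_of_compact_support hc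
      exact ⟨k, fun x => by simpa using hk x⟩
    · refine ne_top_of_le_ne_top hΩt (measure_mono fun x hx => ?_)
      by_contra hx'
      exact hx (by simp [hzero x hx'])
  have hg1 : gagliardoSqR N s (fun x => |u x|) ≤ 1 := by
    rw [← hgag]; exact ENNReal.toReal_mono hgt hmono
  have hint : ∫ x in Ω, |u x| = ∫ x, |u x| :=
    setIntegral_eq_integral_of_forall_compl_eq_zero fun x hx => by simp [hzero x hx]
  rw [hint]
  set t := ∫ x, |u x| with ht
  have ht0 : 0 ≤ t := integral_nonneg fun x => abs_nonneg _
  have h1 := hst' _ ((hadm.const_mul ht0).rescale hr 0) (fun x hx => by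
    have : u (r • x + 0) = 0 := hzero _ (by rw [add_zero]; exact hx)
    simp only [rescale, this, abs_zero, mul_zero])
  rw [torsionEnergy_rescale _ hr, torsionEnergy_const_mul, ← ht] at h1
  have h2 : t ^ 2 ≤ 2 * t * t - t ^ 2 * gagliardoSqR N s (fun x => |u x|) := by
    have := mul_le_mul_of_nonneg_left hg1 (sq_nonneg t)
    linarith
  have h3 : r ^ (-(N : ℝ) - 2 * s) = (r ^ ((N : ℝ) + 2 * s))⁻¹ := by
    rw [← Real.rpow_neg hr.le]; congr 1; ring
  rw [h3, inv_mul_le_iff₀ (by positivity)] at h1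
  exact h2.trans h1

end Stability

section Mollify
variable {N : ℕ} {s : ℝ} {u : Eu N → ℝ}

/-- Dilating a competitor so that its support has the volume of the unit ball increases the
energy. -/
lemma Adm.exists_supportVol_eq (h : Adm N s u) (hN : 2 ≤ N) (hs : 0 < s)
    (hS : supportVol u ≤ unitBallVol N) (hD : 0 < torsionEnergy N s u) {c : ℝ}
    (hc : c < torsionEnergy N s u) :
    ∃ v : Eu N → ℝ, Adm N s v ∧ supportVol v = unitBallVol N ∧ c < torsionEnergy N s v := by
  have hω := unitBallVol_pos N
  have hN0 : (0 : ℝ) < N := by exact_mod_cast (by omega : 0 < N)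
  have he : 0 < volExp N s := by unfold volExp; positivity
  have hS0 : 0 < supportVol u := by
    refine (supportVol_nonneg u).lt_of_ne fun h0 => ?_
    have := h.torsionEnergy_le_rpow hN hs
    rw [← h0, zero_div, Real.zero_rpow he.ne', zero_mul] at this
    linarith
  set f := supportVol u / unitBallVol N with hf
  have hf0 : 0 < f := by positivity
  have hf1 : f ≤ 1 := (div_le_one hω).2 hS
  set r := f ^ (1 / (N : ℝ)) with hr
  have hr0 : 0 < r := by positivity
  have hr1 : r ≤ 1 := Real.rpow_le_one hf0.le hf1 (by positivity)
  have hrN : r ^ N = f := by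
    rw [hr, ← Real.rpow_natCast, ← Real.rpow_mul hf0.le, one_div_mul_cancel hN0.ne', Real.rpow_one]
  refine ⟨_, h.rescale hr0 0, ?_, ?_⟩
  · rw [supportVol_rescale h hr0, hrN, hf]; field_simp
  · rw [torsionEnergy_rescale u hr0]
    have h1 : 1 ≤ r ^ (-(N : ℝ) - 2 * s) :=
      Real.one_le_rpow_of_pos_of_le_one_of_nonpos hr0 hr1 (by linarith)
    nlinarith

/-- Near-maximizers supported in a slightly enlarged unit ball. -/
lemma exists_support_subset_ball (hN : 2 ≤ N) (hs0 : 0 < s) (hs1 : s < 1) {δ ℓ : ℝ}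
    (hδ : 0 < δ) (hℓ : 0 < ℓ) :
    ∃ v : Eu N → ℝ, Adm N s v ∧ Function.support v ⊆ Metric.ball 0 (1 + ℓ) ∧
      maxEnergy N s - δ ≤ torsionEnergy N s v := by
  have hω := unitBallVol_pos N
  have hM := maxEnergy_pos hN hs0 hs1
  have hk : 0 < 1 / kerMass N s := one_div_pos.2 (kerMass_pos N s)
  set k := 1 / kerMass N s with hkdef
  set ω := unitBallVol N with hωdef
  set M := maxEnergy N s with hMdef
  obtain ⟨ε, hε, hst⟩ := exists_stability hN hs0 hs1
  set K := M + Real.pi ^ 2 / 2 * k ^ 2 * truncMass N s ℓ * ω with hK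
  have hK0 : 0 < K := by
    have := truncMass_nonneg N s ℓ
    positivity
  set A := δ / (2 * K) with hA
  have hA0 : 0 < A := by positivity
  set η := min (min (ε * A ^ (3 / s)) (δ / 2)) (M / 2) with hη
  have hη0 : 0 < η := lt_min (lt_min (by positivity) (by positivity)) (by positivity)
  obtain ⟨_, ⟨u₀, h₀, hS₀, rfl⟩, hu₀⟩ := exists_lt_of_lt_csSup
    (s := {D | ∃ u : Eu N → ℝ, Adm N s u ∧
      volume (Function.support u) ≤ ENNReal.ofReal (unitBallVol N) ∧ D = torsionEnergy N s u})
    ⟨_, fun _ => 0, adm_zero N s, by simp, rfl⟩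
    (show M - η < M by linarith)
  obtain ⟨u₀, h₀, hS₀, hu₀⟩ := h₀.exists_supportVol_eq hN hs0
    (ENNReal.toReal_le_of_le_ofReal hω.le hS₀)
    (show 0 < torsionEnergy N s u₀ by linarith [min_le_right (min (ε * A ^ (3 / s)) (δ / 2)) (M / 2)])
    hu₀
  have hS₀' : volume (Function.support u₀) ≤ ENNReal.ofReal ω := by
    rw [hωdef, ← hS₀, supportVol]
    exact (ofReal_measureReal h₀.supp).ge
  have h₁ := h₀.min_const hk.le
  have hu₁ := hu₀.trans_le (h₀.torsionEnergy_le_min hN hs0 hS₀')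
  have huk : ∀ x, min (u₀ x) k ≤ k := fun x => min_le_right _ _
  have hS₁ : supportVol (fun x => min (u₀ x) k) = ω := by
    rw [supportVol, support_min_const hk]
    exact hS₀
  set u := fun x => min (u₀ x) k
  obtain ⟨p, hp⟩ : ∃ p, volume.real (Function.support u \ Metric.closedBall p 1) ≤ A * ω := by
    by_contra! hcon
    have h2 := hst u (Function.support u) A h₁ h₁.supp_measurable h₁.supp hS₁
      (fun x hx => Function.notMem_support.1 hx) hA0.le (fun p => (hcon p).le.trans
        (measureReal_mono (fun x hx => Or.inl ⟨hx.1, fun h => hx.2 (Metric.ball_subset_closedBall h)⟩)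
          (measure_symmDiff_ne_top h₁.supp measure_ball_lt_top.ne)))
    have h3 : η ≤ ε * A ^ (3 / s) := (min_le_left _ _).trans (min_le_left _ _)
    linarith
  obtain ⟨v, w, hv, hw, -, hvS, hwS, hD⟩ := h₁.exists_cut hN hs0 hs1 huk p 1 hℓ
  refine ⟨rescale s 1 p v, hv.rescale one_pos p, ?_, ?_⟩
  · intro x hx
    have h1 : v ((1 : ℝ) • x + p) ≠ 0 := fun h => hx (by simp only [rescale, h, mul_zero])
    have h2 := (hvS h1).2
    rw [mem_ball_iff_norm] at h2
    rw [mem_ball_zero_iff]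
    simpa using h2
  · rw [torsionEnergy_rescale _ one_pos, Real.one_rpow, one_mul]
    set f := volume.real (Function.support u \ Metric.closedBall p 1) with hf
    have hwf : supportVol w ≤ f := measureReal_mono hwS
      (ne_top_of_le_ne_top h₁.supp (measure_mono Set.sdiff_subset))
    have hfS : f ≤ ω := (measureReal_mono Set.sdiff_subset h₁.supp).trans hS₁.le
    have hDw : torsionEnergy N s w ≤ M * A := by
      refine (hw.torsionEnergy_le_linear hN hs0 hs1 (hwf.trans hfS)).trans ?_
      gcongr
      rw [div_le_iff₀ hω]; exact hwf.trans hp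
    have hE : Real.pi ^ 2 / 2 * k ^ 2 * truncMass N s ℓ * f ≤
        Real.pi ^ 2 / 2 * k ^ 2 * truncMass N s ℓ * (A * ω) := by
      have := truncMass_nonneg N s ℓ
      gcongr
    have hKA : K * A = δ / 2 := by rw [hA]; field_simp
    have h1 : η ≤ δ / 2 := (min_le_left _ _).trans (min_le_right _ _)
    rw [hK] at hKA
    linarith

end Mollify

section Convolution
variable {N : ℕ} {s : ℝ} {u : Eu N → ℝ}

/-- Jensen's inequality for a weighted average of a bounded function. -/
lemma sq_integral_mul_le {ψ f : Eu N → ℝ} (hψ : Integrable ψ) (h0 : ∀ x, 0 ≤ ψ x)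
    (h1 : ∫ x, ψ x = 1) (hf : Measurable f) {k : ℝ} (hk : ∀ x, |f x| ≤ k) :
    ENNReal.ofReal ((∫ x, ψ x * f x) ^ 2) ≤
      ∫⁻ x, ENNReal.ofReal (ψ x) * ENNReal.ofReal (f x ^ 2) := by
  have i1 : Integrable fun x => ψ x * f x :=
    hψ.mul_bdd hf.aestronglyMeasurable (Eventually.of_forall hk)
  have i2 : Integrable fun x => ψ x * f x ^ 2 := by
    refine hψ.mul_bdd (c := k ^ 2) (hf.pow_const 2).aestronglyMeasurable
      (Eventually.of_forall fun x => ?_)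
    rw [Real.norm_eq_abs, abs_pow]
    have := hk x
    gcongr
  set c := ∫ x, ψ x * f x with hc
  have h2 : 0 ≤ ∫ x, ψ x * (f x - c) ^ 2 :=
    integral_nonneg fun x => mul_nonneg (h0 x) (sq_nonneg _)
  have h3 : ∫ x, ψ x * (f x - c) ^ 2 = (∫ x, ψ x * f x ^ 2) - 2 * c * c + c ^ 2 := by
    have e : ∀ x, ψ x * (f x - c) ^ 2 = ψ x * f x ^ 2 - 2 * c * (ψ x * f x) + c ^ 2 * ψ x :=
      fun x => by ring
    have i3 : Integrable fun x => ψ x * f x ^ 2 - 2 * c * (ψ x * f x) := i2.sub (i1.const_mul _)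
    simp_rw [e]
    rw [integral_add i3 (hψ.const_mul _), integral_sub i2 (i1.const_mul _),
      integral_const_mul, integral_const_mul, h1, mul_one]
  calc ENNReal.ofReal (c ^ 2) ≤ ENNReal.ofReal (∫ x, ψ x * f x ^ 2) :=
        ENNReal.ofReal_le_ofReal (by linarith)
    _ = ∫⁻ x, ENNReal.ofReal (ψ x * f x ^ 2) :=
        ofReal_integral_eq_lintegral_ofReal i2
          (Eventually.of_forall fun x => mul_nonneg (h0 x) (sq_nonneg _))
    _ = _ := lintegral_congr fun x => ENNReal.ofReal_mul (h0 x)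

/-- Averaging a double integral over simultaneous translations. -/
lemma lintegral_translate_average {w : Eu N → ℝ≥0∞} (hw : Measurable w)
    {F : Eu N → Eu N → ℝ≥0∞} (hF : Measurable fun p : Eu N × Eu N => F p.1 p.2) :
    ∫⁻ x, ∫⁻ y, ∫⁻ t, w t * F (x - t) (y - t) = (∫⁻ t, w t) * ∫⁻ x, ∫⁻ y, F x y := by
  have hd : Measurable fun p : (Eu N × Eu N) × Eu N => (p.1.1 - p.2, p.1.2 - p.2) :=
    ((measurable_fst.comp measurable_fst).sub measurable_snd).prodMk
      ((measurable_snd.comp measurable_fst).sub measurable_snd)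
  have hG : Measurable fun p : (Eu N × Eu N) × Eu N => w p.2 * F (p.1.1 - p.2) (p.1.2 - p.2) :=
    (hw.comp measurable_snd).mul (hF.comp hd)
  have h1 : ∀ x, ∫⁻ y, ∫⁻ t, w t * F (x - t) (y - t) = ∫⁻ t, ∫⁻ y, w t * F (x - t) (y - t) := by
    intro x
    refine lintegral_lintegral_swap (Measurable.aemeasurable ?_)
    have hm : Measurable fun p : Eu N × Eu N => ((x, p.1), p.2) :=
      (measurable_const.prodMk measurable_fst).prodMk measurable_snd
    exact hG.comp hm
  have h2 : Measurable fun p : Eu N × Eu N => ∫⁻ y, w p.2 * F (p.1 - p.2) (y - p.2) := by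
    have hm : Measurable fun q : (Eu N × Eu N) × Eu N => ((q.1.1, q.2), q.1.2) :=
      ((measurable_fst.comp measurable_fst).prodMk measurable_snd).prodMk
        (measurable_snd.comp measurable_fst)
    exact (hG.comp hm).lintegral_prod_right'
  have hFy : ∀ x, Measurable fun y => F x y := fun x => hF.comp (measurable_const.prodMk measurable_id)
  have hFx : Measurable fun x => ∫⁻ y, F x y := hF.lintegral_prod_right'
  calc ∫⁻ x, ∫⁻ y, ∫⁻ t, w t * F (x - t) (y - t)
      = ∫⁻ x, ∫⁻ t, ∫⁻ y, w t * F (x - t) (y - t) := lintegral_congr h1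
    _ = ∫⁻ t, ∫⁻ x, ∫⁻ y, w t * F (x - t) (y - t) := lintegral_lintegral_swap h2.aemeasurable
    _ = ∫⁻ t, w t * ∫⁻ x, ∫⁻ y, F x y := by
        refine lintegral_congr fun t => ?_
        have h3 : ∀ x, ∫⁻ y, w t * F (x - t) (y - t) = w t * ∫⁻ y, F (x - t) y := by
          intro x
          rw [lintegral_sub_right_eq_self (fun y => w t * F (x - t) y) t,
            lintegral_const_mul _ (hFy _)]
        rw [lintegral_congr h3,
          lintegral_sub_right_eq_self (fun x => w t * ∫⁻ y, F x y) t, lintegral_const_mul _ hFx]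
    _ = _ := lintegral_mul_const _ hw

/-- Convolution with a probability density does not increase the Gagliardo seminorm. -/
lemma gagliardoSq_average_le {ψ : Eu N → ℝ} (hψ : Integrable ψ) (hm : Measurable ψ)
    (h0 : ∀ x, 0 ≤ ψ x) (h1 : ∫ x, ψ x = 1) (hu : Measurable u) {k : ℝ} (hk : ∀ x, |u x| ≤ k) :
    gagliardoSq N s (fun x => ∫ t, ψ t * u (x - t)) ≤ gagliardoSq N s u := by
  have h2 : ∫⁻ t, ENNReal.ofReal (ψ t) = 1 := by
    rw [← ofReal_integral_eq_lintegral_ofReal hψ (Eventually.of_forall h0), h1, ENNReal.ofReal_one]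
  have hum : ∀ x, Measurable fun t => u (x - t) := fun x => hu.comp (measurable_const.sub measurable_id)
  have hi : ∀ x, Integrable fun t => ψ t * u (x - t) := fun x =>
    hψ.mul_bdd (hum x).aestronglyMeasurable (Eventually.of_forall fun t => hk (x - t))
  have key : ∀ x y, ENNReal.ofReal (gagInt N s (fun x => ∫ t, ψ t * u (x - t)) x y) ≤
      ∫⁻ t, ENNReal.ofReal (ψ t) * ENNReal.ofReal (gagInt N s u (x - t) (y - t)) := by
    intro x y
    have h3 := sq_integral_mul_le hψ h0 h1 (f := fun t => u (x - t) - u (y - t)) ((hum x).sub (hum y))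
      (k := 2 * k) (fun t => (abs_sub _ _).trans (by linarith [hk (x - t), hk (y - t)]))
    have h4 : ∫ t, ψ t * (u (x - t) - u (y - t)) = (∫ t, ψ t * u (x - t)) - ∫ t, ψ t * u (y - t) := by
      rw [← integral_sub (hi x) (hi y)]
      exact integral_congr_ae (Eventually.of_forall fun t => mul_sub _ _ _)
    rw [h4] at h3
    have h5 : Measurable fun t => ENNReal.ofReal (ψ t) * ENNReal.ofReal ((u (x - t) - u (y - t)) ^ 2) :=
      hm.ennreal_ofReal.mul (((hum x).sub (hum y)).pow_const 2).ennreal_ofReal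
    calc _ = ENNReal.ofReal (((∫ t, ψ t * u (x - t)) - ∫ t, ψ t * u (y - t)) ^ 2) *
          ENNReal.ofReal (fracKernel N s (x - y)) := by
          rw [gagInt_eq, sq_abs, ENNReal.ofReal_mul (sq_nonneg _)]
      _ ≤ (∫⁻ t, ENNReal.ofReal (ψ t) * ENNReal.ofReal ((u (x - t) - u (y - t)) ^ 2)) *
          ENNReal.ofReal (fracKernel N s (x - y)) := by gcongr
      _ = _ := by
          rw [← lintegral_mul_const _ h5]
          refine lintegral_congr fun t => ?_
          rw [gagInt_eq, sq_abs, ENNReal.ofReal_mul (sq_nonneg _), mul_assoc, sub_sub_sub_cancel_right]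
  have hF : Measurable fun p : Eu N × Eu N => ENNReal.ofReal (gagInt N s u p.1 p.2) :=
    (measurable_gagInt hu).ennreal_ofReal
  rw [gagliardoSq_eq, gagliardoSq_eq]
  refine (lintegral_mono fun x => lintegral_mono fun y => key x y).trans ?_
  rw [lintegral_translate_average (F := fun x y => ENNReal.ofReal (gagInt N s u x y))
    hm.ennreal_ofReal hF, h2, one_mul]

/-- Smooth approximation of compactly supported admissible functions, with the same mass and
no larger seminorm. -/
lemma Adm.exists_contDiff (h : Adm N s u) {R ρ : ℝ} (hρ : 0 < ρ)
    (hR : Function.support u ⊆ Metric.ball 0 R) :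
    ∃ V : Eu N → ℝ, Adm N s V ∧ ContDiff ℝ (⊤ : ℕ∞) V ∧
      tsupport V ⊆ Metric.ball 0 (R + 2 * ρ) ∧ torsionEnergy N s u ≤ torsionEnergy N s V := by
  obtain ⟨k, hk⟩ := h.bdd
  have hk' : ∀ x, |u x| ≤ k := fun x => by rw [abs_of_nonneg (h.nonneg x)]; exact hk x
  let φ : ContDiffBump (0 : Eu N) := ⟨ρ / 2, ρ, by positivity, by linarith⟩
  set ψ : Eu N → ℝ := φ.normed volume with hψ
  have hψi : Integrable ψ := φ.integrable_normed
  have hψ0 : ∀ x, 0 ≤ ψ x := φ.nonneg_normed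
  have hψ1 : ∫ x, ψ x = 1 := φ.integral_normed
  have hψd : ContDiff ℝ (⊤ : ℕ∞) ψ := φ.contDiff_normed
  have hψs : Function.support ψ = Metric.ball 0 ρ := φ.support_normed_eq
  set V : Eu N → ℝ := fun x => ∫ t, ψ t * u (x - t) with hV
  have hVc : V = convolution ψ u (ContinuousLinearMap.mul ℝ ℝ) volume := rfl
  have hVd : ContDiff ℝ (⊤ : ℕ∞) V := by
    rw [hVc]
    exact HasCompactSupport.contDiff_convolution_left _ φ.hasCompactSupport_normed hψd
      h.integrable.locallyIntegrable
  have hVs : Function.support V ⊆ Metric.ball 0 (R + ρ) := by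
    rw [hVc]
    refine (support_convolution_subset _).trans ?_
    rw [hψs]
    rintro _ ⟨a, ha, b, hb, rfl⟩
    have h1 := mem_ball_zero_iff.1 ha
    have h2 := mem_ball_zero_iff.1 (hR hb)
    exact mem_ball_zero_iff.2 ((norm_add_le a b).trans_lt (by linarith))
  have hVg : gagliardoSq N s V ≤ gagliardoSq N s u :=
    gagliardoSq_average_le hψi hψd.continuous.measurable hψ0 hψ1 h.meas hk'
  have hVi : ∫ x, V x = ∫ x, u x := by
    rw [hVc, integral_convolution _ hψi h.integrable, hψ1]
    simp
  have hum : ∀ x, Measurable fun t => u (x - t) :=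
    fun x => h.meas.comp (measurable_const.sub measurable_id)
  refine ⟨V, ⟨hVd.continuous.measurable, fun x => integral_nonneg fun t =>
    mul_nonneg (hψ0 t) (h.nonneg _), ⟨k, fun x => ?_⟩, ?_, ne_top_of_le_ne_top h.gag hVg⟩, hVd, ?_, ?_⟩
  · calc V x ≤ ∫ t, ψ t * k := integral_mono
          (hψi.mul_bdd (hum x).aestronglyMeasurable (Eventually.of_forall fun t => hk' (x - t)))
          (hψi.mul_const k) fun t => mul_le_mul_of_nonneg_left (hk _) (hψ0 t)
      _ = k := by rw [integral_mul_const, hψ1, one_mul]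
  · exact ne_top_of_le_ne_top measure_ball_lt_top.ne (measure_mono hVs)
  · refine (closure_mono hVs).trans (Metric.closure_ball_subset_closedBall.trans ?_)
    exact Metric.closedBall_subset_ball (by linarith)
  · unfold torsionEnergy gagliardoSqR
    have := ENNReal.toReal_mono h.gag hVg
    rw [hVi]
    linarith

end Convolution

section Torsion
variable {N : ℕ} {s : ℝ} {u : Eu N → ℝ}

/-- The values whose supremum is the torsional rigidity. -/
def torsionSet (N : ℕ) (s : ℝ) (Ω : Set (Eu N)) : Set ℝ :=
  {c : ℝ | ∃ u : Eu N → ℝ, ContDiff ℝ (⊤ : ℕ∞) u ∧ HasCompactSupport u ∧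
    tsupport u ⊆ Ω ∧ gagliardoSqR N s u = 1 ∧ c = (∫ x in Ω, |u x|) ^ 2}

/-- A function with positive energy has positive seminorm. -/
lemma Adm.gagliardoSqR_pos (h : Adm N s u) (hN : 2 ≤ N) (hs : 0 < s)
    (hD : 0 < torsionEnergy N s u) : 0 < gagliardoSqR N s u := by
  refine (gagliardoSqR_nonneg N s u).lt_of_ne fun h0 => ?_
  have hI : 0 < ∫ x, u x := by
    unfold torsionEnergy at hD
    linarith
  set I := ∫ x, u x
  set C := (supportVol u / unitBallVol N) ^ volExp N s * maxEnergy N s with hC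
  have hb : ∀ t : ℝ, 0 < t → 2 * t * I ≤ C := by
    intro t ht
    have h1 := (h.const_mul ht.le).torsionEnergy_le_rpow hN hs
    have h2 : Function.support (fun x => t * u x) = Function.support u := by
      ext x; simp [ht.ne']
    rwa [torsionEnergy_const_mul, ← h0, mul_zero, sub_zero, supportVol, h2, ← supportVol,
      ← hC] at h1
  have h1 := hb (max C 0 + 1) (by positivity)
  have h3 := hb (max C 0 / I + 1) (by positivity)
  have h4 : 2 * (max C 0 / I + 1) * I = 2 * max C 0 + 2 * I := by field_simp
  linarith [le_max_left C 0, le_max_right C 0]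

/-- The energy of a smooth competitor is bounded by the torsional rigidity. -/
lemma Adm.torsionEnergy_le_torsion (h : Adm N s u) (hN : 2 ≤ N) (hs : 0 < s)
    (hD : 0 < torsionEnergy N s u) (hd : ContDiff ℝ (⊤ : ℕ∞) u) (hc : HasCompactSupport u)
    {Ω : Set (Eu N)} (hΩ : tsupport u ⊆ Ω) (hb : BddAbove (torsionSet N s Ω)) :
    torsionEnergy N s u ≤ torsion N s Ω := by
  have hg := h.gagliardoSqR_pos hN hs hD
  set g := gagliardoSqR N s u with hgdef
  set I := ∫ x, u x with hI
  set t := 1 / √g with ht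
  have ht0 : 0 < t := by positivity
  have htg : t ^ 2 * g = 1 := by
    rw [ht, div_pow, Real.sq_sqrt hg.le]; field_simp
  have hts : tsupport (fun x => t * u x) ⊆ tsupport u :=
    closure_mono fun x hx hu => hx (by simp only [hu, mul_zero])
  have hmem : (t * I) ^ 2 ∈ torsionSet N s Ω := by
    refine ⟨fun x => t * u x, contDiff_const.mul hd, hc.mul_left, hts.trans hΩ, ?_, ?_⟩
    · rw [gagliardoSqR_const_mul, ← hgdef, htg]
    · have h1 : ∀ x, |t * u x| = t * u x := fun x => abs_of_nonneg (mul_nonneg ht0.le (h.nonneg x))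
      simp_rw [h1]
      rw [setIntegral_eq_integral_of_forall_compl_eq_zero, integral_const_mul]
      intro x hx
      rw [image_eq_zero_of_notMem_tsupport fun h => hx (hΩ h), mul_zero]
  refine le_trans ?_ (le_csSup hb hmem)
  have h2 : torsionEnergy N s u = 2 * I - g := rfl
  have h3 : 0 ≤ (t * I - t * g) ^ 2 := sq_nonneg _
  have h4 : (t * I - t * g) ^ 2 = (t * I) ^ 2 - 2 * I * (t ^ 2 * g) + (t ^ 2 * g) * g := by ring
  rw [h4, htg] at h3
  linarith

/-- Smooth competitors in a ball with energy close to optimal. -/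
lemma exists_contDiff_ball (hN : 2 ≤ N) (hs0 : 0 < s) (hs1 : s < 1) (x₀ : Eu N) {r ℓ δ : ℝ}
    (hr : 0 < r) (hℓ : 0 < ℓ) (hδ : 0 < δ) :
    ∃ W : Eu N → ℝ, Adm N s W ∧ ContDiff ℝ (⊤ : ℕ∞) W ∧ HasCompactSupport W ∧
      tsupport W ⊆ Metric.ball x₀ r ∧
      ((1 + 3 * ℓ) / r) ^ (-(N : ℝ) - 2 * s) * (maxEnergy N s - δ) ≤ torsionEnergy N s W := by
  obtain ⟨v, hv, hvS, hvD⟩ := exists_support_subset_ball hN hs0 hs1 hδ hℓ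
  obtain ⟨V, hV, hVd, hVS, hVD⟩ := hv.exists_contDiff hℓ hvS
  set a := (1 + 3 * ℓ) / r with ha
  have ha0 : 0 < a := by positivity
  have hcont : Continuous fun x : Eu N => a • x + -(a • x₀) := by fun_prop
  have hsub : tsupport (rescale s a (-(a • x₀)) V) ⊆
      (fun x : Eu N => a • x + -(a • x₀)) ⁻¹' tsupport V := by
    refine closure_minimal (fun x hx => subset_closure fun h => hx ?_)
      ((isClosed_tsupport V).preimage hcont)
    simp only [rescale]
    rw [h, mul_zero]
  have hball : tsupport (rescale s a (-(a • x₀)) V) ⊆ Metric.ball x₀ r := by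
    intro x hx
    have h1 : ‖a • x + -(a • x₀)‖ < 1 + ℓ + 2 * ℓ := mem_ball_zero_iff.1 (hVS (hsub hx))
    rw [← sub_eq_add_neg, ← smul_sub, norm_smul, Real.norm_eq_abs, abs_of_pos ha0] at h1
    rw [mem_ball_iff_norm]
    have h2 : a * r = 1 + ℓ + 2 * ℓ := by rw [ha]; field_simp; ring
    rw [← h2] at h1
    exact lt_of_mul_lt_mul_left h1 ha0.le
  refine ⟨rescale s a (-(a • x₀)) V, hV.rescale ha0 _, ?_, ?_, hball, ?_⟩
  · unfold rescale
    exact contDiff_const.mul (hVd.comp (by fun_prop))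
  · exact Metric.isCompact_of_isClosed_isBounded (isClosed_tsupport _)
      (Metric.isBounded_ball.subset hball)
  · rw [torsionEnergy_rescale V ha0]
    have : 0 ≤ a ^ (-(N : ℝ) - 2 * s) := by positivity
    exact mul_le_mul_of_nonneg_left (hvD.trans hVD) this

/-- The torsional rigidity of a ball is at least the scaled maximal energy. -/
lemma le_torsion_ball (hN : 2 ≤ N) (hs0 : 0 < s) (hs1 : s < 1) (x₀ : Eu N) {r : ℝ} (hr : 0 < r)
    (hb : BddAbove (torsionSet N s (Metric.ball x₀ r))) :
    r ^ ((N : ℝ) + 2 * s) * maxEnergy N s ≤ torsion N s (Metric.ball x₀ r) := by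
  have hM := maxEnergy_pos hN hs0 hs1
  have hlim : Tendsto (fun ℓ : ℝ => ((1 + 3 * ℓ) / r) ^ (-(N : ℝ) - 2 * s) * (maxEnergy N s - ℓ))
      (𝓝[>] 0) (𝓝 (((1 + 3 * 0) / r) ^ (-(N : ℝ) - 2 * s) * (maxEnergy N s - 0))) := by
    refine Tendsto.mono_left (ContinuousAt.tendsto (x := (0 : ℝ)) ?_) nhdsWithin_le_nhds
    refine ContinuousAt.mul (ContinuousAt.rpow_const (by fun_prop) (Or.inl ?_)) (by fun_prop)
    positivity
  have he : ((1 + 3 * 0) / r) ^ (-(N : ℝ) - 2 * s) * (maxEnergy N s - 0) =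
      r ^ ((N : ℝ) + 2 * s) * maxEnergy N s := by
    rw [mul_zero, add_zero, sub_zero, one_div, Real.inv_rpow hr.le, ← Real.rpow_neg hr.le]
    congr 2; ring
  rw [he] at hlim
  refine le_of_tendsto hlim ?_
  filter_upwards [Ioo_mem_nhdsGT hM] with ℓ hℓ
  obtain ⟨W, hW, hWd, hWc, hWS, hWD⟩ := exists_contDiff_ball hN hs0 hs1 x₀ hr hℓ.1 hℓ.1
  have h1 : 0 < ((1 + 3 * ℓ) / r) ^ (-(N : ℝ) - 2 * s) * (maxEnergy N s - ℓ) := by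
    have := hℓ.1
    have := sub_pos.2 hℓ.2
    positivity
  exact hWD.trans (hW.torsionEnergy_le_torsion hN hs0 (h1.trans_le hWD) hWd hWc hWS hb)

end Torsion

/-- **Quantitative Saint-Venant type inequality** (Corollary 1.3). -/
theorem quantitative_fractional_torsion
    (N : ℕ) (hN : 2 ≤ N) (s : ℝ) (hs0 : 0 < s) (hs1 : s < 1) :
    ∃ σ₂ : ℝ, 0 < σ₂ ∧
      ∀ Ω : Set (Eu N), IsOpen Ω → volume Ω ≠ ⊤ → 0 < volume Ω →
      ∀ (x₀ : Eu N) (r : ℝ), 0 < r →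
        torsion N s (Metric.ball x₀ r)
            / (volume (Metric.ball x₀ r)).toReal ^ (((N : ℝ) + 2 * s) / N)
          - torsion N s Ω / (volume Ω).toReal ^ (((N : ℝ) + 2 * s) / N)
          ≥ σ₂ * (1 - s) * asym N Ω ^ (3 / s) := by
  have hω := unitBallVol_pos N
  have hN0 : (0 : ℝ) < N := by exact_mod_cast (by omega : 0 < N)
  have h1s : 0 < 1 - s := sub_pos.2 hs1
  set ω := unitBallVol N with hωdef
  set e := ((N : ℝ) + 2 * s) / N with he
  have hωe : 0 < ω ^ e := by positivity
  have hpow : ∀ r : ℝ, 0 < r → (r ^ N * ω) ^ e = r ^ ((N : ℝ) + 2 * s) * ω ^ e := by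
    intro r hr
    rw [Real.mul_rpow (by positivity) hω.le, ← Real.rpow_natCast, ← Real.rpow_mul hr.le, he,
      mul_div_cancel₀ _ hN0.ne']
  obtain ⟨ε, hε, H⟩ := exists_integral_sq_le hN hs0 hs1
  refine ⟨ε / ((1 - s) * ω ^ e), by positivity, fun Ω hΩ hΩt hΩ0 x₀ r hr => ?_⟩
  set R := (volume.real Ω / ω) ^ (1 / (N : ℝ)) with hR
  have hv : 0 < volume.real Ω := ENNReal.toReal_pos hΩ0.ne' hΩt
  have hR0 : 0 < R := by positivity
  have hRN : volume.real Ω = R ^ N * ω := by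
    rw [hR, ← Real.rpow_natCast, ← Real.rpow_mul (by positivity), one_div_mul_cancel hN0.ne',
      Real.rpow_one]
    field_simp
  obtain ⟨h0, hle⟩ := H Ω R hΩ.measurableSet hΩt hR0 hRN
  have hup : torsion N s Ω ≤
      R ^ ((N : ℝ) + 2 * s) * (maxEnergy N s - ε * asym N Ω ^ (3 / s)) := by
    refine Real.sSup_le ?_ (by positivity)
    rintro c ⟨u, hu, huc, huS, hug, rfl⟩
    exact hle u hu.continuous huc huS hug
  have hlow := le_torsion_ball hN hs0 hs1 x₀ hr (by
    refine ⟨r ^ ((N : ℝ) + 2 * s) *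
      (maxEnergy N s - ε * asym N (Metric.ball x₀ r) ^ (3 / s)), ?_⟩
    rintro c ⟨u, hu, huc, huS, hug, rfl⟩
    exact (H (Metric.ball x₀ r) r measurableSet_ball measure_ball_lt_top.ne hr
      (measureReal_ball_eq x₀ hr)).2 u hu.continuous huc huS hug)
  have hp1 := hpow r hr
  have hp2 := hpow R hR0
  rw [← hRN] at hp2
  rw [hωdef, ← measureReal_ball_eq x₀ hr, ← hωdef] at hp1
  rw [← measureReal_def, ← measureReal_def, hp1, hp2]
  have hrp : 0 < r ^ ((N : ℝ) + 2 * s) := by positivity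
  have hRp : 0 < R ^ ((N : ℝ) + 2 * s) := by positivity
  have k1 : maxEnergy N s / ω ^ e ≤
      torsion N s (Metric.ball x₀ r) / (r ^ ((N : ℝ) + 2 * s) * ω ^ e) := by
    rw [div_le_div_iff₀ hωe (by positivity)]
    calc _ = (r ^ ((N : ℝ) + 2 * s) * maxEnergy N s) * ω ^ e := by ring
      _ ≤ _ := by gcongr
  have k2 : torsion N s Ω / (R ^ ((N : ℝ) + 2 * s) * ω ^ e) ≤
      (maxEnergy N s - ε * asym N Ω ^ (3 / s)) / ω ^ e := by
    rw [div_le_div_iff₀ (by positivity) hωe]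
    calc _ ≤ (R ^ ((N : ℝ) + 2 * s) * (maxEnergy N s - ε * asym N Ω ^ (3 / s))) * ω ^ e := by
          gcongr
      _ = _ := by ring
  have k3 : ε / ((1 - s) * ω ^ e) * (1 - s) * asym N Ω ^ (3 / s) =
      maxEnergy N s / ω ^ e - (maxEnergy N s - ε * asym N Ω ^ (3 / s)) / ω ^ e := by
    field_simp; ring
  rw [k3]
  linarith
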